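/- Let k be a positive integer. There exists a constant c = c(k) > 0 such that for every intersective polynomial h ∈ ℤ[x] of degree k there is a constant C = C(h) > 0 with the following property: for every integer N ≥ 100 and every subset A ⊆ {1,…,N} such that the equation a − b = h(n) has no solutions with a, b ∈ A, a ≠ b, and n a positive integer, one has |A| ≤ C · N · (log N)^{−c·log log log N}. -/

import Mathlib

set_option linter.all false
namespace BM
open Finset

section Omega
variable {ι : Type*} [Fintype ι] [DecidableEq ι] {Ω : ι → Type*} [∀ i, Fintype (Ω i)]
  [∀ i, Nonempty (Ω i)]

noncomputable def ex (F : (∀ i, Ω i) → ℝ) : ℝ := (∑ x, F x) / Fintype.card (∀ i, Ω i)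

noncomputable def cE (A : Finset ι) (F : (∀ i, Ω i) → ℝ) (x : ∀ i, Ω i) : ℝ :=
  ex (fun y => F (A.piecewise x y))

lemma card_pos' : (0 : ℝ) < Fintype.card (∀ i, Ω i) := by
  exact_mod_cast Fintype.card_pos

lemma ex_add (F G : (∀ i, Ω i) → ℝ) : ex (fun x => F x + G x) = ex F + ex G := by
  simp [ex, sum_add_distrib, add_div]

lemma ex_sub (F G : (∀ i, Ω i) → ℝ) : ex (fun x => F x - G x) = ex F - ex G := by
  simp [ex, sum_sub_distrib, sub_div]

lemma ex_smul (c : ℝ) (F : (∀ i, Ω i) → ℝ) : ex (fun x => c * F x) = c * ex F := by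
  simp [ex, ← mul_sum, mul_div_assoc]

lemma ex_const (c : ℝ) : ex (fun _ : (∀ i, Ω i) => c) = c := by
  have := card_pos' (Ω := Ω)
  simp only [ex, sum_const, card_univ, nsmul_eq_mul]
  field_simp

lemma ex_sum {κ : Type*} (s : Finset κ) (F : κ → (∀ i, Ω i) → ℝ) :
    ex (fun x => ∑ j ∈ s, F j x) = ∑ j ∈ s, ex (F j) := by
  simp only [ex]
  rw [sum_comm, sum_div]

lemma ex_mono {F G : (∀ i, Ω i) → ℝ} (h : ∀ x, F x ≤ G x) : ex F ≤ ex G := by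
  unfold ex
  gcongr with x
  exact h x

lemma ex_nonneg {F : (∀ i, Ω i) → ℝ} (h : ∀ x, 0 ≤ F x) : 0 ≤ ex F := by
  have := ex_mono (F := fun _ => 0) (G := F) h
  rwa [ex_const] at this

lemma ex_abs_le {F : (∀ i, Ω i) → ℝ} {c : ℝ} (h : ∀ x, |F x| ≤ c) : |ex F| ≤ c := by
  rw [abs_le]
  constructor
  · have := ex_mono (F := fun _ => -c) (G := F) (fun x => (abs_le.1 (h x)).1)
    rwa [ex_const] at this
  · have := ex_mono (G := fun _ => c) (F := F) (fun x => (abs_le.1 (h x)).2)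
    rwa [ex_const] at this

lemma ex_piecewise (B : Finset ι) (Φ : (∀ i, Ω i) → ℝ) :
    ex (fun y => ex (fun y' => Φ (B.piecewise y y'))) = ex Φ := by
  have hbij : ∑ p : (∀ i, Ω i) × (∀ i, Ω i), Φ (B.piecewise p.1 p.2)
      = ∑ p : (∀ i, Ω i) × (∀ i, Ω i), Φ p.1 := by
    let e : (∀ i, Ω i) × (∀ i, Ω i) → (∀ i, Ω i) × (∀ i, Ω i) :=
      fun p => (B.piecewise p.1 p.2, B.piecewise p.2 p.1)
    have he : Function.Involutive e := by
      intro p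
      refine Prod.ext ?_ ?_ <;> funext i <;> by_cases hi : i ∈ B <;> simp [e, hi]
    exact Fintype.sum_equiv he.toPerm _ _ (fun p => rfl)
  have hc := card_pos' (Ω := Ω)
  rw [Fintype.sum_prod_type, Fintype.sum_prod_type] at hbij
  simp only [ex, ← sum_div]
  rw [hbij]
  simp only [sum_const, card_univ, nsmul_eq_mul, ← mul_sum]
  field_simp

lemma cE_add (A : Finset ι) (F G : (∀ i, Ω i) → ℝ) :
    cE A (fun x => F x + G x) = fun x => cE A F x + cE A G x := by
  funext x; exact ex_add _ _

lemma cE_smul (A : Finset ι) (c : ℝ) (F : (∀ i, Ω i) → ℝ) :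
    cE A (fun x => c * F x) = fun x => c * cE A F x := by
  funext x; exact ex_smul _ _

lemma cE_sum {κ : Type*} (A : Finset ι) (s : Finset κ) (F : κ → (∀ i, Ω i) → ℝ) :
    cE A (fun x => ∑ j ∈ s, F j x) = fun x => ∑ j ∈ s, cE A (F j) x := by
  funext x; exact ex_sum _ _

lemma cE_nonneg (A : Finset ι) {F : (∀ i, Ω i) → ℝ} (h : ∀ x, 0 ≤ F x) (x) :
    0 ≤ cE A F x := ex_nonneg (fun _ => h _)

lemma cE_univ (F : (∀ i, Ω i) → ℝ) : cE univ F = F := by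
  funext x; simp [cE, ex_const]

lemma cE_empty (F : (∀ i, Ω i) → ℝ) (x) : cE ∅ F x = ex F := by
  simp [cE]

lemma cE_cE (A B : Finset ι) (F : (∀ i, Ω i) → ℝ) : cE A (cE B F) = cE (A ∩ B) F := by
  funext x
  have : ∀ y y' : (∀ i, Ω i), B.piecewise (A.piecewise x y) y'
      = (A ∩ B).piecewise x (B.piecewise y y') := by
    intro y y'; funext i
    by_cases h1 : i ∈ A <;> by_cases h2 : i ∈ B <;> simp [h1, h2]
  simp only [cE, this]
  exact ex_piecewise B (fun z => F ((A ∩ B).piecewise x z))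

lemma ex_cE (A : Finset ι) (F : (∀ i, Ω i) → ℝ) : ex (cE A F) = ex F := by
  have h := cE_cE ∅ A F
  have x : ∀ i, Ω i := Classical.arbitrary _
  have := congrFun h x
  rw [empty_inter, cE_empty, cE_empty] at this
  exact this

lemma cE_mul_left (A : Finset ι) (g F : (∀ i, Ω i) → ℝ)
    (hg : ∀ x y, g (A.piecewise x y) = g x) :
    cE A (fun x => g x * F x) = fun x => g x * cE A F x := by
  funext x
  simp only [cE, hg]
  exact ex_smul _ _

lemma ex_CS (F G : (∀ i, Ω i) → ℝ) :
    (ex (fun x => F x * G x)) ^ 2 ≤ ex (fun x => F x ^ 2) * ex (fun x => G x ^ 2) := by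
  have hc := card_pos' (Ω := Ω)
  have := Finset.sum_mul_sq_le_sq_mul_sq univ F G
  simp only [ex]
  rw [div_pow, div_mul_div_comm, ← sq]
  gcongr

lemma cE_CS (A : Finset ι) (F G : (∀ i, Ω i) → ℝ) (x) :
    (cE A (fun x => F x * G x) x) ^ 2 ≤ cE A (fun x => F x ^ 2) x * cE A (fun x => G x ^ 2) x :=
  ex_CS _ _

end Omega

set_option maxHeartbeats 1000000 in
lemma pointwise_ineq {r : ℕ} (hr : 1 ≤ r) {a t b : ℝ} (ha : 0 ≤ a) (hb : 0 ≤ b)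
    (ht : t ^ 2 ≤ a * b) :
    (a + 2 * (1 / (4 * r)) * t + (1 / (4 * r)) ^ 2 * b) ^ r
      ≤ a ^ r + 1 / 2 * t * a ^ (r - 1) + a ^ (r - 1) * b + 2 * b ^ r := by
  have hr' : (1 : ℝ) ≤ r := by exact_mod_cast hr
  set ρ : ℝ := 1 / (4 * r) with hρ
  have hρ0 : 0 < ρ := by positivity
  have hρr : ρ * r = 1 / 4 := by rw [hρ]; field_simp
  have hρ1 : ρ ≤ 1 / 4 := by nlinarith
  clear_value ρ
  have hpow : a ^ r = a ^ (r - 1) * a := by rw [← pow_succ]; congr 1; omega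
  by_cases hab : b ≤ a
  · rcases ha.eq_or_lt with h0 | h0
    · have hb0 : b = 0 := by linarith
      have ht0 : t = 0 := by
        have : t ^ 2 ≤ 0 := by rw [← h0] at ht; simpa using ht
        nlinarith [sq_nonneg t]
      subst hb0; subst ht0; subst h0
      have : r ≠ 0 := by omega
      simp [this]
    ·
      set u : ℝ := (2 * ρ * t + ρ ^ 2 * b) / a with hu
      have hta : |t| ≤ a := by
        apply abs_le_of_sq_le_sq _ ha
        nlinarith
      have hs : a + 2 * ρ * t + ρ ^ 2 * b = a * (1 + u) := by
        rw [hu]; field_simp; ring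
      have hru : |r * u| ≤ 1 := by
        rw [hu, ← mul_div_assoc, abs_div, abs_of_pos h0, div_le_one h0]
        have : (r : ℝ) * (2 * ρ * t + ρ ^ 2 * b) = 1 / 2 * t + ρ / 4 * b := by
          linear_combination (2 * t + ρ * b) * hρr
        rw [this]
        calc |1 / 2 * t + ρ / 4 * b| ≤ |1 / 2 * t| + |ρ / 4 * b| := abs_add_le _ _
          _ = 1 / 2 * |t| + ρ / 4 * b := by
            rw [abs_mul, abs_of_nonneg (by positivity : 0 ≤ ρ / 4 * b)]; norm_num
          _ ≤ a := by linarith [mul_le_mul hρ1 hab hb (by norm_num)]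
      have h1u : 0 ≤ 1 + u := by
        have : |u| ≤ 1 := by
          calc |u| ≤ |r * u| := by
                rw [abs_mul, abs_of_pos (by positivity : (0 : ℝ) < r)]
                exact le_mul_of_one_le_left (abs_nonneg u) hr'
            _ ≤ 1 := hru
        linarith [(abs_le.1 this).1]
      have hexp : (1 + u) ^ r ≤ 1 + r * u + (r * u) ^ 2 := by
        calc (1 + u) ^ r ≤ (Real.exp u) ^ r := by
              gcongr; linarith [Real.add_one_le_exp u]
          _ = Real.exp (r * u) := by rw [← Real.exp_nat_mul]
          _ ≤ 1 + r * u + (r * u) ^ 2 := by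
            have := Real.abs_exp_sub_one_sub_id_le hru
            linarith [(abs_le.1 this).2]
      rw [hs, mul_pow]
      have key : a * (r * u) + a * (r * u) ^ 2 ≤ 1 / 2 * t + b := by
        have e1 : a * (r * u) = 1 / 2 * t + ρ / 4 * b := by
          have e0 : a * (r * u) = r * (2 * ρ * t + ρ ^ 2 * b) := by rw [hu]; field_simp
          rw [e0]
          linear_combination (2 * t + ρ * b) * hρr
        have e2 : a * (r * u) ^ 2 = (1 / 2 * t + ρ / 4 * b) ^ 2 / a := by
          rw [← e1]; field_simp
        rw [e2, e1]
        have : (1 / 2 * t + ρ / 4 * b) ^ 2 / a ≤ 3 / 4 * b := by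
          rw [div_le_iff₀ h0]
          have : (1 / 2 * t + ρ / 4 * b) ^ 2 ≤ 2 * (1 / 2 * t) ^ 2 + 2 * (ρ / 4 * b) ^ 2 := by
            nlinarith [sq_nonneg (1 / 2 * t - ρ / 4 * b)]
          have h3 : (ρ / 4 * b) ^ 2 ≤ 1 / 100 * (a * b) := by
            have : (ρ / 4) ^ 2 ≤ 1 / 100 := (pow_le_pow_left₀ (by linarith) (by linarith) 2 : (ρ / 4) ^ 2 ≤ (1 / 16) ^ 2).trans (by norm_num)
            have hbb : b ^ 2 ≤ a * b := by rw [sq]; exact mul_le_mul_of_nonneg_right hab hb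
            calc (ρ / 4 * b) ^ 2 = (ρ / 4) ^ 2 * b ^ 2 := by ring
              _ ≤ 1 / 100 * (a * b) := by gcongr
          linarith [mul_nonneg ha hb]
        linarith [mul_le_mul_of_nonneg_right hρ1 hb]
      have : a ^ r * (1 + u) ^ r ≤ a ^ r * (1 + r * u + (r * u) ^ 2) := by gcongr
      have h4 : a ^ r * (1 + r * u + (r * u) ^ 2)
          = a ^ r + a ^ (r - 1) * (a * (r * u) + a * (r * u) ^ 2) := by
        rw [hpow]; ring
      have h5 : a ^ (r - 1) * (a * (r * u) + a * (r * u) ^ 2) ≤ a ^ (r - 1) * (1 / 2 * t + b) := by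
        gcongr
      have h6 : 0 ≤ 2 * b ^ r := by positivity
      have h7 : a ^ (r - 1) * (1 / 2 * t + b) = 1 / 2 * t * a ^ (r - 1) + a ^ (r - 1) * b := by
        ring
      linarith
  · push Not at hab
    have htb : |t| ≤ b := by
      apply abs_le_of_sq_le_sq _ hb
      nlinarith
    have h1 : a + 2 * ρ * t + ρ ^ 2 * b ≤ b * (1 + ρ) ^ 2 := by
      have := mul_le_mul_of_nonneg_left (abs_le.1 htb).2 hρ0.le
      linarith
    have h0 : 0 ≤ a + 2 * ρ * t + ρ ^ 2 * b := by
      have : (2 * ρ * t) ^ 2 ≤ (a + ρ ^ 2 * b) ^ 2 := by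
        have e1 := sq_nonneg (a - ρ ^ 2 * b)
        have e2 := mul_le_mul_of_nonneg_left ht (by positivity : 0 ≤ ρ ^ 2)
        linarith
      have := abs_le_of_sq_le_sq this (by positivity)
      linarith [(abs_le.1 this).1]
    have h2 : (a + 2 * ρ * t + ρ ^ 2 * b) ^ r ≤ 2 * b ^ r := by
      calc (a + 2 * ρ * t + ρ ^ 2 * b) ^ r ≤ (b * (1 + ρ) ^ 2) ^ r := by gcongr
        _ = b ^ r * ((1 + ρ) ^ (2 * r)) := by rw [mul_pow, pow_mul]
        _ ≤ b ^ r * (Real.exp ρ ^ (2 * r)) := by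
          gcongr; linarith [Real.add_one_le_exp ρ]
        _ = b ^ r * Real.exp (1 / 2) := by
          rw [← Real.exp_nat_mul]; congr 2; push_cast; linarith
        _ ≤ b ^ r * 2 := by
          gcongr
          have := Real.exp_one_lt_d9
          have h : Real.exp (1 / 2) ^ 2 = Real.exp 1 := by
            rw [← Real.exp_nat_mul]; norm_num
          have h0 := Real.exp_pos (1 / 2)
          nlinarith
        _ = 2 * b ^ r := by ring
    have h3 : 0 ≤ 1 / 2 * t * a ^ (r - 1) + a ^ (r - 1) * b := by
      have : 0 ≤ a ^ (r - 1) * (1 / 2 * t + b) := by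
        apply mul_nonneg (by positivity)
        linarith [(abs_le.1 htb).1]
      linarith
    have h4 : 0 ≤ a ^ r := by positivity
    linarith
end BM

namespace BM
open Finset

section Hyper
variable {ι : Type*} [Fintype ι] [DecidableEq ι] {Ω : ι → Type*} [∀ i, Fintype (Ω i)]
  [∀ i, Nonempty (Ω i)]

lemma cE_inv_of_subset {A B : Finset ι} (h : ∀ i, i ∈ B → i ∈ A) (F : (∀ i, Ω i) → ℝ) (x y) :
    cE B F (A.piecewise x y) = cE B F x := by
  simp only [cE]
  congr 1; funext z; congr 1
  funext i; by_cases hi : i ∈ B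
  · simp [hi, h i hi]
  · simp [hi]

lemma cE_inv_of_inv {A B : Finset ι} (F : (∀ i, Ω i) → ℝ)
    (hF : ∀ x y, F (A.piecewise x y) = F x) (x y) :
    cE B F (A.piecewise x y) = cE B F x := by
  have : cE A F = F := by
    funext x; simp only [cE, hF, ex_const]
  rw [← this, cE_cE]
  exact cE_inv_of_subset (by intro i hi; simp at hi; exact hi.2) F x y

lemma hyper_step {r : ℕ} (hr : 1 ≤ r) (K : Finset ι) (i : ι) (m v : (∀ i, Ω i) → ℝ)
    (hm : ∀ x y, m (({i}ᶜ : Finset ι).piecewise x y) = m x)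
    (hv : ∀ x, cE {i}ᶜ v x = 0) :
    ex (fun x => (cE K (fun x => (m x + 1 / (4 * r) * v x) ^ 2) x) ^ r)
      ≤ ex (fun x => (cE (K.erase i) (fun x => (m x + v x) ^ 2) x) ^ r)
        + 2 * ex (fun x => (cE K (fun x => v x ^ 2) x) ^ r) := by
  set a := cE K (fun x => m x ^ 2) with ha
  set t := cE K (fun x => m x * v x) with ht
  set b := cE K (fun x => v x ^ 2) with hb
  set Ei := cE (Ω := Ω) ({i}ᶜ : Finset ι) with hEi
  have ha0 : ∀ x, 0 ≤ a x := cE_nonneg _ (fun x => by positivity)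
  have hb0 : ∀ x, 0 ≤ b x := cE_nonneg _ (fun x => by positivity)
  have ht2 : ∀ x, t x ^ 2 ≤ a x * b x := cE_CS _ _ _
  have ainv : ∀ x y, a (({i}ᶜ : Finset ι).piecewise x y) = a x :=
    cE_inv_of_inv _ (fun x y => by rw [hm])
  have apinv : ∀ (s : ℕ) x y, (fun z => a z ^ s) (({i}ᶜ : Finset ι).piecewise x y) = a x ^ s := by
    intro s x y; simp only [ainv]
  have hKe : ({i}ᶜ : Finset ι) ∩ K = K.erase i := by
    ext j; simp [and_comm]
  have hEit : ∀ x, Ei t x = 0 := by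
    intro x
    rw [hEi, ht, cE_cE, inter_comm, ← cE_cE, cE_mul_left _ _ _ hm]
    have : (fun x => m x * cE {i}ᶜ v x) = fun _ => 0 := by funext x; have := hv x; rw [hEi] at this; rw [this, mul_zero]
    rw [this]
    simp [cE, ex_const]
  have e1 : ∀ x, cE K (fun x => (m x + 1 / (4 * r) * v x) ^ 2) x
      = a x + 2 * (1 / (4 * r)) * t x + (1 / (4 * r)) ^ 2 * b x := by
    intro x
    have : (fun x => (m x + 1 / (4 * r) * v x) ^ 2) = fun x => (m x ^ 2
      + 2 * (1 / (4 * r)) * (m x * v x)) + (1 / (4 * r)) ^ 2 * v x ^ 2 := by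
      funext x; ring
    rw [this, cE_add, cE_add, cE_smul, cE_smul]
  have e2 : ∀ x, cE (K.erase i) (fun x => (m x + v x) ^ 2) x = a x + Ei b x := by
    intro x
    have : (fun x => (m x + v x) ^ 2) = fun x => (m x ^ 2 + 2 * (m x * v x)) + v x ^ 2 := by
      funext x; ring
    have hh : cE K (fun x => (m x ^ 2 + 2 * (m x * v x)) + v x ^ 2)
        = fun x => (a x + 2 * t x) + b x := by
      rw [cE_add, cE_add, cE_smul]
    rw [← hKe, ← cE_cE, this, hh, cE_add, cE_add, cE_smul]
    have h1 : cE {i}ᶜ a x = a x := by simp only [cE]; simp only [ainv, ex_const]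
    have h2 := hEit x
    rw [hEi] at h2 ⊢
    simp only [← ha, ← hb, ← ht, h1, h2]
    ring
  have hEib0 : ∀ x, 0 ≤ Ei b x := cE_nonneg _ hb0
  have p1 : ex (fun x => (cE K (fun x => (m x + 1 / (4 * r) * v x) ^ 2) x) ^ r)
      ≤ ex (fun x => a x ^ r + 1 / 2 * (a x ^ (r - 1) * t x) + a x ^ (r - 1) * b x
        + 2 * b x ^ r) := by
    apply ex_mono
    intro x
    rw [e1]
    have := pointwise_ineq hr (ha0 x) (hb0 x) (ht2 x)
    linarith
  have p2 : ex (fun x => a x ^ (r - 1) * t x) = 0 := by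
    rw [← ex_cE ({i}ᶜ : Finset ι), cE_mul_left _ (fun x => a x ^ (r - 1)) _ (apinv _)]
    have : (fun x => a x ^ (r - 1) * cE {i}ᶜ t x) = fun _ => 0 := by
      funext x; rw [← hEi, hEit]; simp
    rw [this, ex_const]
  have p3 : ex (fun x => a x ^ (r - 1) * b x) = ex (fun x => a x ^ (r - 1) * Ei b x) := by
    rw [← ex_cE ({i}ᶜ : Finset ι), cE_mul_left _ (fun x => a x ^ (r - 1)) _ (apinv _)]
  have p4 : ex (fun x => a x ^ r) + ex (fun x => a x ^ (r - 1) * Ei b x)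
      ≤ ex (fun x => (a x + Ei b x) ^ r) := by
    rw [← ex_add]
    apply ex_mono
    intro x
    have hpow : ∀ z : ℝ, z ^ r = z ^ (r - 1) * z := by
      intro z; rw [← pow_succ]; congr 1; omega
    rw [hpow, hpow, ← mul_add]
    have := ha0 x
    have := hEib0 x
    gcongr
    linarith
  rw [ex_add, ex_add, ex_add, ex_smul, ex_smul, p2, p3] at p1
  simp only [e2]
  linarith

def Pure (F : Finset ι → (∀ i, Ω i) → ℝ) : Prop :=
  ∀ S i, (i ∈ S → ∀ x, cE {i}ᶜ (F S) x = 0) ∧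
    (i ∉ S → ∀ x y, F S (({i}ᶜ : Finset ι).piecewise x y) = F S x)

noncomputable def HH (ρ : ℝ) (F : Finset ι → (∀ i, Ω i) → ℝ) (U A : Finset ι) (x : ∀ i, Ω i) : ℝ :=
  ∑ S ∈ univ.filter (fun S => A ⊆ S), ρ ^ (S ∩ U).card * F S x

lemma hyper_aux {r : ℕ} (hr : 1 ≤ r) (F : Finset ι → (∀ i, Ω i) → ℝ) (hF : Pure F)
    (U : Finset ι) : ∀ (A K : Finset ι), Disjoint U A →
    ex (fun x => (cE K (fun x => HH (1 / (4 * r)) F U A x ^ 2) x) ^ r)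
      ≤ ∑ S ∈ U.powerset, 2 ^ S.card *
        ex (fun x => (cE (K \ (U \ S)) (fun x => HH (1 / (4 * r)) F ∅ (A ∪ S) x ^ 2) x) ^ r) := by
  induction U using Finset.induction_on with
  | empty => intro A K _; simp
  | insert i U hiU ih =>
    intro A K hd
    rw [disjoint_insert_left] at hd
    obtain ⟨hiA, hd⟩ := hd
    set ρ : ℝ := 1 / (4 * r) with hρ
    set m : (∀ i, Ω i) → ℝ := fun x =>
      ∑ S ∈ univ.filter (fun S => A ⊆ S ∧ i ∉ S), ρ ^ (S ∩ U).card * F S x with hm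
    set v : (∀ i, Ω i) → ℝ := fun x =>
      ∑ S ∈ univ.filter (fun S => A ⊆ S ∧ i ∈ S), ρ ^ (S ∩ U).card * F S x with hv
    have hv' : v = HH ρ F U (insert i A) := by
      funext x
      simp only [hv, HH, insert_subset_iff]
      congr 1; ext S; simp [and_comm]
    have hmv : ∀ x, HH ρ F U A x = m x + v x := by
      intro x
      simp only [HH, hm, hv]
      rw [← sum_filter_add_sum_filter_not _ (fun S => i ∈ S), add_comm, filter_filter,
        filter_filter]
    have hmv' : ∀ x, HH ρ F (insert i U) A x = m x + ρ * v x := by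
      intro x
      simp only [HH, hm, hv]
      rw [← sum_filter_add_sum_filter_not _ (fun S => i ∈ S), add_comm, filter_filter,
        filter_filter, mul_sum]
      congr 1
      · apply sum_congr rfl
        intro S hS
        simp only [mem_filter] at hS
        rw [inter_insert_of_notMem hS.2.2]
      · apply sum_congr rfl
        intro S hS
        simp only [mem_filter] at hS
        rw [inter_insert_of_mem hS.2.2, card_insert_of_notMem, pow_succ]
        · ring
        · simp [hiU]
    have hm_inv : ∀ x y, m (({i}ᶜ : Finset ι).piecewise x y) = m x := by
      intro x y
      simp only [hm]
      apply sum_congr rfl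
      intro S hS
      simp only [mem_filter] at hS
      rw [(hF S i).2 hS.2.2]
    have hv0 : ∀ x, cE {i}ᶜ v x = 0 := by
      intro x
      rw [hv, cE_sum]
      apply sum_eq_zero
      intro S hS
      simp only [mem_filter] at hS
      rw [cE_smul]
      show ρ ^ _ * cE {i}ᶜ (F S) x = 0
      rw [(hF S i).1 hS.2.2, mul_zero]
    have hstep := hyper_step hr K i m v hm_inv hv0
    rw [← hρ] at hstep
    simp only [← hmv', ← hmv] at hstep
    rw [hv'] at hstep
    have i1 := ih A (K.erase i) hd
    have i2 := ih (insert i A) K (by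
      rw [disjoint_insert_right]; exact ⟨hiU, hd⟩)
    refine hstep.trans ?_
    rw [sum_powerset_insert hiU]
    apply add_le_add
    · refine i1.trans (le_of_eq ?_)
      apply sum_congr rfl
      intro S hS
      have hiS : i ∉ S := fun h => hiU (mem_powerset.1 hS h)
      have : K.erase i \ (U \ S) = K \ (insert i U \ S) := by
        ext j; by_cases hj : j = i <;> simp [hj, hiS]
      rw [this]
    · refine (mul_le_mul_of_nonneg_left i2 (by norm_num)).trans (le_of_eq ?_)
      rw [mul_sum]
      apply sum_congr rfl
      intro S hS
      have hiS : i ∉ S := fun h => hiU (mem_powerset.1 hS h)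
      have h1 : K \ (insert i U \ insert i S) = K \ (U \ S) := by
        ext j; by_cases hj : j = i
        · simp [hj, hiU]
        · simp [hj]
      have h2 : A ∪ insert i S = insert i A ∪ S := by
        ext j; simp
      rw [h1, h2, card_insert_of_notMem hiS]
      ring

theorem hyper {r : ℕ} (hr : 1 ≤ r) (F : Finset ι → (∀ i, Ω i) → ℝ) (hF : Pure F) :
    ex (fun x => (∑ S, (1 / (4 * r) : ℝ) ^ S.card * F S x) ^ (2 * r))
      ≤ ∑ A : Finset ι, 2 ^ A.card *
        ex (fun x => (cE A (fun x => (∑ S ∈ univ.filter (fun S => A ⊆ S), F S x) ^ 2) x) ^ r) := by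
  have h := hyper_aux hr F hF univ ∅ univ (disjoint_empty_right _)
  rw [cE_univ] at h
  simp only [HH, empty_subset, filter_true, inter_univ, inter_empty, card_empty, pow_zero,
    one_mul, empty_union, powerset_univ, ← pow_mul] at h
  refine h.trans (le_of_eq ?_)
  apply sum_congr rfl
  intro S _
  have : (univ : Finset ι) \ (univ \ S) = S := by ext; simp
  rw [this]

end Hyper
end BM

namespace BM
open Finset

section Level
variable {ι : Type*} [Fintype ι] [DecidableEq ι] {Ω : ι → Type*} [∀ i, Fintype (Ω i)]
  [∀ i, Nonempty (Ω i)]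

lemma ex_prod (φ : ∀ i, Ω i → ℝ) :
    ex (fun x => ∏ i, φ i (x i)) = ∏ i, ((∑ a, φ i a) / Fintype.card (Ω i)) := by
  rw [prod_div_distrib, prod_univ_sum]
  simp [ex, Fintype.card_pi]

lemma ex_prod_mem (S : Finset ι) (φ : ∀ i, Ω i → ℝ) :
    ex (fun x => ∏ i ∈ S, φ i (x i)) = ∏ i ∈ S, ((∑ a, φ i a) / Fintype.card (Ω i)) := by
  have h := ex_prod (fun i a => if i ∈ S then φ i a else 1)
  have h1 : ∀ x : ∀ i, Ω i, (∏ i, if i ∈ S then φ i (x i) else 1) = ∏ i ∈ S, φ i (x i) := by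
    intro x; simp [prod_ite_mem]
  simp only [h1] at h
  rw [h, ← prod_filter_mul_prod_filter_not univ (fun i => i ∈ S)]
  rw [filter_mem_eq_inter, univ_inter]
  have h2 : ∏ x ∈ univ.filter (fun i => i ∉ S),
      ((∑ a, if x ∈ S then φ x a else 1) / Fintype.card (Ω x)) = 1 := by
    apply prod_eq_one
    intro i hi
    simp only [mem_filter] at hi
    have : (Fintype.card (Ω i) : ℝ) ≠ 0 := by exact_mod_cast Fintype.card_ne_zero
    simp [hi.2, this]
  rw [h2, mul_one]
  apply prod_congr rfl
  intro i hi
  simp [hi]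

variable [∀ i, DecidableEq (Ω i)]

noncomputable def e1 (x t : ∀ i, Ω i) (i : ι) : ℝ := if x i = t i then (Fintype.card (Ω i) : ℝ) else 0

noncomputable def dl (V : Finset ι) (x t : ∀ i, Ω i) : ℝ := ∏ i ∈ V, e1 x t i

noncomputable def kp (V : Finset ι) (x t : ∀ i, Ω i) : ℝ := ∏ i ∈ V, (e1 x t i - 1)

lemma e1_nonneg (x t : ∀ i, Ω i) (i : ι) : 0 ≤ e1 x t i := by
  unfold e1; split_ifs <;> positivity

lemma dl_nonneg (V : Finset ι) (x t : ∀ i, Ω i) : 0 ≤ dl V x t :=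
  prod_nonneg (fun i _ => e1_nonneg x t i)

lemma ex_dl (U : Finset ι) (z : ∀ i, Ω i) : ex (fun x => dl U x z) = 1 := by
  simp only [dl, e1]
  rw [ex_prod_mem U (fun i a => if a = z i then (Fintype.card (Ω i) : ℝ) else 0)]
  apply prod_eq_one
  intro i _
  have : (Fintype.card (Ω i) : ℝ) ≠ 0 := by exact_mod_cast Fintype.card_ne_zero
  simp [this]

lemma ex_kp_kp (S : Finset ι) (t s : ∀ i, Ω i) :
    ex (fun x => kp S x t * kp S x s) = kp S t s := by
  simp only [kp, e1, ← prod_mul_distrib]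
  rw [ex_prod_mem S (fun i a => ((if a = t i then (Fintype.card (Ω i) : ℝ) else 0) - 1) *
    ((if a = s i then (Fintype.card (Ω i) : ℝ) else 0) - 1))]
  apply prod_congr rfl
  intro i _
  have hc : (Fintype.card (Ω i) : ℝ) ≠ 0 := by exact_mod_cast Fintype.card_ne_zero
  have : ∀ a : Ω i, ((if a = t i then (Fintype.card (Ω i) : ℝ) else 0) - 1) *
    ((if a = s i then (Fintype.card (Ω i) : ℝ) else 0) - 1)
    = (if a = t i then (if a = s i then (Fintype.card (Ω i) : ℝ) ^ 2 else 0) else 0)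
      - (if a = t i then (Fintype.card (Ω i) : ℝ) else 0)
      - (if a = s i then (Fintype.card (Ω i) : ℝ) else 0) + 1 := by
    intro a; split_ifs <;> ring
  simp only [this, sum_add_distrib, sum_sub_distrib]
  simp
  split_ifs
  · field_simp
    try ring
  · field_simp
    try ring

lemma dl_repro (U : Finset ι) (ψ : (∀ i, Ω i) → ℝ) (hψ : ∀ x y, ψ (U.piecewise x y) = ψ x)
    (z : ∀ i, Ω i) : ex (fun x => ψ x * dl U x z) = ψ z := by
  have : ∀ x, ψ x * dl U x z = ψ z * dl U x z := by
    intro x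
    by_cases h : ∀ i ∈ U, x i = z i
    · have : U.piecewise x z = z := by
        funext i; by_cases hi : i ∈ U <;> simp [hi, h]
      rw [← hψ x z, this]
    · push Not at h
      obtain ⟨i, hi, hne⟩ := h
      have : dl U x z = 0 := prod_eq_zero hi (by simp [e1, hne])
      rw [this]; simp
  simp only [this]
  rw [ex_smul, ex_dl, mul_one]

lemma kp_pure {S : Finset ι} {i : ι} (hi : i ∈ S) (t x : ∀ i, Ω i) :
    cE {i}ᶜ (fun x => kp S x t) x = 0 := by
  simp only [cE]
  have : ∀ y : ∀ i, Ω i, kp S (({i}ᶜ : Finset ι).piecewise x y) t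
      = (∏ j ∈ S.erase i, (e1 x t j - 1)) * (e1 y t i - 1) := by
    intro y
    simp only [kp]
    rw [← prod_erase_mul _ _ hi]
    congr 1
    · apply prod_congr rfl
      intro j hj
      have : j ≠ i := (mem_erase.1 hj).1
      simp [e1, this]
    · simp [e1]
  simp only [this]
  rw [ex_smul]
  have h := ex_prod_mem {i} (fun i a => (if a = t i then (Fintype.card (Ω i) : ℝ) else 0) - 1)
  have hc : (Fintype.card (Ω i) : ℝ) ≠ 0 := by exact_mod_cast Fintype.card_ne_zero
  simp only [prod_singleton, sum_sub_distrib] at h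
  simp only [e1]
  rw [h]
  simp

lemma kp_inv (S : Finset ι) (B : Finset ι) (h : S ⊆ B) (t x y : ∀ i, Ω i) :
    kp S (B.piecewise x y) t = kp S x t := by
  simp only [kp]
  apply prod_congr rfl
  intro j hj
  simp [e1, h hj]

lemma kp_expand (A : Finset ι) (x t : ∀ i, Ω i) :
    kp A x t = ∑ B ∈ A.powerset, (-1) ^ (A \ B).card * dl B x t := by
  simp only [kp, dl, sub_eq_add_neg]
  rw [prod_add]
  apply sum_congr rfl
  intro B _
  rw [prod_const, mul_comm]

lemma kp_union {A S : Finset ι} (h : Disjoint A S) (x z t : ∀ i, Ω i) :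
    kp (A ∪ S) (A.piecewise x z) t = kp A x t * kp S z t := by
  simp only [kp]
  rw [prod_union h]
  congr 1
  · apply prod_congr rfl
    intro j hj
    simp [e1, hj]
  · apply prod_congr rfl
    intro j hj
    simp [e1, disjoint_right.1 h hj]

lemma dl_union {A S : Finset ι} (h : Disjoint A S) (x z t : ∀ i, Ω i) :
    dl (A ∪ S) (A.piecewise x z) t = dl A x t * dl S z t := by
  simp only [dl]
  rw [prod_union h]
  congr 1
  · apply prod_congr rfl
    intro j hj
    simp [e1, hj]
  · apply prod_congr rfl
    intro j hj
    simp [e1, disjoint_right.1 h hj]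

variable {τ : Type*} [Fintype τ] [Nonempty τ]

noncomputable def av (F : τ → ℝ) : ℝ := (∑ t, F t) / Fintype.card τ

lemma av_smul (c : ℝ) (F : τ → ℝ) : av (fun x => c * F x) = c * av F := by
  simp [av, ← mul_sum, mul_div_assoc]

lemma av_sum {κ : Type*} (s : Finset κ) (F : κ → τ → ℝ) :
    av (fun x => ∑ j ∈ s, F j x) = ∑ j ∈ s, av (F j) := by
  simp only [av]
  rw [sum_comm, sum_div]

lemma av_mono {F G : τ → ℝ} (h : ∀ x, F x ≤ G x) : av F ≤ av G := by
  unfold av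
  gcongr with x
  exact h x

lemma av_nonneg {F : τ → ℝ} (h : ∀ x, 0 ≤ F x) : 0 ≤ av F := by
  unfold av
  exact div_nonneg (sum_nonneg fun i _ => h i) (by positivity)

lemma ex_av (Φ : (∀ i, Ω i) → τ → ℝ) : ex (fun x => av (Φ x)) = av (fun t => ex (fun x => Φ x t)) := by
  simp only [ex, av]
  rw [← sum_div, ← sum_div, sum_comm, div_right_comm]

lemma cE_av (A : Finset ι) (Φ : (∀ i, Ω i) → τ → ℝ) (x) :
    cE A (fun x => av (Φ x)) x = av (fun t => cE A (fun x => Φ x t) x) := by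
  simp only [cE]
  rw [ex_av (fun y t => Φ (A.piecewise x y) t)]

lemma av_jensen (w G : τ → ℝ) (hw : ∀ t, 0 ≤ w t) {r : ℕ} (hr : 1 ≤ r) :
    (av (fun t => w t * G t)) ^ (2 * r) ≤ (av w) ^ (2 * r - 1) * av (fun t => w t * G t ^ (2 * r)) := by
  have hc : (0 : ℝ) < Fintype.card τ := by exact_mod_cast Fintype.card_pos
  have hs : 0 ≤ ∑ t, w t := sum_nonneg fun i _ => hw i
  rcases hs.eq_or_lt with h0 | h0
  · have : ∀ t, w t = 0 := by
      intro t
      exact (sum_eq_zero_iff_of_nonneg (fun i _ => hw i)).1 h0.symm t (mem_univ _)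
    have h2 : 2 * r ≠ 0 := by omega
    simp [av, this, h2]
  · have := Real.pow_arith_mean_le_arith_mean_pow_of_even univ (fun t => w t / ∑ t, w t) G
      (fun t _ => div_nonneg (hw t) hs) (by rw [← sum_div]; exact div_self h0.ne')
      (n := 2 * r) (even_two_mul r)
    simp only [div_mul_eq_mul_div, ← sum_div] at this
    simp only [av]
    rw [div_pow] at this ⊢
    rw [div_pow]
    have e : ∀ z : ℝ, z ^ (2 * r) = z ^ (2 * r - 1) * z := by
      intro z; rw [← pow_succ]; congr 1; omega
    rw [div_le_div_iff₀ (by positivity) h0] at this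
    rw [div_mul_div_comm, div_le_div_iff₀ (by positivity) (by positivity)]
    rw [e (∑ t, w t)] at this
    have h3 : (∑ t, w t * G t) ^ (2 * r) ≤ (∑ t, w t * G t ^ (2 * r)) * (∑ t, w t) ^ (2 * r - 1) := by
      have : (∑ t, w t * G t) ^ (2 * r) * ∑ t, w t ≤ ((∑ t, w t * G t ^ (2 * r)) * (∑ t, w t) ^ (2 * r - 1)) * ∑ t, w t := by
        linarith
      exact le_of_mul_le_mul_right this h0
    rw [e (Fintype.card τ : ℝ)]
    nlinarith [pow_pos hc (2 * r - 1), mul_pos (pow_pos hc (2 * r - 1)) hc]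

end Level
end BM

namespace BM
open Finset

section Level2
variable {ι : Type*} [Fintype ι] [DecidableEq ι] {Ω : ι → Type*} [∀ i, Fintype (Ω i)]
  [∀ i, Nonempty (Ω i)] [∀ i, DecidableEq (Ω i)] {τ : Type*} [Fintype τ] [Nonempty τ]

noncomputable def gg (f : τ → ℝ) (π : τ → ∀ i, Ω i) (V : Finset ι) (y : ∀ i, Ω i) (S : Finset ι)
    (x : ∀ i, Ω i) : ℝ := av (fun t => (f t * dl V y (π t)) * kp S x (π t))

def lev (V : Finset ι) (d : ℕ) : Finset (Finset ι) :=
  univ.filter (fun S => S.card = d ∧ Disjoint S V)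

lemma mem_lev {V : Finset ι} {d : ℕ} {S : Finset ι} :
    S ∈ lev V d ↔ S.card = d ∧ Disjoint S V := by simp [lev]

noncomputable def WW (f : τ → ℝ) (π : τ → ∀ i, Ω i) (V : Finset ι) (y : ∀ i, Ω i) (d : ℕ) : ℝ :=
  ∑ S ∈ lev V d, ex (fun x => gg f π V y S x ^ 2)

variable (f : τ → ℝ) (π : τ → ∀ i, Ω i)

lemma gg_pure (V : Finset ι) (y : ∀ i, Ω i) {S : Finset ι} {i : ι} (hi : i ∈ S) (x : ∀ i, Ω i) :
    cE {i}ᶜ (gg f π V y S) x = 0 := by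
  have : gg f π V y S = fun x => av (fun t => (f t * dl V y (π t)) * kp S x (π t)) := rfl
  rw [this, cE_av]
  have : ∀ t, cE {i}ᶜ (fun x => (f t * dl V y (π t)) * kp S x (π t)) x = 0 := by
    intro t
    rw [cE_smul]
    simp only [kp_pure hi, mul_zero]
  simp [this, av]

lemma gg_inv (V : Finset ι) (y : ∀ i, Ω i) {S B : Finset ι} (h : S ⊆ B) (x z : ∀ i, Ω i) :
    gg f π V y S (B.piecewise x z) = gg f π V y S x := by
  simp only [gg, kp_inv S B h]

lemma gg_repro (V : Finset ι) (y : ∀ i, Ω i) (S : Finset ι) (s : ∀ i, Ω i) :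
    ex (fun x => kp S x s * gg f π V y S x) = gg f π V y S s := by
  have : ∀ x, kp S x s * gg f π V y S x
      = av (fun t => (f t * dl V y (π t)) * (kp S x s * kp S x (π t))) := by
    intro x
    simp only [gg]
    rw [← av_smul]
    congr 1; funext t; ring
  simp only [this]
  rw [ex_av]
  simp only [ex_smul, ex_kp_kp, gg]

lemma WW_eq (V : Finset ι) (y : ∀ i, Ω i) (d : ℕ) :
    WW f π V y d = av (fun t => (f t * dl V y (π t)) * ∑ S ∈ lev V d, gg f π V y S (π t)) := by
  simp only [mul_sum, WW]
  rw [av_sum]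
  apply sum_congr rfl
  intro S _
  have : ∀ x, gg f π V y S x ^ 2
      = av (fun t => (f t * dl V y (π t)) * (kp S x (π t) * gg f π V y S x)) := by
    intro x
    rw [sq]
    nth_rewrite 1 [gg]
    rw [mul_comm, ← av_smul]
    congr 1; funext t; ring
  simp only [this]
  rw [ex_av]
  simp only [ex_smul, gg_repro]

lemma gg_split (V A S : Finset ι) (y x z : ∀ i, Ω i) (h1 : Disjoint A S) (h2 : Disjoint A V) :
    gg f π V y (A ∪ S) (A.piecewise x z)
      = ∑ B ∈ A.powerset, (-1) ^ (A \ B).card * gg f π (V ∪ B) (V.piecewise y x) S z := by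
  simp only [gg]
  simp only [← av_smul]
  rw [← av_sum]
  congr 1; funext t
  rw [kp_union h1, kp_expand, sum_mul, mul_sum]
  apply sum_congr rfl
  intro B hB
  rw [dl_union (h2.symm.mono_right (mem_powerset.1 hB))]
  ring

noncomputable def FF (V : Finset ι) (y : ∀ i, Ω i) (d : ℕ) (S : Finset ι) (x : ∀ i, Ω i) : ℝ :=
  if S ∈ lev V d then gg f π V y S x else 0

lemma FF_pure (V : Finset ι) (y : ∀ i, Ω i) (d : ℕ) : Pure (FF f π V y d) := by
  intro S i
  constructor
  · intro hi x
    by_cases h : S ∈ lev V d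
    · have : FF f π V y d S = gg f π V y S := by funext x; simp [FF, h]
      rw [this, gg_pure f π V y hi]
    · have : FF f π V y d S = fun _ => 0 := by funext x; simp [FF, h]
      rw [this]; simp [cE, ex_const]
  · intro hi x z
    simp only [FF]
    rw [gg_inv f π V y (by intro j hj; simp; rintro rfl; exact hi hj)]

lemma pure_orth (F : Finset ι → (∀ i, Ω i) → ℝ) (hF : Pure F) (A S T : Finset ι) (hS : A ⊆ S)
    (hT : A ⊆ T) (hne : S ≠ T) (x) : cE A (fun x => F S x * F T x) x = 0 := by
  have key : ∀ S T : Finset ι, A ⊆ T → ¬ S ⊆ T → cE A (fun x => F S x * F T x) x = 0 := by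
    intro S T hT h
    rw [not_subset] at h
    obtain ⟨i, hiS, hiT⟩ := h
    have hA : A ∩ {i}ᶜ = A := by
      ext j; simp; intro hj hji; subst hji; exact hiT (hT hj)
    rw [← hA, ← cE_cE]
    have : cE {i}ᶜ (fun x => F S x * F T x) = fun _ => 0 := by
      funext x
      have : (fun x => F S x * F T x) = fun x => F T x * F S x := by funext x; ring
      rw [this, cE_mul_left _ _ _ ((hF T i).2 hiT)]
      beta_reduce
      rw [(hF S i).1 hiS, mul_zero]
    rw [this]; simp [cE, ex_const]
  by_cases h : S ⊆ T
  · have h2 : ¬ T ⊆ S := fun h' => hne (h.antisymm h')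
    have : (fun x => F S x * F T x) = fun x => F T x * F S x := by funext x; ring
    rw [this]
    exact key T S hS h2
  · exact key S T hT h

lemma pure_sq (F : Finset ι → (∀ i, Ω i) → ℝ) (hF : Pure F) (A : Finset ι) (x) :
    cE A (fun x => (∑ S ∈ univ.filter (fun S => A ⊆ S), F S x) ^ 2) x
      = ∑ S ∈ univ.filter (fun S => A ⊆ S), cE A (fun x => F S x ^ 2) x := by
  simp only [sq, sum_mul_sum]
  rw [cE_sum]
  apply sum_congr rfl
  intro S hS
  rw [cE_sum]
  beta_reduce
  rw [sum_eq_single S]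
  · intro T hT hne
    exact pure_orth F hF A S T (by simpa using hS) (by simpa using hT) hne.symm x
  · intro h; exact absurd hS h

end Level2
end BM

namespace BM
open Finset

section Level3
variable {ι : Type*} [Fintype ι] [DecidableEq ι] {Ω : ι → Type*} [∀ i, Fintype (Ω i)]
  [∀ i, Nonempty (Ω i)] [∀ i, DecidableEq (Ω i)] {τ : Type*} [Fintype τ] [Nonempty τ]
variable (f : τ → ℝ) (π : τ → ∀ i, Ω i)

lemma compare_one (V : Finset ι) (y : ∀ i, Ω i) (d n D0 : ℕ) (ε0 B : ℝ)
    (hH : ∀ U x, U.card ≤ D0 → |av (fun t => dl U x (π t)) - 1| ≤ ε0)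
    (hD : V.card + n * d ≤ D0) (hB : ∀ S ∈ lev V d, ∀ x, |gg f π V y S x| ≤ B)
    (p : Fin n → Finset ι) (hp : ∀ j, p j ∈ lev V d) :
    |av (fun t => dl V y (π t) * ∏ j, gg f π V y (p j) (π t)) - ex (fun x => ∏ j, gg f π V y (p j) x)|
      ≤ B ^ n * ε0 := by
  set ψ : (∀ i, Ω i) → ℝ := fun x => ∏ j, gg f π V y (p j) x with hψ
  set U : Finset ι := univ.biUnion p with hU
  have hinv : ∀ x z, ψ (U.piecewise x z) = ψ x := by
    intro x z
    simp only [hψ]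
    apply prod_congr rfl
    intro j _
    exact gg_inv f π V y (subset_biUnion_of_mem p (mem_univ j)) x z
  have hUc : U.card ≤ n * d := by
    refine card_biUnion_le.trans ?_
    refine (sum_le_sum (fun j _ => (mem_lev.1 (hp j)).1.le)).trans ?_
    simp
  have hdis : Disjoint V U := by
    rw [hU, disjoint_biUnion_right]
    intro j _
    exact (mem_lev.1 (hp j)).2.symm
  have e : av (fun t => dl V y (π t) * ψ (π t))
      = ex (fun x => ψ x * av (fun t => dl (V ∪ U) (V.piecewise y x) (π t))) := by
    simp only [dl_union hdis, ← av_smul]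
    rw [ex_av]
    congr 1; funext t
    nth_rewrite 1 [← dl_repro U ψ hinv (π t)]
    rw [← ex_smul]
    congr 1; funext x; ring
  have e' : av (fun t => dl V y (π t) * ∏ j, gg f π V y (p j) (π t)) =
    av (fun t => dl V y (π t) * ψ (π t)) := rfl
  rw [e', e, ← ex_sub]
  apply ex_abs_le
  intro x
  have : ψ x * av (fun t => dl (V ∪ U) (V.piecewise y x) (π t)) - ψ x
    = ψ x * (av (fun t => dl (V ∪ U) (V.piecewise y x) (π t)) - 1) := by ring
  rw [this, abs_mul]
  have h1 : |ψ x| ≤ B ^ n := by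
    simp only [hψ]
    rw [abs_prod]
    refine (prod_le_prod (fun j _ => abs_nonneg _) (fun j _ => hB _ (hp j) x)).trans ?_
    simp
  have h2 := hH (V ∪ U) (V.piecewise y x) ((card_union_le _ _).trans (by omega))
  exact mul_le_mul h1 h2 (abs_nonneg _) ((abs_nonneg _).trans h1)

lemma compare_pow (V : Finset ι) (y : ∀ i, Ω i) (d n D0 : ℕ) (ε0 B : ℝ)
    (hH : ∀ U x, U.card ≤ D0 → |av (fun t => dl U x (π t)) - 1| ≤ ε0)
    (hD : V.card + n * d ≤ D0) (hB : ∀ S ∈ lev V d, ∀ x, |gg f π V y S x| ≤ B) :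
    |av (fun t => dl V y (π t) * (∑ S ∈ lev V d, gg f π V y S (π t)) ^ n)
      - ex (fun x => (∑ S ∈ lev V d, gg f π V y S x) ^ n)|
      ≤ ((lev V d).card * B) ^ n * ε0 := by
  simp only [sum_pow', mul_sum]
  rw [av_sum, ex_sum, ← sum_sub_distrib]
  refine (abs_sum_le_sum_abs _ _).trans ?_
  refine (sum_le_sum (g := fun _ => B ^ n * ε0) (fun p hp => ?_)).trans ?_
  · exact compare_one f π V y d n D0 ε0 B hH hD hB p (fun j => (Fintype.mem_piFinset.1 hp) j)
  · rw [sum_const, Fintype.card_piFinset_const, nsmul_eq_mul, mul_pow]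
    push_cast
    linarith

lemma Z_bound (V : Finset ι) (y : ∀ i, Ω i) (d D : ℕ) (K α : ℝ) (hK : 4 ≤ K)
    (IH : ∀ d' < d, ∀ V y, V.card + d' ≤ D → WW f π V y d' ≤ 4 * K ^ d' * α ^ 2)
    (hVD : V.card + d ≤ D) (A : Finset ι) (hA : A.Nonempty) (x) :
    ∑ S ∈ univ.filter (fun S => A ⊆ S), cE A (fun x => FF f π V y d S x ^ 2) x
      ≤ 4 * K ^ d * α ^ 2 := by
  have hR0 : 0 ≤ 4 * K ^ d * α ^ 2 := by positivity
  have hA1 : 1 ≤ A.card := hA.card_pos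
  by_cases hc : A.card ≤ d ∧ Disjoint A V
  swap
  · refine le_trans (le_of_eq ?_) hR0
    apply sum_eq_zero
    intro S hS
    have hS : A ⊆ S := by simpa using hS
    have : S ∉ lev V d := by
      rw [mem_lev]
      rintro ⟨h1, h2⟩
      exact hc ⟨(card_le_card hS).trans h1.le, h2.mono_left hS⟩
    simp [FF, this, cE, ex_const]
  obtain ⟨hAd, hAV⟩ := hc
  set d' := d - A.card with hd'
  set y' : ∀ i, Ω i := V.piecewise y x with hy'
  have step1 : ∑ S ∈ univ.filter (fun S => A ⊆ S), cE A (fun x => FF f π V y d S x ^ 2) x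
      = ∑ S ∈ lev (V ∪ A) d', cE A (fun x => gg f π V y (A ∪ S) x ^ 2) x := by
    rw [← sum_filter_of_ne (p := fun S => S ∈ lev V d)]
    · symm
      refine sum_bij' (fun S _ => A ∪ S) (fun S _ => S \ A) ?_ ?_ ?_ ?_ ?_
      · intro S hS
        obtain ⟨h1, h2⟩ := mem_lev.1 hS
        rw [disjoint_union_right] at h2
        simp only [mem_filter, mem_univ, true_and, subset_union_left, mem_lev]
        refine ⟨?_, disjoint_union_left.2 ⟨hAV, h2.1⟩⟩
        rw [card_union_of_disjoint h2.2.symm]; omega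
      · intro S hS
        simp only [mem_filter, mem_univ, true_and, mem_lev] at hS ⊢
        refine ⟨?_, ?_⟩
        · rw [card_sdiff_of_subset hS.1]; omega
        · rw [disjoint_union_right]
          exact ⟨hS.2.2.mono_left sdiff_subset, sdiff_disjoint⟩
      · intro S hS
        obtain ⟨h1, h2⟩ := mem_lev.1 hS
        rw [disjoint_union_right] at h2
        rw [union_sdiff_left, sdiff_eq_self_of_disjoint h2.2]
      · intro S hS
        simp only [mem_filter, mem_univ, true_and, mem_lev] at hS
        exact union_sdiff_of_subset hS.1
      · intro S hS
        obtain ⟨h1, h2⟩ := mem_lev.1 hS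
        rw [disjoint_union_right] at h2
        have : A ∪ S ∈ lev V d := by
          rw [mem_lev]
          refine ⟨?_, disjoint_union_left.2 ⟨hAV, h2.1⟩⟩
          rw [card_union_of_disjoint h2.2.symm]; omega
        simp [FF, this]
    · intro S _ hne
      by_contra h
      exact hne (by simp [FF, h, cE, ex_const])
  rw [step1]
  have step2 : ∀ S ∈ lev (V ∪ A) d', cE A (fun x => gg f π V y (A ∪ S) x ^ 2) x
      ≤ 2 ^ A.card * ∑ B ∈ A.powerset, ex (fun z => gg f π (V ∪ B) y' S z ^ 2) := by
    intro S hS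
    obtain ⟨h1, h2⟩ := mem_lev.1 hS
    rw [disjoint_union_right] at h2
    rw [← ex_sum, ← ex_smul]
    simp only [cE]
    apply ex_mono
    intro z
    rw [gg_split f π V A S y x z h2.2.symm hAV]
    refine sq_sum_le_card_mul_sum_sq.trans (le_of_eq ?_)
    rw [card_powerset]
    push_cast
    congr 1
    apply sum_congr rfl
    intro B _
    rw [mul_pow, ← pow_mul, mul_comm _ 2, pow_mul]
    simp [hy']
  refine (sum_le_sum step2).trans ?_
  rw [← mul_sum, sum_comm]
  have step3 : ∀ B ∈ A.powerset, ∑ S ∈ lev (V ∪ A) d', ex (fun z => gg f π (V ∪ B) y' S z ^ 2)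
      ≤ 4 * K ^ d' * α ^ 2 := by
    intro B hB
    have hB := mem_powerset.1 hB
    refine le_trans (sum_le_sum_of_subset_of_nonneg ?_ ?_) (IH d' (by omega) (V ∪ B) y' ?_)
    · intro S hS
      rw [mem_lev] at hS ⊢
      exact ⟨hS.1, hS.2.mono_right (union_subset_union_right hB)⟩
    · intros; exact ex_nonneg (fun x => sq_nonneg _)
    · have := card_union_le V B
      have := card_le_card hB
      omega
  refine (mul_le_mul_of_nonneg_left (sum_le_sum step3) (by positivity)).trans ?_
  rw [sum_const, card_powerset, nsmul_eq_mul]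
  push_cast
  have : K ^ d = K ^ A.card * K ^ d' := by rw [← pow_add]; congr 1; omega
  rw [this]
  have h4 : (4 : ℝ) ^ A.card ≤ K ^ A.card := by gcongr
  have h5 : (2 : ℝ) ^ A.card * 2 ^ A.card = 4 ^ A.card := by rw [← mul_pow]; norm_num
  calc (2 : ℝ) ^ A.card * (2 ^ A.card * (4 * K ^ d' * α ^ 2))
      = 4 ^ A.card * (4 * K ^ d' * α ^ 2) := by rw [← h5]; ring
    _ ≤ K ^ A.card * (4 * K ^ d' * α ^ 2) := by gcongr
    _ = _ := by ring

lemma Z_sum (V : Finset ι) (y : ∀ i, Ω i) (d : ℕ) :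
    ∑ A : Finset ι, ∑ S ∈ univ.filter (fun S => A ⊆ S), ex (fun x => FF f π V y d S x ^ 2)
      = 2 ^ d * WW f π V y d := by
  have : ∀ A : Finset ι, ∑ S ∈ univ.filter (fun S => A ⊆ S), ex (fun x => FF f π V y d S x ^ 2)
     = ∑ S, if A ⊆ S then ex (fun x => FF f π V y d S x ^ 2) else 0 := by
    intro A; rw [sum_filter]
  simp only [this]
  rw [sum_comm, WW, mul_sum, ← sum_filter_add_sum_filter_not univ (fun S => S ∈ lev V d)]
  have h2 : ∑ S ∈ univ.filter (fun S => S ∉ lev V d),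
      (∑ A : Finset ι, if A ⊆ S then ex (fun x => FF f π V y d S x ^ 2) else 0) = 0 := by
    apply sum_eq_zero
    intro S hS
    simp only [mem_filter, mem_univ, true_and] at hS
    simp [FF, hS, ex_const]
  rw [h2, add_zero]
  rw [filter_mem_eq_inter, univ_inter]
  apply sum_congr rfl
  intro S hS
  rw [← sum_filter]
  have : univ.filter (fun A => A ⊆ S) = S.powerset := by ext; simp
  rw [this, sum_const, card_powerset, (mem_lev.1 hS).1, nsmul_eq_mul]
  simp [FF, hS]

lemma gg_bound (V : Finset ι) (y : ∀ i, Ω i) (S : Finset ι) (Pm : ℝ) (hPm : 1 ≤ Pm)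
    (hP : ∀ i, (Fintype.card (Ω i) : ℝ) ≤ Pm) (hf : ∀ t, 0 ≤ f t) (x) :
    |gg f π V y S x| ≤ av (fun t => f t * dl V y (π t)) * Pm ^ S.card := by
  have hk : ∀ t, |kp S x t| ≤ Pm ^ S.card := by
    intro t
    simp only [kp]
    rw [abs_prod]
    refine (prod_le_prod (fun j _ => abs_nonneg _) (g := fun _ => Pm) (fun j _ => ?_)).trans ?_
    · simp only [e1]
      have h1 : (1 : ℝ) ≤ Fintype.card (Ω j) := by exact_mod_cast Fintype.card_pos
      have := hP j
      split_ifs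
      · rw [abs_le]; constructor <;> linarith
      · simpa using hPm
    · simp
  have hw : ∀ t, 0 ≤ f t * dl V y (π t) := fun t => mul_nonneg (hf t) (dl_nonneg _ _ _)
  rw [mul_comm, ← av_smul]
  simp only [gg]
  rw [abs_le, neg_eq_neg_one_mul, ← av_smul]
  constructor
  · apply av_mono
    intro t
    nlinarith [(abs_le.1 (hk (π t))).1, hw t]
  · apply av_mono
    intro t
    nlinarith [(abs_le.1 (hk (π t))).2, hw t]

set_option maxHeartbeats 1000000 in
theorem level (D r I : ℕ) (hr : 1 ≤ r) (α K ε0 Pm : ℝ) (hα : 0 < α) (hα1 : α ≤ 1) (hK : 4 ≤ K)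
    (hK2 : 4 * (4 * r : ℝ) ^ (2 * r) ≤ α * K ^ r) (hf : ∀ t, 0 ≤ f t ∧ f t ≤ 1)
    (hA : ∀ V y, V.card ≤ D → av (fun t => f t * dl V y (π t)) ≤ 2 * α)
    (hH : ∀ U x, U.card ≤ (2 * r + 1) * D → |av (fun t => dl U x (π t)) - 1| ≤ ε0)
    (hPm : 1 ≤ Pm) (hP : ∀ i, (Fintype.card (Ω i) : ℝ) ≤ Pm) (hI : 1 ≤ I)
    (hι : Fintype.card ι ≤ I)
    (hε : (I ^ D * (2 * Pm ^ D)) ^ (2 * r) * ε0 ≤ α ^ (2 * r)) :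
    ∀ d V y, V.card + d ≤ D → WW f π V y d ≤ 4 * K ^ d * α ^ 2 := by
  intro d
  induction d using Nat.strong_induction_on with
  | _ d IH =>
  intro V y hVD
  have hε0 : 0 ≤ ε0 := (abs_nonneg _).trans (hH ∅ y (by simp))
  have hw : ∀ t, 0 ≤ f t * dl V y (π t) := fun t => mul_nonneg (hf t).1 (dl_nonneg _ _ _)
  by_contra hcon
  push Not at hcon
  set W := WW f π V y d with hWdef
  set M0 := 4 * K ^ d * α ^ 2 with hM0
  have hM0pos : 0 < M0 := by positivity
  have hWpos : 0 < W := hM0pos.trans hcon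
  set Z : Finset ι → (∀ i, Ω i) → ℝ := fun A x =>
    ∑ S ∈ univ.filter (fun S => A ⊆ S), cE A (fun x => FF f π V y d S x ^ 2) x with hZ
  have hZ0 : ∀ A x, 0 ≤ Z A x := fun A x => sum_nonneg fun S _ =>
    cE_nonneg _ (fun x => sq_nonneg _) x
  have hexZ : ∀ A, ex (Z A) = ∑ S ∈ univ.filter (fun S => A ⊆ S), ex (fun x => FF f π V y d S x ^ 2) := by
    intro A
    simp only [hZ]
    rw [ex_sum]
    apply sum_congr rfl
    intro S _
    exact ex_cE A (fun x => FF f π V y d S x ^ 2)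
  have hsumZ : ∑ A, ex (Z A) = 2 ^ d * W := by
    simp only [hexZ]
    exact Z_sum f π V y d
  have hZW : ∀ A x, Z A x ≤ W := by
    intro A x
    rcases A.eq_empty_or_nonempty with rfl | hne
    · apply le_of_eq
      simp only [hZ, empty_subset, filter_true, cE_empty]
      rw [hWdef, WW, ← sum_subset (subset_univ (lev V d))]
      · apply sum_congr rfl
        intro S hS
        simp [FF, hS]
      · intro S _ hS
        simp [FF, hS, ex_const]
    · exact (Z_bound f π V y d D K α hK IH hVD A hne x).trans hcon.le
  have hG : ∀ x, ∑ S, (1 / (4 * r) : ℝ) ^ S.card * FF f π V y d S x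
      = (1 / (4 * r) : ℝ) ^ d * ∑ S ∈ lev V d, gg f π V y S x := by
    intro x
    rw [mul_sum, ← sum_subset (subset_univ (lev V d))]
    · apply sum_congr rfl
      intro S hS
      simp [FF, hS, (mem_lev.1 hS).1]
    · intro S _ hS
      simp [FF, hS]
  have hyp := hyper hr _ (FF_pure f π V y d)
  simp only [hG, pure_sq _ (FF_pure f π V y d)] at hyp
  have hyp2 : ∑ A : Finset ι, 2 ^ A.card * ex (fun x => Z A x ^ r) ≤ 4 ^ d * W ^ r := by
    have : ∀ A : Finset ι, 2 ^ A.card * ex (fun x => Z A x ^ r) ≤ 2 ^ d * W ^ (r - 1) * ex (Z A) := by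
      intro A
      by_cases hAd : A.card ≤ d
      · have h1 : ex (fun x => Z A x ^ r) ≤ W ^ (r - 1) * ex (Z A) := by
          rw [← ex_smul]
          apply ex_mono
          intro x
          have : Z A x ^ r = Z A x ^ (r - 1) * Z A x := by rw [← pow_succ]; congr 1; omega
          rw [this]
          exact mul_le_mul_of_nonneg_right (pow_le_pow_left₀ (hZ0 A x) (hZW A x) _) (hZ0 A x)
        have h2 : (2 : ℝ) ^ A.card ≤ 2 ^ d := pow_le_pow_right₀ (by norm_num) hAd
        have h3 : 0 ≤ ex (fun x => Z A x ^ r) := ex_nonneg (fun x => pow_nonneg (hZ0 A x) _)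
        calc _ ≤ 2 ^ d * (W ^ (r - 1) * ex (Z A)) := mul_le_mul h2 h1 h3 (by positivity)
          _ = _ := by ring
      · have h0 : ∀ x, Z A x = 0 := by
          intro x
          apply sum_eq_zero
          intro S hS
          have hS : A ⊆ S := by simpa using hS
          have : S ∉ lev V d := by
            rw [mem_lev]; rintro ⟨h1, _⟩
            exact hAd ((card_le_card hS).trans h1.le)
          simp [FF, this, cE, ex_const]
        have : r ≠ 0 := by omega
        have hz : Z A = fun _ => 0 := funext h0
        rw [hz]
        simp [this, ex_const]
    refine (sum_le_sum fun A _ => this A).trans ?_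
    rw [← mul_sum, hsumZ]
    have h1 : W ^ r = W ^ (r - 1) * W := by rw [← pow_succ]; congr 1; omega
    have h2 : (4 : ℝ) ^ d = 2 ^ d * 2 ^ d := by rw [← mul_pow]; norm_num
    rw [h1, h2]
    apply le_of_eq; ring
  have hyp3 := hyp.trans hyp2
  simp only [mul_pow _ _ (2 * r)] at hyp3
  rw [ex_smul] at hyp3
  have hJ := av_jensen (fun t => f t * dl V y (π t))
    (fun t => ∑ S ∈ lev V d, gg f π V y S (π t)) hw hr
  rw [← WW_eq, ← hWdef] at hJ
  have hA' := hA V y (by omega)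
  have hav0 : 0 ≤ av (fun t => f t * dl V y (π t)) := av_nonneg hw
  have hdrop : av (fun t => f t * dl V y (π t) * (∑ S ∈ lev V d, gg f π V y S (π t)) ^ (2 * r))
      ≤ av (fun t => dl V y (π t) * (∑ S ∈ lev V d, gg f π V y S (π t)) ^ (2 * r)) := by
    apply av_mono
    intro t
    have h1 : 0 ≤ (∑ S ∈ lev V d, gg f π V y S (π t)) ^ (2 * r) := (even_two_mul r).pow_nonneg _
    have h2 := dl_nonneg V y (π t)
    have h3 := (hf t).2
    have h4 : f t * dl V y (π t) ≤ dl V y (π t) := mul_le_of_le_one_left h2 h3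
    exact mul_le_mul_of_nonneg_right h4 h1
  have hI' : (1 : ℝ) ≤ I := by exact_mod_cast hI
  have hB : ∀ S ∈ lev V d, ∀ x, |gg f π V y S x| ≤ 2 * Pm ^ D := by
    intro S hS x
    refine (gg_bound f π V y S Pm hPm hP (fun t => (hf t).1) x).trans ?_
    rw [(mem_lev.1 hS).1]
    have h1 : Pm ^ d ≤ Pm ^ D := pow_le_pow_right₀ hPm (by omega)
    exact mul_le_mul (by linarith) h1 (by positivity) (by norm_num)
  have hcmp := compare_pow f π V y d (2 * r) ((2 * r + 1) * D) ε0 (2 * Pm ^ D) hH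
    (by linarith [Nat.mul_le_mul_left (2 * r) (show d ≤ D by omega)]) hB
  have hlev : ((lev V d).card : ℝ) ≤ (I : ℝ) ^ D := by
    have h1 : (lev V d).card ≤ (Fintype.card ι) ^ d := by
      calc (lev V d).card ≤ (powersetCard d (univ : Finset ι)).card := by
            apply card_le_card
            intro S hS
            simp [mem_powersetCard, (mem_lev.1 hS).1]
        _ ≤ _ := by rw [card_powersetCard, card_univ]; exact Nat.choose_le_pow _ _
    have h2 : (lev V d).card ≤ I ^ D := by
      refine h1.trans ((Nat.pow_le_pow_left hι d).trans (Nat.pow_le_pow_right hI (by omega)))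
    exact_mod_cast h2
  have herr : ((lev V d).card * (2 * Pm ^ D)) ^ (2 * r) * ε0 ≤ α ^ (2 * r) := by
    refine le_trans ?_ hε
    gcongr
  have hKd : (1 : ℝ) ≤ K ^ d := one_le_pow₀ (by linarith)
  have hαW : α ^ (2 * r) ≤ W ^ r := by
    rw [pow_mul]
    apply pow_le_pow_left₀ (by positivity)
    refine le_trans ?_ hcon.le
    rw [hM0]
    linarith [mul_le_mul_of_nonneg_right hKd (sq_nonneg α), sq_nonneg α]
  set EG := ex (fun x => (∑ S ∈ lev V d, gg f π V y S x) ^ (2 * r)) with hEG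
  have hr0 : (0 : ℝ) < r := by exact_mod_cast hr
  have hEGb : EG ≤ ((4 * r : ℝ) ^ (2 * r)) ^ d * (4 ^ d * W ^ r) := by
    have h1 : ((1 / (4 * r) : ℝ) ^ d) ^ (2 * r) = (((4 * r : ℝ) ^ (2 * r)) ^ d)⁻¹ := by
      rw [one_div, inv_pow, inv_pow, ← pow_mul, ← pow_mul, mul_comm d]
    rw [h1, inv_mul_le_iff₀ (by positivity)] at hyp3
    exact hyp3
  have hfin : W ^ (2 * r) ≤ (2 * α) ^ (2 * r - 1) *
      (((4 * r : ℝ) ^ (2 * r)) ^ d * (4 ^ d * W ^ r) + W ^ r) := by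
    refine hJ.trans ?_
    apply mul_le_mul (pow_le_pow_left₀ hav0 hA' _)
    · refine hdrop.trans ?_
      have := (abs_le.1 hcmp).2
      linarith
    · exact av_nonneg (fun t => mul_nonneg (hw t) ((even_two_mul r).pow_nonneg _))
    · positivity
  set T : ℝ := 4 * (4 * r : ℝ) ^ (2 * r) with hT
  have hT1 : 1 ≤ T := by
    have : (1 : ℝ) ≤ (4 * r : ℝ) ^ (2 * r) := one_le_pow₀ (by
      have : (1 : ℝ) ≤ r := by exact_mod_cast hr
      linarith)
    linarith
  have hTd : ((4 * r : ℝ) ^ (2 * r)) ^ d * (4 ^ d * W ^ r) = T ^ d * W ^ r := by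
    rw [hT, mul_pow]; ring
  rw [hTd] at hfin
  have hTd1 : 1 ≤ T ^ d := one_le_pow₀ hT1
  have h2r : W ^ (2 * r) = W ^ r * W ^ r := by rw [← pow_add]; congr 1; omega
  have hWr : 0 < W ^ r := by positivity
  have hfin2 : W ^ r ≤ (2 * α) ^ (2 * r - 1) * (2 * T ^ d) := by
    have : W ^ r * W ^ r ≤ ((2 * α) ^ (2 * r - 1) * (2 * T ^ d)) * W ^ r := by
      rw [← h2r]
      refine hfin.trans ?_
      rw [mul_assoc]
      apply mul_le_mul_of_nonneg_left _ (by positivity)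
      linarith [mul_le_mul_of_nonneg_right hTd1 hWr.le]
    exact le_of_mul_le_mul_right this hWr
  have hTd2 : d ≠ 0 → T ^ d ≤ α * (K ^ d) ^ r := by
    intro hd
    calc T ^ d ≤ (α * K ^ r) ^ d := pow_le_pow_left₀ (by linarith) hK2 d
      _ = α ^ d * (K ^ d) ^ r := by rw [mul_pow, ← pow_mul, ← pow_mul, mul_comm r]
      _ ≤ α * (K ^ d) ^ r := by
        apply mul_le_mul_of_nonneg_right _ (by positivity)
        exact pow_le_of_le_one hα.le hα1 hd
  have hM0r : M0 ^ r < W ^ r := pow_lt_pow_left₀ hcon hM0pos.le (by omega)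
  have hM0e : M0 ^ r = (2 * α) ^ (2 * r - 1) * (2 * α) * (K ^ d) ^ r := by
    rw [← pow_succ, show 2 * r - 1 + 1 = 2 * r by omega, pow_mul, ← mul_pow, hM0]
    congr 1; ring
  by_cases hd : d = 0
  · subst hd
    have : W ≤ M0 := by
      have h1 : lev V 0 = {∅} := by ext S; simp [mem_lev]; rintro rfl; simp
      rw [hWdef, WW, h1, sum_singleton]
      have : ∀ x, gg f π V y ∅ x = av (fun t => f t * dl V y (π t)) := by
        intro x; simp [gg, kp]
      simp only [this, ex_const]
      have h5 := pow_le_pow_left₀ hav0 hA' 2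
      rw [hM0, pow_zero]
      linarith [h5, mul_pow 2 α 2]
    exact absurd hcon this.not_gt
  · have := hTd2 hd
    have h3 : (2 * α) ^ (2 * r - 1) * (2 * T ^ d) ≤ (2 * α) ^ (2 * r - 1) * (2 * α) * (K ^ d) ^ r := by
      rw [mul_assoc ((2 * α) ^ (2 * r - 1))]
      apply mul_le_mul_of_nonneg_left _ (by positivity)
      linarith
    linarith

end Level3
end BM

namespace BM
open Finset

section Weyl

noncomputable def ee (x : ℝ) : ℂ := Complex.exp (2 * Real.pi * x * Complex.I)

lemma ee_add (x y : ℝ) : ee (x + y) = ee x * ee y := by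
  simp only [ee]; rw [← Complex.exp_add]; congr 1; push_cast; ring

lemma ee_zero : ee 0 = 1 := by simp [ee]

lemma ee_norm (x : ℝ) : ‖ee x‖ = 1 := by
  have : ee x = Complex.exp ((2 * Real.pi * x : ℝ) * Complex.I) := by simp [ee]
  rw [this, Complex.norm_exp_ofReal_mul_I]

lemma ee_int (m : ℤ) : ee m = 1 := by
  simp only [ee]
  rw [Complex.exp_eq_one_iff]
  exact ⟨m, by push_cast; ring⟩

lemma ee_neg (x : ℝ) : ee (-x) = (starRingEnd ℂ) (ee x) := by
  simp only [ee]
  rw [← Complex.exp_conj]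
  congr 1
  simp
  left; exact (map_ofNat _ 2).symm

lemma ee_sub (x y : ℝ) : ee (x - y) = ee x * (starRingEnd ℂ) (ee y) := by
  rw [sub_eq_add_neg, ee_add, ee_neg]

lemma ee_mul_nat (x : ℝ) (n : ℕ) : ee (n * x) = ee x ^ n := by
  simp only [ee]; rw [← Complex.exp_nat_mul]; congr 1; push_cast; ring

lemma ee_sub_one_norm (x : ℝ) : ‖ee x - 1‖ = 2 * |Real.sin (Real.pi * x)| := by
  have : ee x = Complex.exp (Complex.I * (2 * Real.pi * x : ℝ)) := by
    simp only [ee]; congr 1; push_cast; ring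
  rw [this, Complex.norm_exp_I_mul_ofReal_sub_one]
  rw [Real.norm_eq_abs, abs_mul, abs_of_pos (by norm_num : (0 : ℝ) < 2)]
  congr 3; ring

lemma ee_sub_one_le (x : ℝ) : ‖ee x - 1‖ ≤ 2 * Real.pi * |x| := by
  rw [ee_sub_one_norm]
  have := Real.abs_sin_le_abs (x := Real.pi * x)
  rw [abs_mul, abs_of_pos Real.pi_pos] at this
  linarith

lemma ee_sub_le (x y : ℝ) : ‖ee x - ee y‖ ≤ 2 * Real.pi * |x - y| := by
  have : ee x - ee y = ee y * (ee (x - y) - 1) := by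
    rw [mul_sub, ← ee_add]; simp
  rw [this, norm_mul, ee_norm, one_mul]
  exact ee_sub_one_le _

lemma ee_sub_one_ge (x : ℝ) (hx : |x| ≤ 1 / 2) : 4 * |x| ≤ ‖ee x - 1‖ := by
  rw [ee_sub_one_norm]
  have h := Real.mul_le_sin (x := Real.pi * |x|) (by positivity) (by nlinarith [Real.pi_pos])
  have h2 : |Real.sin (Real.pi * x)| = |Real.sin (Real.pi * |x|)| := by
    rcases abs_choice x with h | h <;> rw [h]
    simp
  rw [h2]
  have h3 := le_abs_self (Real.sin (Real.pi * |x|))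
  have h4 : 2 / Real.pi * (Real.pi * |x|) = 2 * |x| := by field_simp
  linarith

lemma geom_bound (a b : ℝ) (Y : ℕ) (m : ℤ) (hm : |a - m| ≤ 1 / 2) :
    2 * |a - m| * ‖∑ n ∈ range Y, ee (b + a * n)‖ ≤ 1 := by
  have h1 : ∑ n ∈ range Y, ee (b + a * n) = ee b * ∑ n ∈ range Y, ee (a - m) ^ n := by
    rw [mul_sum]
    apply sum_congr rfl
    intro n _
    rw [ee_add, ← ee_mul_nat]
    congr 1
    have : a * n = n * (a - m) + ((m * n : ℤ) : ℝ) := by push_cast; ring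
    rw [this, ee_add, ee_int, mul_one]
  have h2 := geom_sum_mul (ee (a - m)) Y
  have h3 : ‖∑ n ∈ range Y, ee (a - m) ^ n‖ * ‖ee (a - m) - 1‖ ≤ 2 := by
    rw [← norm_mul, h2]
    refine (norm_sub_le _ _).trans ?_
    rw [norm_pow, ee_norm]; norm_num
  rw [h1, norm_mul, ee_norm, one_mul]
  have h4 := ee_sub_one_ge _ hm
  nlinarith [norm_nonneg (∑ n ∈ range Y, ee (a - m) ^ n)]

lemma vdc_id (z : ℕ → ℂ) (hz : ∀ n, ‖z n‖ = 1) (Y : ℕ) :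
    ‖∑ n ∈ range Y, z n‖ ^ 2 = Y + 2 * (∑ h ∈ range Y, ∑ n ∈ range (Y - h - 1),
      z (n + h + 1) * (starRingEnd ℂ) (z n)).re := by
  induction Y with
  | zero => simp
  | succ Y ih =>
    have e : ∑ h ∈ range (Y + 1), ∑ n ∈ range (Y + 1 - h - 1), z (n + h + 1) * (starRingEnd ℂ) (z n)
        = (∑ h ∈ range Y, ∑ n ∈ range (Y - h - 1), z (n + h + 1) * (starRingEnd ℂ) (z n))
          + z Y * (starRingEnd ℂ) (∑ n ∈ range Y, z n) := by
      rw [sum_range_succ]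
      simp only [show Y + 1 - Y - 1 = 0 by omega, range_zero, sum_empty, add_zero]
      have hr : ∑ n ∈ range Y, z n = ∑ h ∈ range Y, z (Y - 1 - h) := (sum_range_reflect z Y).symm
      rw [hr, map_sum, mul_sum, ← sum_add_distrib]
      apply sum_congr rfl
      intro h hh
      have hh := mem_range.1 hh
      rw [show Y + 1 - h - 1 = (Y - h - 1) + 1 by omega, sum_range_succ,
        show Y - h - 1 + h + 1 = Y by omega, show Y - h - 1 = Y - 1 - h by omega]
    rw [e, Complex.add_re, sum_range_succ]
    have h2 : ‖∑ n ∈ range Y, z n + z Y‖ ^ 2 = ‖∑ n ∈ range Y, z n‖ ^ 2 + ‖z Y‖ ^ 2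
        + 2 * (z Y * (starRingEnd ℂ) (∑ n ∈ range Y, z n)).re := by
      rw [← Complex.normSq_eq_norm_sq, ← Complex.normSq_eq_norm_sq, ← Complex.normSq_eq_norm_sq,
        add_comm, Complex.normSq_add]
      ring
    rw [h2, ih, hz]
    push_cast
    ring

lemma vdc (z : ℕ → ℂ) (hz : ∀ n, ‖z n‖ = 1) (Y : ℕ) :
    ‖∑ n ∈ range Y, z n‖ ^ 2 ≤ Y + 2 * ∑ h ∈ range Y, ‖∑ n ∈ range (Y - h - 1),
      z (n + h + 1) * (starRingEnd ℂ) (z n)‖ := by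
  rw [vdc_id z hz]
  have := (Complex.re_le_norm (∑ h ∈ range Y, ∑ n ∈ range (Y - h - 1),
      z (n + h + 1) * (starRingEnd ℂ) (z n))).trans (norm_sum_le _ _)
  linarith

lemma vdc_many (z : ℕ → ℂ) (hz : ∀ n, ‖z n‖ = 1) (Y T : ℕ) (hT : 1 ≤ T) (hY : 2 * T ^ 2 ≤ Y)
    (hS : (Y : ℝ) ≤ T * ‖∑ n ∈ range Y, z n‖) :
    (Y : ℝ) ≤ 8 * T ^ 2 * ((range Y).filter (fun h => (Y : ℝ) ≤ 8 * T ^ 2 *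
      ‖∑ n ∈ range (Y - h - 1), z (n + h + 1) * (starRingEnd ℂ) (z n)‖)).card := by
  have hv := vdc z hz Y
  set s : ℕ → ℝ := fun h => ‖∑ n ∈ range (Y - h - 1), z (n + h + 1) * (starRingEnd ℂ) (z n)‖ with hs
  have hsY : ∀ h, s h ≤ Y := by
    intro h
    simp only [hs]
    refine (norm_sum_le _ _).trans ?_
    simp only [norm_mul, hz, RCLike.norm_conj]
    simp
    omega
  have hT0 : (1 : ℝ) ≤ T := by exact_mod_cast hT
  have hY' : 2 * (T : ℝ) ^ 2 ≤ Y := by exact_mod_cast hY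
  have hYpos : (0 : ℝ) < Y := by nlinarith
  set c := ((range Y).filter (fun h => (Y : ℝ) ≤ 8 * T ^ 2 * s h)).card with hc
  have h1 : ∑ h ∈ range Y, s h ≤ c * Y + Y * (Y / (8 * T ^ 2)) := by
    rw [← sum_filter_add_sum_filter_not (range Y) (fun h => (Y : ℝ) ≤ 8 * T ^ 2 * s h)]
    apply add_le_add
    · refine (sum_le_sum (fun h _ => hsY h)).trans ?_
      simp [hc]
    · refine (sum_le_sum (g := fun _ => (Y : ℝ) / (8 * T ^ 2)) (fun h hh => ?_)).trans ?_
      · simp only [mem_filter, not_le] at hh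
        rw [le_div_iff₀ (by positivity)]
        linarith [hh.2]
      · rw [sum_const, nsmul_eq_mul]
        apply mul_le_mul_of_nonneg_right _ (by positivity)
        exact_mod_cast (card_filter_le _ _).trans (by simp)
  have h2 : (Y : ℝ) ^ 2 ≤ T ^ 2 * (Y + 2 * (c * Y + Y * (Y / (8 * T ^ 2)))) := by
    have : (Y : ℝ) ^ 2 ≤ (T * ‖∑ n ∈ range Y, z n‖) ^ 2 := pow_le_pow_left₀ (by positivity) hS 2
    rw [mul_pow] at this
    refine this.trans ?_
    apply mul_le_mul_of_nonneg_left _ (by positivity)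
    linarith
  have h3 : (T : ℝ) ^ 2 * (Y + 2 * (c * Y + Y * (Y / (8 * T ^ 2))))
      = Y * (T ^ 2 + 2 * T ^ 2 * c + Y / 4) := by
    field_simp; ring
  rw [h3, sq] at h2
  have h4 := le_of_mul_le_mul_left h2 hYpos
  linarith

lemma count_res (q Y B : ℕ) (a : ℤ) (hq : 1 ≤ q) (hco : IsCoprime a (q : ℤ)) (H : Finset ℕ)
    (hH : ∀ h ∈ H, h ≤ Y) (hr : ∀ h ∈ H, ∃ m : ℤ, |h * a - m * q| ≤ B) :
    H.card ≤ (Y / q + 1) * (2 * B + 1) := by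
  classical
  choose! m hm using hr
  have hinj : ((range (Y / q + 1)) ×ˢ (Icc (-(B : ℤ)) B)).card = (Y / q + 1) * (2 * B + 1) := by
    rw [card_product, card_range, Int.card_Icc]
    congr 1; omega
  rw [← hinj]
  apply card_le_card_of_injOn (fun h => (h / q, (h : ℤ) * a - m h * q))
  · intro h hh
    have := abs_le.1 (hm h hh)
    simp only [coe_product, Set.mem_prod, coe_range, Set.mem_Iio, coe_Icc, Set.mem_Icc]
    exact ⟨Nat.lt_succ_of_le (Nat.div_le_div_right (hH h hh)), this.1, this.2⟩
  · intro h _ h' _ heq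
    simp only [Prod.mk.injEq] at heq
    obtain ⟨h1, h2⟩ := heq
    have hdvd : (q : ℤ) ∣ ((h : ℤ) - h') * a := ⟨m h - m h', by linarith⟩
    have hdvd2 : (q : ℤ) ∣ (h : ℤ) - h' := hco.symm.dvd_of_dvd_mul_right hdvd
    have h3 : h % q = h' % q := by
      have := (Int.emod_emod_of_dvd (h : ℤ) (dvd_refl (q : ℤ)))
      have h4 := Int.emod_emod_of_dvd
      have : (h : ℤ) ≡ h' [ZMOD q] := (Int.modEq_iff_dvd.2 (by
        rw [← neg_sub, dvd_neg]; exact hdvd2))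
      have := (Int.natCast_modEq_iff).1 this
      exact this
    rw [← Nat.div_add_mod h q, ← Nat.div_add_mod h' q, h1, h3]

lemma lemmaV (β δ : ℝ) (T Y : ℕ) (hT : 1 ≤ T) (hδ0 : 0 ≤ δ) (hδ : 32 * T * δ < 1) (hY : 32 * T ≤ Y)
    (H : Finset ℕ) (hH : ∀ h ∈ H, 1 ≤ h ∧ h ≤ Y) (hcard : Y ≤ T * H.card)
    (hm : ∀ h ∈ H, ∃ m : ℤ, |h * β - m| ≤ δ) :
    ∃ q : ℕ, 1 ≤ q ∧ q ≤ 8 * T ∧ ∃ m : ℤ, |q * β - m| * Y ≤ 8 * T ^ 2 * δ := by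
  have hTr : (1 : ℝ) ≤ T := by exact_mod_cast hT
  have hY0 : 0 < Y := by omega
  have hYr : 32 * (T : ℝ) ≤ Y := by exact_mod_cast hY
  obtain ⟨ρ, hρ, hden⟩ := Real.exists_rat_abs_sub_le_and_den_le β (n := 2 * Y) (by omega)
  set q := ρ.den with hq
  have hq1 : 1 ≤ q := ρ.den_pos
  have hqr : (1 : ℝ) ≤ q := by exact_mod_cast hq1
  have hρ' : (ρ : ℝ) = ρ.num / q := Rat.cast_def ρ
  have hco : IsCoprime ρ.num (q : ℤ) := by
    rw [Int.isCoprime_iff_gcd_eq_one]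
    exact ρ.reduced
  set γ := β - ρ with hγ
  have hγb : ∀ h : ℕ, h ≤ Y → |h * γ| * (2 * q) < 1 := by
    intro h hh
    rw [abs_mul, Nat.abs_cast]
    have h1 : (h : ℝ) ≤ Y := by exact_mod_cast hh
    push_cast at hρ
    rw [le_div_iff₀ (by positivity)] at hρ
    have h2 : |γ| * ((2 * Y + 1) * q) ≤ 1 := hρ
    have h3 := abs_nonneg γ
    rcases h3.eq_or_lt with h0 | h0
    · rw [← h0]; norm_num
    · have : (h : ℝ) * |γ| * (2 * q) ≤ Y * |γ| * (2 * q) := by gcongr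
      nlinarith [mul_pos h0 (by linarith : (0:ℝ) < q)]
  have hqm : ∀ h ∈ H, ∀ m : ℤ, |h * β - m| ≤ δ → |(h : ℝ) * ρ.num - m * q| < δ * q + 1 / 2 := by
    intro h hh m hm
    have h1 := hγb h (hH h hh).2
    have : (h : ℝ) * ρ.num - m * q = (h * β - m) * q - (h * γ) * q := by
      rw [hγ, hρ']; field_simp; ring
    rw [this]
    refine (abs_sub _ _).trans_lt ?_
    rw [abs_mul, abs_mul _ (q : ℝ), Nat.abs_cast]
    have := mul_le_mul_of_nonneg_right hm (by linarith : (0 : ℝ) ≤ q)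
    linarith
  have hHr : (Y : ℝ) ≤ T * H.card := by exact_mod_cast hcard
  have hq8 : q ≤ 8 * T := by
    by_contra hcon
    push Not at hcon
    set B := ⌊δ * q + 1 / 2⌋₊ with hB
    have hBle : (B : ℝ) ≤ δ * q + 1 / 2 := Nat.floor_le (by positivity)
    have hc := count_res q Y B ρ.num hq1 hco H (fun h hh => (hH h hh).2) (by
      intro h hh
      obtain ⟨m, hm⟩ := hm h hh
      refine ⟨m, ?_⟩
      have h1 := hqm h hh m hm
      have h2 : ((|h * ρ.num - m * q| : ℤ) : ℝ) = |(h : ℝ) * ρ.num - m * q| := by push_cast; rfl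
      rw [← h2] at h1
      have h3 : ((h * ρ.num - m * q : ℤ).natAbs : ℝ) = ((|h * ρ.num - m * q| : ℤ) : ℝ) := by
        rw [Nat.cast_natAbs]
      rw [← h3] at h1
      have h4 : (h * ρ.num - m * q : ℤ).natAbs ≤ B := Nat.le_floor h1.le
      rw [Int.abs_eq_natAbs]
      exact_mod_cast h4)
    have hcr : (H.card : ℝ) ≤ (Y / q + 1) * (2 * (δ * q + 1 / 2) + 1) := by
      have h1 : (H.card : ℝ) ≤ ((Y / q : ℕ) + 1) * (2 * B + 1) := by exact_mod_cast hc
      have h2 : ((Y / q : ℕ) : ℝ) ≤ Y / q := Nat.cast_div_le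
      refine h1.trans ?_
      gcongr
    have hq8r : 8 * (T : ℝ) < q := by exact_mod_cast hcon
    have hq2Y : (q : ℝ) ≤ 2 * Y := by exact_mod_cast hden
    have e : ((Y : ℝ) / q + 1) * (2 * (δ * q + 1 / 2) + 1) = 2 * δ * Y + 2 * (Y / q) + 2 * δ * q + 2 := by
      field_simp; ring
    rw [e] at hcr
    have h1 : T * ((Y : ℝ) / q) ≤ Y / 8 := by
      rw [mul_div_assoc', div_le_iff₀ (by linarith)]
      nlinarith
    have h2 : T * (2 * δ * Y) ≤ Y / 16 := by nlinarith
    have h3 : T * (2 * δ * q) ≤ Y / 8 := by nlinarith [mul_nonneg hδ0 (by linarith : (0:ℝ) ≤ T)]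
    nlinarith
  have hq8r : (q : ℝ) ≤ 8 * T := by exact_mod_cast hq8
  have hδq : δ * q < 1 / 2 := by nlinarith
  obtain ⟨h, hh, hhT⟩ : ∃ h ∈ H, Y ≤ T * h := by
    by_contra hcon
    push Not at hcon
    have hsub : H ⊆ Icc 1 ((Y - 1) / T) := by
      intro h hh
      rw [mem_Icc]
      refine ⟨(hH h hh).1, ?_⟩
      rw [Nat.le_div_iff_mul_le (by omega)]
      have := hcon h hh
      rw [mul_comm]; omega
    have h1 := card_le_card hsub
    rw [Nat.card_Icc] at h1
    have h2 : T * ((Y - 1) / T) ≤ Y - 1 := Nat.mul_div_le _ _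
    have h3 : T * H.card ≤ T * ((Y - 1) / T) := Nat.mul_le_mul_left _ (by simpa using h1)
    omega
  obtain ⟨m, hm⟩ := hm h hh
  have h1 := hqm h hh m hm
  have h2 : (h * ρ.num - m * q : ℤ) = 0 := by
    have : (|(h * ρ.num - m * q : ℤ)| : ℤ) < 1 := by
      have : ((|h * ρ.num - m * q| : ℤ) : ℝ) < 1 := by push_cast; linarith
      exact_mod_cast this
    exact Int.abs_lt_one_iff.1 this
  have h3 : (h : ℝ) * ρ.num - m * q = 0 := by exact_mod_cast h2
  have h4 : h * β - m = h * γ := by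
    have : (m : ℝ) = h * ρ := by rw [hρ']; field_simp; linarith
    rw [this, hγ]; ring
  rw [h4, abs_mul, Nat.abs_cast] at hm
  refine ⟨q, hq1, hq8, ρ.num, ?_⟩
  have h5 : q * β - ρ.num = q * γ := by rw [hγ, hρ']; field_simp
  rw [h5, abs_mul, Nat.abs_cast]
  have h6 : (Y : ℝ) ≤ T * h := by exact_mod_cast hhT
  have h7 := abs_nonneg γ
  calc (q : ℝ) * |γ| * Y ≤ (8 * T) * |γ| * (T * h) := by gcongr
    _ = 8 * T ^ 2 * (h * |γ|) := by ring
    _ ≤ _ := by gcongr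

end Weyl
end BM

namespace BM
open Finset

section Weyl2

noncomputable def dP (P : Polynomial ℝ) (r : ℝ) : Polynomial ℝ := Polynomial.taylor r P - P

lemma dP_eval (P : Polynomial ℝ) (r s : ℝ) : (dP P r).eval s = P.eval (s + r) - P.eval s := by
  simp [dP, Polynomial.taylor_eval]

lemma taylor_coeff_top (P : Polynomial ℝ) (k : ℕ) (hP : P.natDegree ≤ k) (r : ℝ) :
    (Polynomial.taylor r P).coeff k = P.coeff k := by
  rw [Polynomial.taylor_coeff]
  have h0 : (Polynomial.hasseDeriv k P).natDegree ≤ 0 := by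
    refine (Polynomial.natDegree_hasseDeriv_le P k).trans (by omega)
  rw [Polynomial.eval_eq_sum_range' (n := 1) (by omega)]
  simp [Polynomial.hasseDeriv_coeff]

lemma taylor_coeff_top2 (P : Polynomial ℝ) (k : ℕ) (hP : P.natDegree ≤ k + 1) (r : ℝ) :
    (Polynomial.taylor r P).coeff k = P.coeff k + (k + 1) * P.coeff (k + 1) * r := by
  rw [Polynomial.taylor_coeff]
  have h0 : (Polynomial.hasseDeriv k P).natDegree ≤ 1 := by
    refine (Polynomial.natDegree_hasseDeriv_le P k).trans (by omega)
  rw [Polynomial.eval_eq_sum_range' (n := 2) (by omega)]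
  simp [Polynomial.hasseDeriv_coeff, sum_range_succ]
  rw [add_comm 1 k]
  left
  rw [Nat.choose_succ_self_right]
  push_cast; ring

lemma dP_natDegree (P : Polynomial ℝ) (k : ℕ) (hP : P.natDegree ≤ k + 1) (r : ℝ) :
    (dP P r).natDegree ≤ k := by
  rw [Polynomial.natDegree_le_iff_coeff_eq_zero]
  intro N hN
  rw [dP, Polynomial.coeff_sub, taylor_coeff_top P N (by omega), sub_self]

lemma dP_coeff (P : Polynomial ℝ) (k : ℕ) (hP : P.natDegree ≤ k + 1) (r : ℝ) :
    (dP P r).coeff k = (k + 1) * P.coeff (k + 1) * r := by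
  rw [dP, Polynomial.coeff_sub, taylor_coeff_top2 P k hP]; ring

def WTop (k c : ℕ) : Prop := ∀ (T Y : ℕ) (P : Polynomial ℝ), 2 ≤ T → 1 ≤ Y → P.natDegree ≤ k →
    (Y : ℝ) ≤ T * ‖∑ n ∈ range Y, ee (P.eval (n : ℝ))‖ →
    ∃ q : ℕ, 1 ≤ q ∧ q ≤ T ^ c ∧ ∃ m : ℤ, |q * P.coeff k - m| * (Y : ℝ) ^ k ≤ (T : ℝ) ^ c

lemma wtop_one : WTop 1 1 := by
  intro T Y P hT hY hP hS
  refine ⟨1, le_refl _, by simp; omega, round (P.coeff 1), ?_⟩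
  have hr := abs_sub_round (P.coeff 1)
  have e : ∀ n : ℕ, P.eval (n : ℝ) = P.coeff 0 + P.coeff 1 * n := by
    intro n
    rw [Polynomial.eval_eq_sum_range' (n := 2) (by omega)]
    simp [sum_range_succ]
  simp only [e] at hS
  have h := geom_bound (P.coeff 1) (P.coeff 0) Y (round (P.coeff 1)) hr
  set d := |P.coeff 1 - round (P.coeff 1)| with hd
  have hd0 : 0 ≤ d := abs_nonneg _
  have hT0 : (0 : ℝ) ≤ T := by positivity
  simp only [Nat.cast_one, one_mul, pow_one]
  rw [← hd]
  set s := ‖∑ n ∈ range Y, ee (P.coeff 0 + P.coeff 1 * n)‖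
  calc d * Y ≤ d * (T * s) := by gcongr
    _ = T * (d * s) := by ring
    _ ≤ T * 1 := by gcongr; nlinarith [norm_nonneg (∑ n ∈ range Y, ee (P.coeff 0 + P.coeff 1 * n))]
    _ = T := by ring

lemma wtop_succ (k c : ℕ) (hk : 1 ≤ k) (hc : WTop k c) :
    WTop (k + 1) ((10 * c + 20) * (k + 1) + 15 * c + 5 * k + 20) := by
  intro T Y P hT hY hP hS
  set C := (10 * c + 20) * (k + 1) + 15 * c + 5 * k + 20 with hC
  have hTr : (2 : ℝ) ≤ T := by exact_mod_cast hT
  have hT1 : (1 : ℝ) ≤ T := by linarith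
  by_cases hbig : Y < T ^ (10 * c + 20)
  · refine ⟨1, le_refl _, Nat.one_le_pow _ _ (by omega), round (P.coeff (k + 1)), ?_⟩
    have hr := abs_sub_round (P.coeff (k + 1))
    simp only [Nat.cast_one, one_mul]
    have h1 : (Y : ℝ) ≤ (T : ℝ) ^ (10 * c + 20) := by exact_mod_cast hbig.le
    calc _ ≤ (1 : ℝ) * ((T : ℝ) ^ (10 * c + 20)) ^ (k + 1) := by gcongr; linarith
      _ = (T : ℝ) ^ ((10 * c + 20) * (k + 1)) := by rw [one_mul, pow_mul]
      _ ≤ _ := pow_le_pow_right₀ hT1 (by omega)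
  push Not at hbig
  have hbigr : (T : ℝ) ^ (10 * c + 20) ≤ Y := by exact_mod_cast hbig
  set T1 := T ^ 5 with hT1def
  have hT1ge : 8 * T ^ 2 ≤ T1 := by
    have : 2 ^ 3 ≤ T ^ 3 := Nat.pow_le_pow_left hT 3
    calc 8 * T ^ 2 ≤ T ^ 3 * T ^ 2 := Nat.mul_le_mul_right _ (by simpa using this)
      _ = T1 := by rw [hT1def]; ring
  have hT1ger : 8 * (T : ℝ) ^ 2 ≤ T1 := by exact_mod_cast hT1ge
  have hT12 : 2 ≤ T1 := by nlinarith
  have hYT : T1 ≤ Y := by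
    refine le_trans ?_ hbig
    rw [hT1def]; exact Nat.pow_le_pow_right (by omega) (by omega)
  have hmany := vdc_many (fun n => ee (P.eval (n : ℝ))) (fun n => ee_norm _) Y T (by omega) (by omega) hS
  set s := (range Y).filter (fun h => (Y : ℝ) ≤ 8 * T ^ 2 * ‖∑ n ∈ range (Y - h - 1),
      ee (P.eval ((n + h + 1 : ℕ) : ℝ)) * (starRingEnd ℂ) (ee (P.eval (n : ℝ)))‖) with hs
  have hYr : (0 : ℝ) < Y := by exact_mod_cast hY
  have key : ∀ h ∈ s, ∃ q : ℕ, 1 ≤ q ∧ q ≤ T1 ^ c ∧ ∃ m : ℤ,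
      |((h + 1 : ℕ) : ℝ) * (q * (k + 1) * P.coeff (k + 1)) - m| * (Y : ℝ) ^ k ≤ (T1 : ℝ) ^ (c + k) := by
    intro h hh
    simp only [hs, mem_filter, mem_range] at hh
    obtain ⟨hhY, hh⟩ := hh
    have e : ∀ n : ℕ, ee (P.eval ((n + h + 1 : ℕ) : ℝ)) * (starRingEnd ℂ) (ee (P.eval (n : ℝ)))
        = ee ((dP P ((h + 1 : ℕ) : ℝ)).eval (n : ℝ)) := by
      intro n
      rw [← ee_sub, dP_eval]
      congr 3
      push_cast; ring
    simp only [e] at hh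
    set Yh := Y - h - 1 with hYh
    have hle : ‖∑ n ∈ range Yh, ee ((dP P ((h + 1 : ℕ) : ℝ)).eval (n : ℝ))‖ ≤ Yh := by
      refine (norm_sum_le _ _).trans ?_
      simp [ee_norm]
    set S := ‖∑ n ∈ range Yh, ee ((dP P ((h + 1 : ℕ) : ℝ)).eval (n : ℝ))‖ with hSd
    have hS0 : 0 ≤ S := norm_nonneg _
    have hYS : (Y : ℝ) ≤ T1 * S := hh.trans (by gcongr)
    have hYYh : (Y : ℝ) ≤ T1 * Yh := hYS.trans (by gcongr)
    have hYh1 : 1 ≤ Yh := by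
      by_contra hcon
      have : Yh = 0 := by omega
      rw [this] at hYYh
      simp at hYYh
      linarith
    have hYhY : (Yh : ℝ) ≤ Y := by exact_mod_cast (by omega : Yh ≤ Y)
    obtain ⟨q, hq1, hq2, m, hm⟩ := hc T1 Yh (dP P ((h + 1 : ℕ) : ℝ)) hT12 hYh1
      (dP_natDegree P k hP _) (hYhY.trans hYS)
    refine ⟨q, hq1, hq2, m, ?_⟩
    rw [dP_coeff P k hP] at hm
    have e2 : ((h + 1 : ℕ) : ℝ) * (q * (k + 1) * P.coeff (k + 1)) - m
      = q * ((k + 1) * P.coeff (k + 1) * ((h + 1 : ℕ) : ℝ)) - m := by ring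
    rw [e2]
    set A := |(q : ℝ) * ((k + 1) * P.coeff (k + 1) * ((h + 1 : ℕ) : ℝ)) - m| with hA
    calc A * (Y : ℝ) ^ k ≤ A * (T1 * Yh) ^ k := by gcongr
      _ = T1 ^ k * (A * (Yh : ℝ) ^ k) := by rw [mul_pow]; ring
      _ ≤ T1 ^ k * T1 ^ c := by gcongr
      _ = _ := by rw [← pow_add, add_comm]
  choose! qf hq1 hq2 hqm using key
  have hT1c : 1 ≤ T1 ^ c := Nat.one_le_pow _ _ (by omega)
  obtain ⟨q, hqmem, hqc⟩ := exists_le_card_fiber_of_nsmul_le_card_of_maps_to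
    (s := s) (t := Icc 1 (T1 ^ c)) (f := qf) (b := (s.card : ℝ) / (T1 ^ c : ℕ))
    (fun h hh => mem_Icc.2 ⟨hq1 h hh, hq2 h hh⟩) ⟨1, mem_Icc.2 ⟨le_refl _, hT1c⟩⟩
    (by
      rw [Nat.card_Icc, nsmul_eq_mul, Nat.add_sub_cancel]
      have : ((T1 ^ c : ℕ) : ℝ) ≠ 0 := by positivity
      rw [mul_div_cancel₀ _ this])
  rw [mem_Icc] at hqmem
  rw [div_le_iff₀ (by positivity)] at hqc
  set fib := s.filter (fun h => qf h = q) with hfib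
  set H := fib.image (fun h => h + 1) with hH
  have hHc : H.card = fib.card := card_image_of_injective _ (fun a b h => by simpa using h)
  set T' := T1 ^ (c + 1) with hT'
  have hcardH : Y ≤ T' * H.card := by
    have : (Y : ℝ) ≤ T1 * (fib.card * (T1 ^ c : ℕ)) := by
      refine hmany.trans ?_
      gcongr
    rw [hHc, hT', pow_succ]
    have : (Y : ℝ) ≤ ((T1 ^ c * T1 * fib.card : ℕ) : ℝ) := by
      push_cast at this ⊢; linarith
    exact_mod_cast this
  set β : ℝ := q * (k + 1) * P.coeff (k + 1) with hβ
  set δ : ℝ := (T1 : ℝ) ^ (c + k) / (Y : ℝ) ^ k with hδ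
  have hYk : (0 : ℝ) < (Y : ℝ) ^ k := by positivity
  have hT1pow : ∀ j, (T1 : ℝ) ^ j = (T : ℝ) ^ (5 * j) := by
    intro j; rw [hT1def]; push_cast; rw [← pow_mul]
  have h32 : (32 : ℝ) ≤ (T : ℝ) ^ 5 := by
    calc (32 : ℝ) = 2 ^ 5 := by norm_num
      _ ≤ _ := by gcongr
  have hT'r : (T' : ℝ) = (T : ℝ) ^ (5 * (c + 1)) := by rw [hT']; push_cast; exact hT1pow _
  have hV := lemmaV β δ T' Y (Nat.one_le_pow _ _ (by omega)) (by positivity) (by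
      rw [hδ, mul_div_assoc', div_lt_one hYk, hT'r, hT1pow]
      calc 32 * (T : ℝ) ^ (5 * (c + 1)) * (T : ℝ) ^ (5 * (c + k))
          ≤ (T : ℝ) ^ 5 * (T : ℝ) ^ (5 * (c + 1)) * (T : ℝ) ^ (5 * (c + k)) := by gcongr
        _ = (T : ℝ) ^ (5 + 5 * (c + 1) + 5 * (c + k)) := by rw [pow_add, pow_add]
        _ < (T : ℝ) ^ ((10 * c + 20) * k) := by
            apply pow_lt_pow_right₀ (by linarith)
            linarith [Nat.le_mul_of_pos_right c (show 0 < k by omega)]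
        _ = ((T : ℝ) ^ (10 * c + 20)) ^ k := by rw [pow_mul]
        _ ≤ _ := by gcongr)
    (by
      have : (32 * T' : ℝ) ≤ Y := by
        rw [hT'r]
        refine le_trans ?_ hbigr
        calc 32 * (T : ℝ) ^ (5 * (c + 1)) ≤ (T : ℝ) ^ 5 * (T : ℝ) ^ (5 * (c + 1)) := by gcongr
          _ = (T : ℝ) ^ (5 + 5 * (c + 1)) := by rw [pow_add]
          _ ≤ _ := pow_le_pow_right₀ hT1 (by omega)
      exact_mod_cast this)
    H (by
      intro h hh
      simp only [hH, mem_image, hfib, mem_filter, hs, mem_range] at hh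
      obtain ⟨a, ha, rfl⟩ := hh
      omega)
    hcardH (by
      intro h hh
      simp only [hH, mem_image] at hh
      obtain ⟨a, ha, rfl⟩ := hh
      rw [hfib, mem_filter] at ha
      obtain ⟨m, hm⟩ := hqm a ha.1
      refine ⟨m, ?_⟩
      rw [ha.2] at hm
      rw [hδ, le_div_iff₀ hYk]
      exact hm)
  obtain ⟨q1, hq11, hq12, m, hm⟩ := hV
  have hk2 : k + 1 ≤ T ^ k := by
    calc k + 1 ≤ 2 ^ k := Nat.lt_two_pow_self
      _ ≤ _ := Nat.pow_le_pow_left hT k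
  have h8 : 8 ≤ T ^ 3 := by
    calc 8 = 2 ^ 3 := by norm_num
      _ ≤ _ := Nat.pow_le_pow_left hT 3
  refine ⟨q1 * q * (k + 1), ?_, ?_, m, ?_⟩
  · exact Nat.mul_pos (Nat.mul_pos hq11 hqmem.1) (by omega)
  · calc q1 * q * (k + 1) ≤ (8 * T') * T1 ^ c * T ^ k := by gcongr; exact hqmem.2
      _ ≤ (T ^ 3 * T') * T1 ^ c * T ^ k := by gcongr
      _ = T ^ (3 + 5 * (c + 1) + 5 * c + k) := by
          rw [hT', hT1def, ← pow_mul, ← pow_mul, ← pow_add, ← pow_add, ← pow_add]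
      _ ≤ T ^ C := Nat.pow_le_pow_right (by omega) (by rw [hC]; linarith [Nat.zero_le (c * k)])
  · have e3 : ((q1 * q * (k + 1) : ℕ) : ℝ) * P.coeff (k + 1) - m = q1 * β - m := by
      rw [hβ]; push_cast; ring
    rw [e3, pow_succ', ← mul_assoc]
    have h8r : (8 : ℝ) ≤ (T : ℝ) ^ 3 := by exact_mod_cast h8
    calc |q1 * β - m| * Y * (Y : ℝ) ^ k ≤ 8 * (T' : ℝ) ^ 2 * δ * (Y : ℝ) ^ k := by gcongr
      _ = 8 * (T' : ℝ) ^ 2 * (T1 : ℝ) ^ (c + k) := by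
          rw [hδ]; field_simp
      _ ≤ (T : ℝ) ^ 3 * (T' : ℝ) ^ 2 * (T1 : ℝ) ^ (c + k) := by gcongr
      _ = (T : ℝ) ^ (3 + 5 * (c + 1) * 2 + 5 * (c + k)) := by
          rw [hT'r, hT1pow, ← pow_mul, ← pow_add, ← pow_add]
      _ ≤ _ := pow_le_pow_right₀ hT1 (by rw [hC]; linarith [Nat.zero_le (c * k)])

lemma wtop (k : ℕ) (hk : 1 ≤ k) : ∃ c, WTop k c := by
  induction k with
  | zero => omega
  | succ k ih =>
    rcases Nat.eq_zero_or_pos k with rfl | h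
    · exact ⟨1, wtop_one⟩
    · obtain ⟨c, hc⟩ := ih h
      exact ⟨_, wtop_succ k c h hc⟩

end Weyl2
end BM

namespace BM
open Finset

section Weyl3

lemma shift_bound' (F : ℕ → ℂ) (hF : ∀ n, ‖F n‖ ≤ 1) (Y s : ℕ) :
    ‖∑ n ∈ range Y, F n - ∑ n ∈ range Y, F (n + s)‖ ≤ 2 * s := by
  have h1 := sum_range_add F s Y
  have h2 := sum_range_add F Y s
  rw [add_comm Y s, h1] at h2
  have h3 : ∑ n ∈ range Y, F n - ∑ n ∈ range Y, F (n + s) = (∑ n ∈ range s, F n - ∑ n ∈ range s, F (Y + n)) := by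
    have : ∑ n ∈ range Y, F (n + s) = ∑ n ∈ range Y, F (s + n) := by simp only [add_comm]
    rw [this]
    linear_combination -h2
  have b : ∀ G : ℕ → ℂ, (∀ n, ‖G n‖ ≤ 1) → ‖∑ n ∈ range s, G n‖ ≤ s := by
    intro G hG
    refine (norm_sum_le _ _).trans ((sum_le_sum fun n _ => hG n).trans ?_)
    simp
  rw [h3]
  have := (norm_sub_le (∑ n ∈ range s, F n) (∑ n ∈ range s, F (Y + n)))
  have := b F hF
  have := b (fun n => F (Y + n)) (fun n => hF _)
  linarith

lemma find_prog (F : ℕ → ℂ) (hF : ∀ n, ‖F n‖ ≤ 1) (Y Y' q : ℕ) (T : ℝ) (hT : 0 < T) (hY : 1 ≤ Y)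
    (hS : (Y : ℝ) ≤ T * ‖∑ n ∈ range Y, F n‖)
    (hq : 4 * T * (q * Y') ≤ Y) :
    ∃ n0 < Y, (Y' : ℝ) ≤ 2 * T * ‖∑ m ∈ range Y', F (n0 + q * m)‖ := by
  by_contra hcon
  push Not at hcon
  have hYr : (0 : ℝ) < Y := by exact_mod_cast hY
  have h1 : 2 * T * ∑ n ∈ range Y, ‖∑ m ∈ range Y', F (n + q * m)‖ < Y * Y' := by
    rw [mul_sum]
    have : ∑ n ∈ range Y, 2 * T * ‖∑ m ∈ range Y', F (n + q * m)‖ < ∑ n ∈ range Y, (Y' : ℝ) := by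
      apply sum_lt_sum_of_nonempty
      · exact ⟨0, mem_range.2 (by omega)⟩
      · intro n hn; exact hcon n (mem_range.1 hn)
    simpa using this
  have h2 : (Y' : ℝ) * ‖∑ n ∈ range Y, F n‖ ≤ ∑ n ∈ range Y, ‖∑ m ∈ range Y', F (n + q * m)‖
      + Y' * (2 * (q * Y')) := by
    have e : (Y' : ℂ) * ∑ n ∈ range Y, F n = ∑ n ∈ range Y, ∑ m ∈ range Y', F (n + q * m)
      + ∑ m ∈ range Y', (∑ n ∈ range Y, F n - ∑ n ∈ range Y, F (n + q * m)) := by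
      rw [sum_comm, ← sum_add_distrib]
      simp
    have : (Y' : ℝ) * ‖∑ n ∈ range Y, F n‖ = ‖(Y' : ℂ) * ∑ n ∈ range Y, F n‖ := by simp
    rw [this, e]
    refine (norm_add_le _ _).trans (add_le_add (norm_sum_le _ _) ?_)
    refine (norm_sum_le _ _).trans ?_
    refine (sum_le_sum (g := fun _ => (2 * (q * Y') : ℝ)) (fun m hm => ?_)).trans ?_
    · refine (shift_bound' F hF Y (q * m)).trans ?_
      have : (m : ℝ) ≤ Y' := by exact_mod_cast (mem_range.1 hm).le
      push_cast
      gcongr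
    · simp
  have h3 : (Y' : ℝ) * Y ≤ T * (Y' * ‖∑ n ∈ range Y, F n‖) := by
    have : (0 : ℝ) ≤ Y' := by positivity
    calc (Y' : ℝ) * Y ≤ Y' * (T * ‖∑ n ∈ range Y, F n‖) := by gcongr
      _ = _ := by ring
  have h4 : T * (Y' * (2 * (q * Y'))) ≤ Y' * Y / 2 := by
    have : (0 : ℝ) ≤ Y' := by positivity
    nlinarith
  have h5 := mul_le_mul_of_nonneg_left h2 hT.le
  nlinarith

def WAll (k s c : ℕ) : Prop := ∀ (T Y : ℕ) (P : Polynomial ℝ), 2 ≤ T → 1 ≤ Y → P.natDegree ≤ k →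
    (Y : ℝ) ≤ T * ‖∑ n ∈ range Y, ee (P.eval (n : ℝ))‖ →
    ∃ q : ℕ, 1 ≤ q ∧ q ≤ T ^ c ∧ ∀ j, s < j → j ≤ k →
      ∃ m : ℤ, |q * P.coeff j - m| * (Y : ℝ) ^ j ≤ (T : ℝ) ^ c

lemma pow_diff_bound (a b B : ℝ) (i : ℕ) (ha : 0 ≤ a) (hab : a ≤ b) (hb : b ≤ B) :
    b ^ (i + 1) - a ^ (i + 1) ≤ (i + 1) * (b - a) * B ^ i := by
  have hb0 : 0 ≤ b := ha.trans hab
  induction i with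
  | zero => simp
  | succ i ih =>
    have e : b ^ (i + 1 + 1) - a ^ (i + 1 + 1) = b * (b ^ (i + 1) - a ^ (i + 1)) + (b - a) * a ^ (i + 1) := by
      ring
    rw [e]
    have h1 : b * (b ^ (i + 1) - a ^ (i + 1)) ≤ B * ((i + 1) * (b - a) * B ^ i) := by
      apply mul_le_mul hb ih _ (by linarith)
      have := pow_le_pow_left₀ ha hab (i + 1)
      linarith
    have h2 : (b - a) * a ^ (i + 1) ≤ (b - a) * B ^ (i + 1) := by
      have : 0 ≤ b - a := by linarith
      have := pow_le_pow_left₀ ha (hab.trans hb) (i + 1)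
      gcongr
    have h3 : B * ((i + 1) * (b - a) * B ^ i) = (i + 1) * (b - a) * B ^ (i + 1) := by ring
    have h4 : ((i : ℝ) + 1 + 1) * (b - a) * B ^ (i + 1) = (i + 1) * (b - a) * B ^ (i + 1) + (b - a) * B ^ (i + 1) := by ring
    push_cast
    linarith

lemma term_const (α : ℝ) (i q n0 m Y Y' : ℕ) (E : ℝ) (hi : 1 ≤ i) (hq : 1 ≤ q) (hY : 1 ≤ Y) (a : ℤ)
    (hE : |q * α - a| * (Y : ℝ) ^ i ≤ E) (hn0 : n0 < Y) (hm : m < Y') (hqY : q * Y' ≤ Y) :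
    ∃ z : ℤ, |α * ((n0 + q * m : ℕ) : ℝ) ^ i - α * (n0 : ℝ) ^ i - z| * Y ≤ i * 2 ^ i * E * Y' := by
  have hd : (q : ℤ) ∣ ((n0 + q * m : ℕ) : ℤ) ^ i - (n0 : ℤ) ^ i := by
    refine dvd_trans ?_ (sub_dvd_pow_sub_pow _ _ i)
    exact ⟨m, by push_cast; ring⟩
  obtain ⟨w, hw⟩ := hd
  refine ⟨a * w, ?_⟩
  have hwr : ((n0 + q * m : ℕ) : ℝ) ^ i - (n0 : ℝ) ^ i = q * w := by exact_mod_cast hw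
  have e : α * ((n0 + q * m : ℕ) : ℝ) ^ i - α * (n0 : ℝ) ^ i - ((a * w : ℤ) : ℝ) = (q * α - a) * w := by
    push_cast at hwr ⊢; linear_combination α * hwr
  rw [e, abs_mul]
  have hqr : (1 : ℝ) ≤ q := by exact_mod_cast hq
  have hYr : (0 : ℝ) < Y := by exact_mod_cast hY
  obtain ⟨j, rfl⟩ : ∃ j, i = j + 1 := ⟨i - 1, by omega⟩
  have hb := pow_diff_bound (n0 : ℝ) ((n0 + q * m : ℕ) : ℝ) (2 * Y) j (by positivity)
    (by exact_mod_cast Nat.le_add_right _ _) (by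
      have : n0 + q * m ≤ 2 * Y := by
        have : q * m ≤ q * Y' := Nat.mul_le_mul_left _ hm.le
        omega
      exact_mod_cast this)
  rw [hwr] at hb
  have hmY : (m : ℝ) ≤ Y' := by exact_mod_cast hm.le
  have hw0 : (0 : ℝ) ≤ w := by
    have : (0 : ℝ) ≤ q * w := by
      rw [← hwr]
      have := pow_le_pow_left₀ (by positivity : (0 : ℝ) ≤ n0) (by exact_mod_cast Nat.le_add_right n0 (q * m) : (n0 : ℝ) ≤ ((n0 + q * m : ℕ) : ℝ)) (j + 1)
      linarith
    exact nonneg_of_mul_nonneg_right this (by linarith)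
  have hw1 : (w : ℝ) ≤ (j + 1) * Y' * (2 * Y) ^ j := by
    have h1 : (q : ℝ) * w ≤ q * ((j + 1) * Y' * (2 * Y) ^ j) := by
      refine hb.trans ?_
      have : ((n0 + q * m : ℕ) : ℝ) - n0 = q * m := by push_cast; ring
      rw [this]
      calc ((j : ℝ) + 1) * (q * m) * (2 * Y) ^ j ≤ ((j : ℝ) + 1) * (q * Y') * (2 * Y) ^ j := by gcongr
        _ = _ := by ring
    exact le_of_mul_le_mul_left h1 (by linarith)
  rw [abs_of_nonneg hw0]
  have hA := abs_nonneg (q * α - a)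
  calc |q * α - a| * w * Y ≤ |q * α - a| * ((j + 1) * Y' * (2 * Y) ^ j) * Y := by gcongr
    _ = (j + 1) * 2 ^ j * (|q * α - a| * (Y : ℝ) ^ (j + 1)) * Y' := by rw [mul_pow]; ring
    _ ≤ (j + 1) * 2 ^ j * E * Y' := by gcongr
    _ ≤ ((j + 1 : ℕ) : ℝ) * 2 ^ (j + 1) * E * Y' := by
      have hE0 : 0 ≤ E := le_trans (by positivity) hE
      push_cast
      gcongr <;> norm_num

end Weyl3
end BM

namespace BM
open Finset

section Weyl4

noncomputable def plow (P : Polynomial ℝ) (j : ℕ) : Polynomial ℝ :=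
  ∑ i ∈ range (j + 1), Polynomial.monomial i (P.coeff i)

lemma plow_deg (P : Polynomial ℝ) (j : ℕ) : (plow P j).natDegree ≤ j := by
  apply Polynomial.natDegree_sum_le_of_forall_le
  intro i hi
  exact (Polynomial.natDegree_monomial_le _).trans (by simp at hi; omega)

lemma plow_coeff (P : Polynomial ℝ) (j : ℕ) : (plow P j).coeff j = P.coeff j := by
  simp [plow, Polynomial.coeff_monomial]

lemma plow_eval (P : Polynomial ℝ) (j k : ℕ) (hP : P.natDegree ≤ k) (hj : j ≤ k) (x : ℝ) :
    P.eval x = (plow P j).eval x + ∑ i ∈ Ico (j + 1) (k + 1), P.coeff i * x ^ i := by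
  rw [Polynomial.eval_eq_sum_range' (Nat.lt_succ_of_le hP), plow, Polynomial.eval_finsetSum]
  simp only [Polynomial.eval_monomial]
  rw [← Finset.sum_range_add_sum_Ico (fun i => P.coeff i * x ^ i) (by omega : j + 1 ≤ k + 1)]

lemma low_large (k j0 c : ℕ) (hj : j0 ≤ k) (T Y q : ℕ) (P : Polynomial ℝ) (hT : 2 ≤ T)
    (hP : P.natDegree ≤ k) (hS : (Y : ℝ) ≤ T * ‖∑ n ∈ range Y, ee (P.eval (n : ℝ))‖)
    (hq1 : 1 ≤ q) (hqT : q ≤ T ^ c)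
    (hq : ∀ j, j0 < j → j ≤ k → ∃ m : ℤ, |q * P.coeff j - m| * (Y : ℝ) ^ j ≤ (T : ℝ) ^ c)
    (Y' : ℕ) (hY' : 1 ≤ Y') (hYY : Y' * T ^ (c + 3 * k + 6) ≤ Y) :
    ∃ n0 : ℕ, (Y' : ℝ) ≤ (T : ℝ) ^ 3 * ‖∑ m ∈ range Y', ee ((plow P j0).eval ((n0 + q * m : ℕ) : ℝ))‖ := by
  have hTr : (2 : ℝ) ≤ T := by exact_mod_cast hT
  have hT1 : (1 : ℝ) ≤ T := by linarith
  have hY'r : (1 : ℝ) ≤ Y' := by exact_mod_cast hY'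
  have hTpos : ∀ n, 1 ≤ T ^ n := fun n => Nat.one_le_pow _ _ (by omega)
  have hY : 1 ≤ Y := le_trans (Nat.mul_le_mul hY' (hTpos _)) hYY
  have hYr : (0 : ℝ) < Y := by exact_mod_cast hY
  have hYYr : (Y' : ℝ) * (T : ℝ) ^ (c + 3 * k + 6) ≤ Y := by exact_mod_cast hYY
  have hqr : (q : ℝ) ≤ (T : ℝ) ^ c := by exact_mod_cast hqT
  have hqY : 4 * (T : ℝ) * (q * Y') ≤ Y := by
    refine le_trans ?_ hYYr
    calc 4 * (T : ℝ) * (q * Y') ≤ (T : ℝ) ^ 2 * T * ((T : ℝ) ^ c * Y') := by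
          gcongr; nlinarith
      _ = Y' * (T : ℝ) ^ (c + 3) := by ring
      _ ≤ Y' * (T : ℝ) ^ (c + 3 * k + 6) := by gcongr <;> omega
  obtain ⟨n0, hn0, hN⟩ := find_prog (fun n => ee (P.eval (n : ℝ))) (fun n => (ee_norm _).le) Y Y' q T
    (by linarith) hY hS hqY
  refine ⟨n0, ?_⟩
  have hqYn : q * Y' ≤ Y := by
    have : ((q * Y' : ℕ) : ℝ) ≤ Y := by
      push_cast
      have : 0 ≤ (q : ℝ) * Y' := by positivity
      nlinarith
    exact_mod_cast this
  have key : ∀ m < Y', ‖ee (P.eval ((n0 + q * m : ℕ) : ℝ)) -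
      ee (∑ i ∈ Ico (j0 + 1) (k + 1), P.coeff i * (n0 : ℝ) ^ i) * ee ((plow P j0).eval ((n0 + q * m : ℕ) : ℝ))‖ ≤ 1 / (4 * T) := by
    intro m hm
    have h1 : ∀ i, ∃ z : ℤ, i ∈ Ico (j0 + 1) (k + 1) →
        |P.coeff i * ((n0 + q * m : ℕ) : ℝ) ^ i - P.coeff i * (n0 : ℝ) ^ i - z| * Y ≤ i * 2 ^ i * (T : ℝ) ^ c * Y' := by
      intro i
      by_cases hi : i ∈ Ico (j0 + 1) (k + 1)
      · rw [mem_Ico] at hi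
        obtain ⟨a, ha⟩ := hq i (by omega) (by omega)
        obtain ⟨z, hz⟩ := term_const (P.coeff i) i q n0 m Y Y' _ (by omega) hq1 hY a ha hn0 hm hqYn
        exact ⟨z, fun _ => hz⟩
      · exact ⟨0, fun h => absurd h hi⟩
    choose z hz using h1
    have e1 : ee (P.eval ((n0 + q * m : ℕ) : ℝ)) = ee ((plow P j0).eval ((n0 + q * m : ℕ) : ℝ) + (∑ i ∈ Ico (j0 + 1) (k + 1), (P.coeff i * ((n0 + q * m : ℕ) : ℝ) ^ i - z i))) := by
      rw [plow_eval P j0 k hP hj, sum_sub_distrib, ← add_sub_assoc, ee_sub]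
      rw [← Int.cast_sum, ee_int]; simp
    rw [e1, ← ee_add]
    refine (ee_sub_le _ _).trans ?_
    have e2 : (plow P j0).eval ((n0 + q * m : ℕ) : ℝ) + (∑ i ∈ Ico (j0 + 1) (k + 1), (P.coeff i * ((n0 + q * m : ℕ) : ℝ) ^ i - z i)) - (∑ i ∈ Ico (j0 + 1) (k + 1), P.coeff i * (n0 : ℝ) ^ i + (plow P j0).eval ((n0 + q * m : ℕ) : ℝ)) = ∑ i ∈ Ico (j0 + 1) (k + 1), (P.coeff i * ((n0 + q * m : ℕ) : ℝ) ^ i - P.coeff i * (n0 : ℝ) ^ i - z i) := by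
      simp only [sum_sub_distrib]; ring
    rw [e2]
    set G := |∑ i ∈ Ico (j0 + 1) (k + 1), (P.coeff i * ((n0 + q * m : ℕ) : ℝ) ^ i - P.coeff i * (n0 : ℝ) ^ i - z i)| with hG
    have hGb : G * Y ≤ (T : ℝ) ^ (3 * k + c) * Y' := by
      calc G * Y ≤ (∑ i ∈ Ico (j0 + 1) (k + 1), |P.coeff i * ((n0 + q * m : ℕ) : ℝ) ^ i - P.coeff i * (n0 : ℝ) ^ i - z i|) * Y := by
            gcongr; exact abs_sum_le_sum_abs _ _
        _ = ∑ i ∈ Ico (j0 + 1) (k + 1), |P.coeff i * ((n0 + q * m : ℕ) : ℝ) ^ i - P.coeff i * (n0 : ℝ) ^ i - z i| * Y := by rw [sum_mul]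
        _ ≤ ∑ i ∈ Ico (j0 + 1) (k + 1), (T : ℝ) ^ k * (T : ℝ) ^ k * (T : ℝ) ^ c * Y' := by
            apply sum_le_sum
            intro i hi
            refine (hz i hi).trans ?_
            rw [mem_Ico] at hi
            have hik : i ≤ k := by omega
            gcongr
            · calc (i : ℝ) ≤ 2 ^ i := by exact_mod_cast Nat.lt_two_pow_self.le
                _ ≤ (T : ℝ) ^ i := by gcongr
                _ ≤ (T : ℝ) ^ k := by gcongr
            · calc (2 : ℝ) ^ i ≤ (T : ℝ) ^ i := by gcongr
                _ ≤ (T : ℝ) ^ k := by gcongr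
        _ ≤ (T : ℝ) ^ k * ((T : ℝ) ^ k * (T : ℝ) ^ k * (T : ℝ) ^ c * Y') := by
            rw [sum_const, nsmul_eq_mul]
            gcongr
            rw [Nat.card_Ico]
            calc ((k + 1 - (j0 + 1) : ℕ) : ℝ) ≤ k := by exact_mod_cast (by omega)
              _ ≤ 2 ^ k := by exact_mod_cast Nat.lt_two_pow_self.le
              _ ≤ (T : ℝ) ^ k := by gcongr
        _ = _ := by ring
    have hG0 : 0 ≤ G := abs_nonneg _
    have hGc : G * (T : ℝ) ^ 6 ≤ 1 := by
      have h2 : (G * (T : ℝ) ^ 6) * (Y' * (T : ℝ) ^ (3 * k + c)) ≤ 1 * (Y' * (T : ℝ) ^ (3 * k + c)) := by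
        calc (G * (T : ℝ) ^ 6) * (Y' * (T : ℝ) ^ (3 * k + c)) = G * (Y' * (T : ℝ) ^ (c + 3 * k + 6)) := by ring
          _ ≤ G * Y := by gcongr
          _ ≤ _ := by linarith
      exact le_of_mul_le_mul_right h2 (by positivity)
    rw [le_div_iff₀ (by positivity)]
    have hpi : Real.pi ≤ 4 := Real.pi_le_four
    have h5 : (32 : ℝ) ≤ (T : ℝ) ^ 5 := by
      calc (32 : ℝ) = 2 ^ 5 := by norm_num
        _ ≤ _ := by gcongr
    calc 2 * Real.pi * G * (4 * T) ≤ 2 * 4 * G * (4 * T) := by gcongr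
      _ = 32 * (G * T) := by ring
      _ ≤ (T : ℝ) ^ 5 * (G * T) := by gcongr
      _ = G * (T : ℝ) ^ 6 := by ring
      _ ≤ 1 := hGc
  set u := ee (∑ i ∈ Ico (j0 + 1) (k + 1), P.coeff i * (n0 : ℝ) ^ i) with hu
  have hdiff : ‖∑ m ∈ range Y', ee (P.eval ((n0 + q * m : ℕ) : ℝ))‖ ≤
      ‖∑ m ∈ range Y', ee ((plow P j0).eval ((n0 + q * m : ℕ) : ℝ))‖ + Y' * (1 / (4 * T)) := by
    have e : ∑ m ∈ range Y', ee (P.eval ((n0 + q * m : ℕ) : ℝ)) = u * ∑ m ∈ range Y', ee ((plow P j0).eval ((n0 + q * m : ℕ) : ℝ)) +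
      ∑ m ∈ range Y', (ee (P.eval ((n0 + q * m : ℕ) : ℝ)) - u * ee ((plow P j0).eval ((n0 + q * m : ℕ) : ℝ))) := by
      rw [sum_sub_distrib, mul_sum]; ring
    rw [e]
    refine (norm_add_le _ _).trans (add_le_add ?_ ?_)
    · rw [norm_mul, hu, ee_norm, one_mul]
    · refine (norm_sum_le _ _).trans ((sum_le_sum fun m hm => key m (mem_range.1 hm)).trans ?_)
      simp
  have h6 : (Y' : ℝ) ≤ 2 * T * (‖∑ m ∈ range Y', ee ((plow P j0).eval ((n0 + q * m : ℕ) : ℝ))‖ + Y' * (1 / (4 * T))) :=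
    hN.trans (by gcongr)
  have h7 : 2 * (T : ℝ) * (Y' * (1 / (4 * T))) = Y' / 2 := by field_simp; ring
  set Z := ‖∑ m ∈ range Y', ee ((plow P j0).eval ((n0 + q * m : ℕ) : ℝ))‖ with hZ
  have hZ0 : 0 ≤ Z := norm_nonneg _
  have h8 : (Y' : ℝ) ≤ 4 * T * Z := by rw [mul_add, h7] at h6; linarith
  refine h8.trans ?_
  have : 4 * (T : ℝ) ≤ (T : ℝ) ^ 3 := by nlinarith [mul_nonneg (by linarith : (0:ℝ) ≤ T) (mul_nonneg (by linarith : (0:ℝ) ≤ T - 2) (by linarith : (0:ℝ) ≤ T + 2))]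
  gcongr

lemma wall_step (k j0 c cc : ℕ) (hj1 : 1 ≤ j0) (hj : j0 ≤ k) (h1 : WAll k j0 c) (h2 : WTop j0 cc) :
    ∃ C, WAll k (j0 - 1) C := by
  set c' := c + 3 * k + 6 with hc'
  refine ⟨3 * cc + (c' + 1) * k + c + c' * k + c * k, ?_⟩
  intro T Y P hT hY hP hS
  set C := 3 * cc + (c' + 1) * k + c + c' * k + c * k with hC
  have hTr : (2 : ℝ) ≤ T := by exact_mod_cast hT
  have hT1 : (1 : ℝ) ≤ T := by linarith
  have hTpos : ∀ n, 1 ≤ T ^ n := fun n => Nat.one_le_pow _ _ (by omega)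
  have hYr : (1 : ℝ) ≤ Y := by exact_mod_cast hY
  by_cases hsm : Y < T ^ c'
  · refine ⟨1, le_refl _, hTpos _, fun j _ hjk => ⟨round (P.coeff j), ?_⟩⟩
    have hr := abs_sub_round (P.coeff j)
    have hYT : (Y : ℝ) ≤ (T : ℝ) ^ c' := by exact_mod_cast hsm.le
    calc |((1 : ℕ) : ℝ) * P.coeff j - round (P.coeff j)| * (Y : ℝ) ^ j ≤ 1 * ((T : ℝ) ^ c') ^ j := by
          gcongr
          push_cast; rw [one_mul]; linarith
      _ = (T : ℝ) ^ (c' * j) := by rw [one_mul, pow_mul]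
      _ ≤ (T : ℝ) ^ C := by
          apply pow_le_pow_right₀ hT1
          have : c' * j ≤ c' * k := Nat.mul_le_mul_left _ hjk
          omega
  push Not at hsm
  obtain ⟨q, hq1, hqT, hq⟩ := h1 T Y P hT hY hP hS
  set Y' := Y / T ^ c' with hY'
  have hY'1 : 1 ≤ Y' := (Nat.one_le_div_iff (hTpos _)).2 hsm
  have hYY : Y' * T ^ c' ≤ Y := Nat.div_mul_le_self _ _
  obtain ⟨n0, hn0⟩ := low_large k j0 c hj T Y q P hT hP hS hq1 hqT hq Y' hY'1 hYY
  set Q := (Polynomial.taylor (n0 : ℝ) (plow P j0)).comp (Polynomial.C (q : ℝ) * Polynomial.X) with hQ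
  have hQe : ∀ m : ℕ, Q.eval (m : ℝ) = (plow P j0).eval ((n0 + q * m : ℕ) : ℝ) := by
    intro m
    rw [hQ, Polynomial.eval_comp, Polynomial.taylor_eval]
    simp; ring_nf
  have hQd : Q.natDegree ≤ j0 := by
    rw [hQ]
    refine Polynomial.natDegree_comp_le.trans ?_
    rw [Polynomial.natDegree_taylor]
    have := plow_deg P j0
    have h3 : (Polynomial.C (q : ℝ) * Polynomial.X).natDegree ≤ 1 := (Polynomial.natDegree_C_mul_le _ _).trans Polynomial.natDegree_X_le
    calc _ ≤ j0 * 1 := Nat.mul_le_mul this h3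
      _ = j0 := by ring
  have hQc : Q.coeff j0 = P.coeff j0 * (q : ℝ) ^ j0 := by
    rw [hQ, Polynomial.comp_C_mul_X_coeff, taylor_coeff_top _ _ (plow_deg P j0), plow_coeff]
  obtain ⟨q1, hq11, hq1T, m1, hm1⟩ := h2 (T ^ 3) Y' Q (by
    calc 2 ≤ T := hT
      _ = T ^ 1 := by ring
      _ ≤ T ^ 3 := Nat.pow_le_pow_right (by omega) (by omega)) hY'1 hQd (by
      simp only [hQe]; push_cast at hn0 ⊢; exact hn0)
  rw [hQc] at hm1
  have hYle : (Y : ℝ) ≤ (T : ℝ) ^ (c' + 1) * Y' := by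
    have : Y < T ^ c' * (Y' + 1) := by
      rw [hY']; exact Nat.lt_mul_div_succ Y (hTpos _)
    have h4 : T ^ c' * (Y' + 1) ≤ T ^ (c' + 1) * Y' := by
      rw [pow_succ T c', mul_assoc]
      apply Nat.mul_le_mul_left
      nlinarith
    exact_mod_cast (this.le.trans h4)
  have hqr : (q : ℝ) ≤ (T : ℝ) ^ c := by exact_mod_cast hqT
  have hq1r : (q1 : ℝ) ≤ (T : ℝ) ^ (3 * cc) := by
    have : q1 ≤ T ^ (3 * cc) := by rw [pow_mul]; exact hq1T
    exact_mod_cast this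
  refine ⟨q1 * q ^ j0, Nat.mul_pos hq11 (Nat.pow_pos hq1), ?_, ?_⟩
  · calc q1 * q ^ j0 ≤ T ^ (3 * cc) * (T ^ c) ^ j0 := by
          apply Nat.mul_le_mul
          · rw [pow_mul]; exact hq1T
          · exact Nat.pow_le_pow_left hqT _
      _ = T ^ (3 * cc + c * j0) := by rw [← pow_mul, ← pow_add]
      _ ≤ T ^ C := by
          apply Nat.pow_le_pow_right (by omega)
          have : c * j0 ≤ c * k := Nat.mul_le_mul_left _ hj
          omega
  · intro j hj0 hjk
    rcases Nat.lt_or_ge j0 j with hlt | hge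
    · obtain ⟨m, hm⟩ := hq j hlt hjk
      refine ⟨q1 * q ^ (j0 - 1) * m, ?_⟩
      have e : ((q1 * q ^ j0 : ℕ) : ℝ) * P.coeff j - ((q1 * q ^ (j0 - 1) * m : ℤ) : ℝ) = (q1 * q ^ (j0 - 1)) * (q * P.coeff j - m) := by
        obtain ⟨i, rfl⟩ : ∃ i, j0 = i + 1 := ⟨j0 - 1, by omega⟩
        push_cast; ring
      rw [e, abs_mul, abs_of_nonneg (by positivity : (0 : ℝ) ≤ q1 * q ^ (j0 - 1))]
      calc (q1 : ℝ) * q ^ (j0 - 1) * |q * P.coeff j - m| * (Y : ℝ) ^ j = (q1 : ℝ) * q ^ (j0 - 1) * (|q * P.coeff j - m| * (Y : ℝ) ^ j) := by ring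
        _ ≤ (T : ℝ) ^ (3 * cc) * ((T : ℝ) ^ c) ^ (j0 - 1) * (T : ℝ) ^ c := by gcongr
        _ = (T : ℝ) ^ (3 * cc + c * (j0 - 1) + c) := by rw [← pow_mul, ← pow_add, ← pow_add]
        _ ≤ (T : ℝ) ^ C := by
          apply pow_le_pow_right₀ hT1
          have : c * (j0 - 1) ≤ c * k := Nat.mul_le_mul_left _ (by omega)
          omega
    · have : j = j0 := by omega
      subst this
      refine ⟨m1, ?_⟩
      have e : ((q1 * q ^ j : ℕ) : ℝ) * P.coeff j = q1 * (P.coeff j * (q : ℝ) ^ j) := by push_cast; ring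
      rw [e]
      calc |(q1 : ℝ) * (P.coeff j * (q : ℝ) ^ j) - m1| * (Y : ℝ) ^ j
          ≤ |(q1 : ℝ) * (P.coeff j * (q : ℝ) ^ j) - m1| * ((T : ℝ) ^ (c' + 1) * Y') ^ j := by gcongr
        _ = (T : ℝ) ^ ((c' + 1) * j) * (|(q1 : ℝ) * (P.coeff j * (q : ℝ) ^ j) - m1| * (Y' : ℝ) ^ j) := by
            rw [mul_pow, ← pow_mul]; ring
        _ ≤ (T : ℝ) ^ ((c' + 1) * j) * (T : ℝ) ^ (3 * cc) := by
            gcongr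
            rw [pow_mul]; push_cast at hm1; exact hm1
        _ = (T : ℝ) ^ ((c' + 1) * j + 3 * cc) := by rw [← pow_add]
        _ ≤ _ := by
          apply pow_le_pow_right₀ hT1
          have : (c' + 1) * j ≤ (c' + 1) * k := Nat.mul_le_mul_left _ hj
          omega

lemma wall (k : ℕ) : ∃ c, WAll k 0 c := by
  have : ∀ s ≤ k, ∃ c, WAll k (k - s) c := by
    intro s
    induction s with
    | zero =>
      intro _
      refine ⟨0, fun T Y P _ _ _ _ => ⟨1, le_refl _, by simp, fun j h1 h2 => by omega⟩⟩
    | succ s ih =>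
      intro hs
      obtain ⟨c, hc⟩ := ih (by omega)
      obtain ⟨cc, hcc⟩ := wtop (k - s) (by omega)
      obtain ⟨C, hC⟩ := wall_step k (k - s) c cc (by omega) (by omega) hc hcc
      exact ⟨C, by rwa [show k - (s + 1) = k - s - 1 by omega]⟩
  simpa using this k (le_refl _)

end Weyl4
end BM

namespace BM
open Finset

lemma rat_approx (k : ℕ) (hk : 1 ≤ k) : ∃ c, 1 ≤ c ∧ ∀ (g : Polynomial ℤ) (H0 R T Y : ℕ) (θ : ℝ),
    g.natDegree = k → (∀ j, |g.coeff j| ≤ H0) → (∀ z : ℤ, (∀ j, 1 ≤ j → z ∣ g.coeff j) → z ∣ R) →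
    2 ≤ T → 4 * T ^ (2 * c) * H0 < Y →
    (Y : ℝ) ≤ T * ‖∑ n ∈ range Y, ee (θ * ((g.eval (n : ℤ) : ℤ) : ℝ))‖ →
    ∃ q q0 : ℕ, ∃ p : ℤ, 1 ≤ q ∧ q ≤ T ^ c ∧ 1 ≤ q0 ∧ q0 ∣ q * R ∧ |θ - p / q0| * (Y : ℝ) ^ k ≤ (T : ℝ) ^ c := by
  obtain ⟨c0, hc0⟩ := wall k
  refine ⟨c0 + 1, by omega, ?_⟩
  set c := c0 + 1 with hc
  intro g H0 R T Y θ hg hH hR hT hY hS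
  have hT1 : (1 : ℝ) ≤ T := by exact_mod_cast (by omega : 1 ≤ T)
  have hTpos : ∀ n, 1 ≤ T ^ n := fun n => Nat.one_le_pow _ _ (by omega)
  have hcT : (T : ℝ) ^ c0 ≤ (T : ℝ) ^ c := pow_le_pow_right₀ hT1 (by omega)
  have hY1 : 1 ≤ Y := by omega
  have hYr : (1 : ℝ) ≤ Y := by exact_mod_cast hY1
  obtain ⟨q, hq1, hqT, hq⟩ := hc0 T Y (Polynomial.C θ * g.map (Int.castRingHom ℝ)) hT hY1
    ((Polynomial.natDegree_C_mul_le _ _).trans (Polynomial.natDegree_map_le.trans hg.le)) (by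
      convert hS using 5 with n hn
      simp)
  have hqT' : q ≤ T ^ c := hqT.trans (Nat.pow_le_pow_right (by omega) (by omega))
  have hqTr : (q : ℝ) ≤ (T : ℝ) ^ c := by exact_mod_cast hqT'
  have hlead : g.coeff k ≠ 0 := by
    rw [← hg]
    have : g ≠ 0 := by rintro rfl; simp at hg; omega
    simpa using this
  have hH1 : 1 ≤ H0 := by
    have := hH k
    have h2 : 1 ≤ |g.coeff k| := Int.one_le_abs hlead
    omega
  set Z := 2 * T ^ c * H0 with hZ
  have hZ1 : 0 < Z := by have := hTpos c; positivity
  obtain ⟨x, hx, hxd⟩ := Real.exists_rat_abs_sub_le_and_den_le θ hZ1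
  have hx0 : (0 : ℝ) < x.den := by exact_mod_cast x.den_pos
  have hxr : (x : ℝ) = x.num / x.den := by exact_mod_cast (Rat.num_div_den x).symm
  have hZr : (Z : ℝ) = 2 * (T : ℝ) ^ c * H0 := by rw [hZ]; push_cast; ring
  have hZ0 : (0 : ℝ) < Z := by exact_mod_cast hZ1
  have hxden : (x.den : ℝ) * |θ - x| ≤ 1 / (Z + 1) := by
    rw [le_div_iff₀ (by positivity)] at hx
    rw [le_div_iff₀ (by positivity)]
    linarith
  have hYbig : 4 * (T : ℝ) ^ (2 * c) * H0 < Y := by exact_mod_cast hY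
  have key : ∀ j, 1 ≤ j → j ≤ k → ∃ m : ℤ, |(q : ℝ) * (θ * g.coeff j) - m| * (Y : ℝ) ^ j ≤ (T : ℝ) ^ c ∧
      (q : ℤ) * x.num * g.coeff j = m * x.den := by
    intro j hj1 hjk
    obtain ⟨m, hm⟩ := hq j hj1 hjk
    rw [Polynomial.coeff_C_mul, Polynomial.coeff_map] at hm
    simp only [eq_intCast] at hm
    refine ⟨m, hm.trans hcT, ?_⟩
    have h1 : |(q : ℝ) * (θ * g.coeff j) - m| * Y ≤ (T : ℝ) ^ c := by
      refine le_trans ?_ (hm.trans hcT)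
      gcongr
      calc (Y : ℝ) = (Y : ℝ) ^ 1 := by ring
        _ ≤ (Y : ℝ) ^ j := pow_le_pow_right₀ hYr hj1
    have hb : |(g.coeff j : ℝ)| ≤ H0 := by exact_mod_cast hH j
    have e : ((q : ℤ) * x.num * g.coeff j - m * x.den : ℤ) = (x.den : ℝ) * ((q : ℝ) * (θ * g.coeff j) - m) - (q : ℝ) * g.coeff j * (x.den * (θ - x)) := by
      rw [hxr]; push_cast; field_simp; ring
    have h2 : (x.den : ℝ) * |(q : ℝ) * (θ * g.coeff j) - m| < 1 / 2 := by
      have h3 : (x.den : ℝ) ≤ Z := by exact_mod_cast hxd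
      have h4 : (x.den : ℝ) * |(q : ℝ) * (θ * g.coeff j) - m| * Y ≤ Z * (T : ℝ) ^ c := by
        rw [mul_assoc]; gcongr
      have h5 : Z * (T : ℝ) ^ c < (1 / 2) * Y := by
        rw [hZr]
        have : (T : ℝ) ^ (2 * c) = (T : ℝ) ^ c * (T : ℝ) ^ c := by rw [← pow_add]; ring_nf
        rw [this] at hYbig; linarith
      by_contra hcon
      push Not at hcon
      nlinarith
    have h6 : |(q : ℝ) * g.coeff j * (x.den * (θ - x))| ≤ 1 / 2 := by
      rw [abs_mul, abs_mul, abs_mul, abs_of_nonneg (by positivity : (0 : ℝ) ≤ q), abs_of_nonneg hx0.le]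
      calc (q : ℝ) * |(g.coeff j : ℝ)| * (x.den * |θ - x|) ≤ (T : ℝ) ^ c * H0 * (1 / (Z + 1)) := by gcongr
        _ ≤ 1 / 2 := by
          rw [mul_one_div, div_le_iff₀ (by positivity), hZr]; linarith
    have h7 : |(((q : ℤ) * x.num * g.coeff j - m * x.den : ℤ) : ℝ)| < 1 := by
      rw [e]
      refine (abs_sub _ _).trans_lt ?_
      rw [abs_mul, abs_of_pos hx0]; linarith
    have h8 : |((q : ℤ) * x.num * g.coeff j - m * x.den : ℤ)| < 1 := by exact_mod_cast h7
    have := Int.abs_lt_one_iff.1 h8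
    linarith
  have hcop : IsCoprime (x.den : ℤ) x.num := by
    rw [Int.isCoprime_iff_gcd_eq_one, Int.gcd_comm]
    exact x.reduced
  have hdvd : ∀ j, 1 ≤ j → (x.den : ℤ) ∣ q * g.coeff j := by
    intro j hj
    by_cases hjk : j ≤ k
    · obtain ⟨m, _, hm⟩ := key j hj hjk
      apply hcop.dvd_of_dvd_mul_left
      exact ⟨m, by linear_combination hm⟩
    · rw [Polynomial.coeff_eq_zero_of_natDegree_lt (by omega)]; simp
  refine ⟨q, x.den, x.num, hq1, hqT', x.den_pos, ?_, ?_⟩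
  · set d := Nat.gcd x.den q with hd
    have hd0 : 0 < d := Nat.gcd_pos_of_pos_left _ x.den_pos
    obtain ⟨u, hu⟩ := Nat.gcd_dvd_left x.den q
    obtain ⟨w, hw⟩ := Nat.gcd_dvd_right x.den q
    rw [← hd] at hu hw
    have hcop2 : Nat.Coprime u w := by
      have := Nat.coprime_div_gcd_div_gcd (m := x.den) (n := q) (by rw [← hd]; exact hd0)
      rw [← hd] at this
      rwa [hu, hw, Nat.mul_div_cancel_left _ hd0, Nat.mul_div_cancel_left _ hd0] at this
    have hu2 : (u : ℤ) ∣ R := by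
      apply hR
      intro j hj
      have h1 := hdvd j hj
      rw [hu, hw] at h1
      push_cast at h1
      rw [mul_assoc] at h1
      have h2 := Int.dvd_of_mul_dvd_mul_left (by exact_mod_cast hd0.ne') h1
      exact (Nat.isCoprime_iff_coprime.2 hcop2).dvd_of_dvd_mul_left h2
    have hu3 : u ∣ R := by exact_mod_cast hu2
    rw [hu, hw, mul_assoc]
    exact Nat.mul_dvd_mul_left _ (hu3.mul_left _)
  · obtain ⟨m, hm, hm2⟩ := key k hk le_rfl
    rw [← hxr]
    have hmr : (q : ℝ) * x.num * g.coeff k = m * x.den := by exact_mod_cast hm2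
    have e : (q : ℝ) * (θ * g.coeff k) - m = (q * g.coeff k) * (θ - x) := by
      rw [hxr]; field_simp; linear_combination hmr
    rw [e, abs_mul] at hm
    have h1 : (1 : ℝ) ≤ |(q : ℝ) * g.coeff k| := by
      have : (1 : ℤ) ≤ |(q : ℤ) * g.coeff k| := Int.one_le_abs (mul_ne_zero (by exact_mod_cast (by omega : q ≠ 0)) hlead)
      exact_mod_cast this
    refine le_trans ?_ hm
    have : 0 ≤ |θ - x| := abs_nonneg _
    have : |θ - x| ≤ |(q : ℝ) * g.coeff k| * |θ - x| := by nlinarith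
    gcongr

end BM

namespace BM
open Finset

section Freq
variable {ι : Type*} [Fintype ι] [DecidableEq ι] {P : ι → ℕ} [∀ i, NeZero (P i)]
variable {τ : Type*} [Fintype τ] [Nonempty τ]

noncomputable def ch (a x : ∀ i, ZMod (P i)) : ℂ := ∏ i, ZMod.stdAddChar (a i * x i)

def sp (a : ∀ i, ZMod (P i)) : Finset ι := univ.filter (fun i => a i ≠ 0)

lemma kp_ch (S : Finset ι) (x y : ∀ i, ZMod (P i)) :
    ((kp S x y : ℝ) : ℂ) = ∑ a ∈ univ.filter (fun a : ∀ i, ZMod (P i) => sp a = S), ch a (x - y) := by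
  have h1 : univ.filter (fun a : ∀ i, ZMod (P i) => sp a = S)
      = Fintype.piFinset (fun i => if i ∈ S then univ.erase (0 : ZMod (P i)) else {0}) := by
    ext a
    simp only [mem_filter, mem_univ, true_and, Fintype.mem_piFinset]
    constructor
    · rintro rfl i
      by_cases h : a i = 0 <;> simp [sp, h]
    · intro h
      ext i
      have := h i
      by_cases hi : i ∈ S
      · simp [hi] at this; simp [sp, hi, this]
      · simp [hi] at this; simp [sp, hi, this]
  rw [h1]
  simp only [ch]
  rw [← prod_univ_sum (t := fun i => if i ∈ S then univ.erase (0 : ZMod (P i)) else {0})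
    (f := fun i a => (ZMod.stdAddChar (a * (x - y) i) : ℂ))]
  have h2 : ∀ i, ∑ a ∈ (if i ∈ S then univ.erase (0 : ZMod (P i)) else {0}), (ZMod.stdAddChar (a * (x - y) i) : ℂ)
      = if i ∈ S then ((e1 x y i - 1 : ℝ) : ℂ) else 1 := by
    intro i
    by_cases hi : i ∈ S
    · simp only [hi, if_true]
      have h3 := AddChar.sum_mulShift ((x - y) i) (ZMod.isPrimitive_stdAddChar (P i))
      rw [← add_sum_erase _ _ (mem_univ (0 : ZMod (P i)))] at h3
      simp only [zero_mul, AddChar.map_zero_eq_one] at h3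
      have h4 : ((e1 x y i : ℝ) : ℂ) = ((if (x - y) i = 0 then Fintype.card (ZMod (P i)) else 0 : ℕ) : ℂ) := by
        simp only [e1, Pi.sub_apply, sub_eq_zero]
        split_ifs <;> simp
      push_cast at h4 h3 ⊢
      rw [h4, ← h3]; ring
    · simp [hi]
  simp only [h2]
  rw [prod_ite_mem]
  simp [kp]

noncomputable def cf (f : τ → ℝ) (π : τ → ∀ i, ZMod (P i)) (a : ∀ i, ZMod (P i)) : ℂ :=
  (∑ t, (f t : ℂ) * (starRingEnd ℂ) (ch a (π t))) / Fintype.card τ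

lemma ch_sub (a x y : ∀ i, ZMod (P i)) : ch a (x - y) = ch a x * (starRingEnd ℂ) (ch a y) := by
  simp only [ch, map_prod, ← prod_mul_distrib]
  apply prod_congr rfl
  intro i _
  rw [Pi.sub_apply, mul_sub, sub_eq_add_neg, AddChar.map_add_eq_mul, AddChar.map_neg_eq_conj]

lemma cf_sum (f : τ → ℝ) (π : τ → ∀ i, ZMod (P i)) (S : Finset ι) :
    ∑ a ∈ univ.filter (fun a : ∀ i, ZMod (P i) => sp a = S), ‖cf f π a‖ ^ 2
      = av (fun t => f t * av (fun s => f s * kp S (π t) (π s))) := by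
  apply Complex.ofReal_injective
  have h1 : ∀ a : ∀ i, ZMod (P i), ((‖cf f π a‖ ^ 2 : ℝ) : ℂ)
      = (∑ t, ∑ s, (f t : ℂ) * f s * ch a (π t - π s)) / (Fintype.card τ * Fintype.card τ) := by
    intro a
    have : ((‖cf f π a‖ ^ 2 : ℝ) : ℂ) = (starRingEnd ℂ) (cf f π a) * cf f π a := by
      rw [Complex.conj_mul']; push_cast; rfl
    rw [this, cf, map_div₀, map_sum, div_mul_div_comm, sum_mul_sum]
    simp only [map_mul, Complex.conj_conj, Complex.conj_ofReal, map_natCast, ch_sub]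
    congr 1
    apply sum_congr rfl; intro t _
    apply sum_congr rfl; intro s _
    ring
  push_cast [av]
  simp only [kp_ch]
  have h2 : ∑ a ∈ univ.filter (fun a : ∀ i, ZMod (P i) => sp a = S), ((‖cf f π a‖ : ℂ)) ^ 2
      = ∑ a ∈ univ.filter (fun a : ∀ i, ZMod (P i) => sp a = S), (∑ t, ∑ s, (f t : ℂ) * f s * ch a (π t - π s)) / (Fintype.card τ * Fintype.card τ) := by
    apply sum_congr rfl; intro a _
    rw [← h1]; push_cast; rfl
  rw [h2, ← sum_div, sum_comm, ← div_div, sum_div]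
  congr 1
  apply sum_congr rfl; intro t _
  rw [mul_div_assoc', mul_sum, sum_comm]
  congr 1
  apply sum_congr rfl; intro s _
  rw [mul_sum, mul_sum]
  apply sum_congr rfl; intro a _
  ring

lemma WW_cf (f : τ → ℝ) (π : τ → ∀ i, ZMod (P i)) (y : ∀ i, ZMod (P i)) (d : ℕ) :
    ∑ a ∈ univ.filter (fun a : ∀ i, ZMod (P i) => (sp a).card = d), ‖cf f π a‖ ^ 2 = WW f π ∅ y d := by
  rw [WW_eq]
  simp only [gg, dl, prod_empty, mul_one, mul_sum]
  rw [av_sum]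
  have h1 : ∀ S, av (fun t => f t * av (fun s => f s * kp S (π t) (π s)))
      = ∑ a ∈ univ.filter (fun a : ∀ i, ZMod (P i) => sp a = S), ‖cf f π a‖ ^ 2 := fun S => (cf_sum f π S).symm
  simp only [h1]
  rw [← sum_biUnion]
  · apply sum_congr _ (fun _ _ => rfl)
    ext a
    simp [mem_lev]
  · intro S _ T _ hST
    rw [Function.onFun, disjoint_filter]
    rintro a _ rfl h
    exact hST h

lemma cf_sub (f f' : τ → ℝ) (α : ℝ) (π : τ → ∀ i, ZMod (P i)) (a : ∀ i, ZMod (P i)) :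
    ‖cf (fun t => f t - α * f' t) π a‖ ^ 2 ≤ 2 * ‖cf f π a‖ ^ 2 + 2 * α ^ 2 * ‖cf f' π a‖ ^ 2 := by
  have h : cf (fun t => f t - α * f' t) π a = cf f π a - α * cf f' π a := by
    simp only [cf]
    rw [← mul_div_assoc, ← sub_div, mul_sum, ← sum_sub_distrib]
    congr 1
    apply sum_congr rfl; intro t _
    push_cast; ring
  rw [h]
  have h1 := norm_sub_le (cf f π a) (α * cf f' π a)
  rw [norm_mul, Complex.norm_real, Real.norm_eq_abs] at h1
  have h2 : ‖cf f π a - α * cf f' π a‖ ^ 2 ≤ (‖cf f π a‖ + |α| * ‖cf f' π a‖) ^ 2 := by gcongr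
  have h3 := sq_abs α
  nlinarith [sq_nonneg (‖cf f π a‖ - |α| * ‖cf f' π a‖)]

end Freq
end BM

namespace BM
open Finset

section Four

lemma orth (N : ℕ) (hN : 1 ≤ N) (m : ℤ) :
    ∑ ξ ∈ range N, ee ((ξ : ℝ) / N * m) = if (N : ℤ) ∣ m then (N : ℂ) else 0 := by
  have hNr : (N : ℝ) ≠ 0 := by exact_mod_cast (by omega : N ≠ 0)
  have h1 : ∀ ξ : ℕ, ee ((ξ : ℝ) / N * m) = ee ((m : ℝ) / N) ^ ξ := by
    intro ξ
    rw [← ee_mul_nat]; congr 1; ring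
  simp only [h1]
  split_ifs with h
  · obtain ⟨w, rfl⟩ := h
    have : (((N : ℤ) * w : ℤ) : ℝ) / N = (w : ℤ) := by push_cast; field_simp
    rw [this, ee_int]; simp
  · have h2 : ee ((m : ℝ) / N) ≠ 1 := by
      intro h3
      simp only [ee] at h3
      rw [Complex.exp_eq_one_iff] at h3
      obtain ⟨w, hw⟩ := h3
      apply h
      refine ⟨w, ?_⟩
      have h4 : ((m : ℝ) / N : ℝ) = (w : ℝ) := by
        have h5 : (2 * Real.pi * Complex.I : ℂ) ≠ 0 := Complex.two_pi_I_ne_zero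
        have h6 : (2 * Real.pi * Complex.I : ℂ) * ((((m : ℝ) / N : ℝ)) : ℂ) = (2 * Real.pi * Complex.I : ℂ) * ((w : ℝ) : ℂ) := by
          push_cast at hw ⊢
          linear_combination hw
        exact_mod_cast mul_left_cancel₀ h5 h6
      rw [div_eq_iff hNr] at h4
      have : (m : ℝ) = ((N * w : ℤ) : ℝ) := by rw [h4]; push_cast; ring
      exact_mod_cast this
    have h3 := geom_sum_eq h2 N
    rw [h3]
    have : ee ((m : ℝ) / N) ^ N = 1 := by
      rw [← ee_mul_nat, mul_div_cancel₀ _ hNr, ee_int]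
    rw [this]; simp

noncomputable def ft (W : Finset ℤ) (G : ℤ → ℂ) (θ : ℝ) : ℂ := ∑ x ∈ W, G x * ee (-(θ * x))

lemma ft_corr (N : ℕ) (hN : 1 ≤ N) (W : Finset ℤ) (G : ℤ → ℂ) (s : ℤ)
    (hW : ∀ x ∈ W, ∀ y ∈ W, |y - x + s| < N) :
    ∑ ξ ∈ range N, ((‖ft W G ((ξ : ℝ) / N)‖ ^ 2 : ℝ) : ℂ) * ee ((ξ : ℝ) / N * s)
      = N * ∑ x ∈ W, ∑ y ∈ W, if x = y + s then G x * (starRingEnd ℂ) (G y) else 0 := by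
  have h1 : ∀ θ : ℝ, ((‖ft W G θ‖ ^ 2 : ℝ) : ℂ) * ee (θ * s)
      = ∑ x ∈ W, ∑ y ∈ W, G x * (starRingEnd ℂ) (G y) * ee (θ * ((y - x + s : ℤ) : ℝ)) := by
    intro θ
    have : ((‖ft W G θ‖ ^ 2 : ℝ) : ℂ) = ft W G θ * (starRingEnd ℂ) (ft W G θ) := by
      rw [Complex.mul_conj']; push_cast; rfl
    rw [this, ft, map_sum, sum_mul_sum, sum_mul]
    apply sum_congr rfl; intro x _
    rw [sum_mul]
    apply sum_congr rfl; intro y _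
    rw [map_mul, ← ee_neg]
    have : θ * ((y - x + s : ℤ) : ℝ) = -(θ * x) + - -(θ * y) + θ * s := by push_cast; ring
    rw [this, ee_add, ee_add]; ring
  simp only [h1]
  rw [sum_comm, mul_sum]
  apply sum_congr rfl; intro x hx
  rw [sum_comm, mul_sum]
  apply sum_congr rfl; intro y hy
  rw [← mul_sum, orth N hN]
  have h2 : ((N : ℤ) ∣ y - x + s) ↔ x = y + s := by
    constructor
    · intro h
      have := Int.eq_zero_of_abs_lt_dvd h (hW x hx y hy)
      omega
    · rintro rfl; simp
  simp only [h2]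
  split_ifs <;> simp [mul_comm]

lemma parseval (N : ℕ) (hN : 1 ≤ N) (W : Finset ℤ) (G : ℤ → ℂ)
    (hW : ∀ x ∈ W, ∀ y ∈ W, |y - x| < N) :
    ∑ ξ ∈ range N, ‖ft W G ((ξ : ℝ) / N)‖ ^ 2 = N * ∑ x ∈ W, ‖G x‖ ^ 2 := by
  have h := ft_corr N hN W G 0 (by simpa using hW)
  apply Complex.ofReal_injective
  push_cast
  simp only [Int.cast_zero, mul_zero, ee_zero, mul_one, add_zero] at h
  push_cast at h
  rw [h]
  congr 1
  apply sum_congr rfl; intro x hx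
  rw [sum_ite_eq, if_pos hx, Complex.mul_conj']

lemma shift_sum {β : Type*} [AddCommMonoid β] (N m s : ℕ) (hs : s ≤ m) (H : ℤ → β)
    (hH : ∀ x, x ∉ Ico (0 : ℤ) N → H x = 0) :
    ∑ x ∈ Ico (-(m : ℤ)) N, H (x + s) = ∑ x ∈ Ico (0 : ℤ) N, H x := by
  have h1 : ∑ x ∈ Ico (0 : ℤ) N, H x = ∑ x ∈ (Ico (-(m : ℤ)) N).map (addRightEmbedding (s : ℤ)), H x := by
    apply sum_subset
    · intro x hx
      rw [mem_Ico] at hx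
      simp only [mem_map, mem_Ico, addRightEmbedding_apply]
      exact ⟨x - s, by omega, by omega⟩
    · intro x _ hx; exact hH x hx
  rw [h1, sum_map]
  rfl

lemma ft_conv (N n M : ℕ) (F : ℤ → ℂ) (hF : ∀ x, x ∉ Ico (0 : ℤ) N → F x = 0) (u : Fin n → ℂ) (θ : ℝ) :
    ft (Ico (-((M * n : ℕ) : ℤ)) N) (fun x => ∑ t : Fin n, F (x + (M * t : ℕ)) * u t) θ
      = ft (Ico 0 N) F θ * ∑ t : Fin n, u t * ee (θ * M * t) := by
  simp only [ft]
  rw [mul_sum]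
  simp only [sum_mul]
  rw [sum_comm]
  apply sum_congr rfl; intro t _
  rw [← shift_sum N (M * n) (M * t) (Nat.mul_le_mul_left _ t.2.le) (fun x => F x * ee (-(θ * x)) * (u t * ee (θ * M * t)))
    (fun x hx => by simp [hF x hx])]
  apply sum_congr rfl; intro x _
  have : ee (-(θ * (((x + (M * t : ℕ) : ℤ)) : ℝ))) * ee (θ * M * t) = ee (-(θ * x)) := by
    rw [← ee_add]; congr 1; push_cast; ring
  rw [← this]; ring

end Four
end BM

namespace BM
open Finset

section Low

noncomputable def fA (A : Finset ℤ) (x : ℤ) : ℝ := if x ∈ A then 1 else 0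

lemma fA_bd (A : Finset ℤ) (x : ℤ) : 0 ≤ fA A x ∧ fA A x ≤ 1 := by
  unfold fA; split_ifs <;> norm_num

lemma fA_sum (A W : Finset ℤ) : ∑ x ∈ W, fA A x = ((W.filter (· ∈ A)).card : ℝ) := by
  rw [card_filter]; push_cast; rfl

lemma fA_sum_sub (A W : Finset ℤ) (h : A ⊆ W) : ∑ x ∈ W, fA A x = (A.card : ℝ) := by
  rw [fA_sum]; congr 2; ext x; simp; exact fun hx => h hx

noncomputable def bF (A : Finset ℤ) (N : ℕ) (α : ℝ) (x : ℤ) : ℝ := fA A x - α * fA (Ico 0 (N : ℤ)) x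

lemma shift_int (N : ℕ) (s : ℤ) : (((Ico (0 : ℤ) N).filter (fun x => x + s ∉ Ico (0 : ℤ) N)).card : ℝ) ≤ |(s : ℝ)| := by
  have h : (Ico (0 : ℤ) N).filter (fun x => x + s ∉ Ico (0 : ℤ) N) ⊆ (if 0 ≤ s then Ico (N - s : ℤ) N else Ico 0 (-s)) := by
    intro x hx
    simp only [mem_filter, mem_Ico, not_and, not_lt] at hx
    split_ifs with h0
    · simp only [mem_Ico]; omega
    · simp only [mem_Ico]; omega
  have h2 : (((Ico (0 : ℤ) N).filter (fun x => x + s ∉ Ico (0 : ℤ) N)).card : ℤ) ≤ |s| := by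
    have := card_le_card h
    split_ifs at this with h0
    · rw [Int.card_Ico] at this; rw [abs_of_nonneg h0]; omega
    · rw [Int.card_Ico] at this; rw [abs_of_neg (by omega)]; omega
  exact_mod_cast h2

lemma corr_upper (N : ℕ) (A : Finset ℤ) (hA : A ⊆ Ico 0 (N : ℤ)) (α : ℝ) (hα : 0 ≤ α) (hcard : (A.card : ℝ) = α * N)
    (s : ℤ) (hs : 64 * |(s : ℝ)| ≤ α * N) :
    ∑ y ∈ Ico (0 : ℤ) N, bF A N α y * bF A N α (y + s) ≤
      ∑ y ∈ Ico (0 : ℤ) N, fA A y * fA A (y + s) - (31 / 32) * (α ^ 2 * N) := by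
  set I := Ico (0 : ℤ) N with hI
  have e : ∑ y ∈ I, bF A N α y * bF A N α (y + s) = ∑ y ∈ I, fA A y * fA A (y + s)
      - α * ∑ y ∈ I, fA A y * fA I (y + s) - α * ∑ y ∈ I, fA I y * fA A (y + s)
      + α ^ 2 * ∑ y ∈ I, fA I y * fA I (y + s) := by
    rw [mul_sum, mul_sum, mul_sum, ← sum_sub_distrib, ← sum_sub_distrib, ← sum_add_distrib]
    apply sum_congr rfl; intro y _
    simp only [bF]; ring
  have h1 : (A.card : ℝ) - |(s : ℝ)| ≤ ∑ y ∈ I, fA A y * fA I (y + s) := by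
    have h2 := shift_int N s
    have h3 : ∑ y ∈ I, fA A y ≤ ∑ y ∈ I, fA A y * fA I (y + s) + ∑ y ∈ I, fA (I.filter (fun x => x + s ∉ I)) y := by
      rw [← sum_add_distrib]
      apply sum_le_sum
      intro y hy
      by_cases h : y + s ∈ I
      · simp [fA, h]
      · have := fA_bd A y
        simp only [fA, h, mem_filter, hy]; split_ifs <;> simp_all
    rw [fA_sum_sub A I hA, fA_sum_sub _ _ (filter_subset _ _)] at h3
    linarith
  have h2 : (A.card : ℝ) - |(s : ℝ)| ≤ ∑ y ∈ I, fA I y * fA A (y + s) := by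
    have h2 := shift_int N (-s)
    have h4 : ∑ y ∈ I, fA I y * fA A (y + s) = (((I.filter (fun y => y + s ∈ A)).card : ℕ) : ℝ) := by
      rw [card_filter]; push_cast
      apply sum_congr rfl; intro y hy; simp [fA, hy]
    have h5 : (A.filter (fun x => x + -s ∈ I)).card ≤ (I.filter (fun y => y + s ∈ A)).card := by
      apply card_le_card_of_injOn (fun x => x + -s)
      · intro x hx
        simp only [coe_filter, Set.mem_ofPred_eq] at hx ⊢
        exact ⟨hx.2, by simpa using hx.1⟩
      · intro x _ y _ hxy; simpa using hxy
    have h6 : A.card ≤ (A.filter (fun x => x + -s ∈ I)).card + (I.filter (fun x => x + -s ∉ I)).card := by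
      rw [← card_filter_add_card_filter_not (s := A) (fun x => x + -s ∈ I)]
      gcongr
    rw [h4]
    have h7 : ((A.filter (fun x => x + -s ∈ I)).card : ℝ) ≤ (I.filter (fun y => y + s ∈ A)).card := by exact_mod_cast h5
    have h8 : (A.card : ℝ) ≤ (A.filter (fun x => x + -s ∈ I)).card + (I.filter (fun x => x + -s ∉ I)).card := by exact_mod_cast h6
    have h9 : |((-s : ℤ) : ℝ)| = |(s : ℝ)| := by push_cast; rw [abs_neg]
    rw [h9] at h2
    linarith
  have h3 : ∑ y ∈ I, fA I y * fA I (y + s) ≤ N := by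
    calc ∑ y ∈ I, fA I y * fA I (y + s) ≤ ∑ y ∈ I, (1 : ℝ) := by
          apply sum_le_sum; intro y _
          have := fA_bd I y; have := fA_bd I (y + s); nlinarith
      _ = N := by simp [hI]
  rw [e]
  have g1 := mul_le_mul_of_nonneg_left h1 hα
  have g2 := mul_le_mul_of_nonneg_left h2 hα
  have g3 := mul_le_mul_of_nonneg_left h3 (sq_nonneg α)
  have g4 := mul_le_mul_of_nonneg_left hs hα
  rw [hcard] at g1 g2
  nlinarith

lemma bF_zero (N : ℕ) (A : Finset ℤ) (hA : A ⊆ Ico 0 (N : ℤ)) (α : ℝ) (x : ℤ) (hx : x ∉ Ico (0 : ℤ) N) :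
    bF A N α x = 0 := by
  have : x ∉ A := fun h => hx (hA h)
  simp only [bF, fA, if_neg hx, if_neg this]; ring

lemma bF_sq (N : ℕ) (A : Finset ℤ) (hA : A ⊆ Ico 0 (N : ℤ)) (α : ℝ) (hcard : (A.card : ℝ) = α * N) :
    ∑ x ∈ Ico (0 : ℤ) N, bF A N α x ^ 2 ≤ α * N := by
  have h1 : ∑ x ∈ Ico (0 : ℤ) N, bF A N α x ^ 2 = ∑ x ∈ Ico (0 : ℤ) N, ((1 - 2 * α) * fA A x + α ^ 2) := by
    apply sum_congr rfl; intro x hx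
    simp only [bF, fA, if_pos hx]
    split_ifs <;> ring
  rw [h1, sum_add_distrib, ← mul_sum, fA_sum_sub A _ hA, hcard]
  simp
  have : (0 : ℝ) ≤ α ^ 2 * N := by positivity
  nlinarith

lemma level0 (N n M : ℕ) (A : Finset ℤ) (hA : A ⊆ Ico 0 (N : ℤ)) (α : ℝ) (hα : 0 < α) (hα1 : α ≤ 1)
    (hcard : (A.card : ℝ) = α * N) (hn : 1 ≤ n) (hMn : 1000 * ((M : ℝ) * n) ≤ α ^ 2 * N)
    (hNI : ∀ x : ℤ, ∑ t : Fin n, fA A (x + (M * t : ℕ)) ≤ (1 + 1 / 1000) * α * n) :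
    ∑ x ∈ Ico (-((M * n : ℕ) : ℤ)) N, ((∑ t : Fin n, bF A N α (x + (M * t : ℕ))) / n) ^ 2 ≤ α ^ 2 * N / 100 := by
  have hnr : (0 : ℝ) < n := by exact_mod_cast hn
  set m := M * n with hm
  have hmr : (m : ℝ) = M * n := by rw [hm]; push_cast; ring
  set W := Ico (-(m : ℤ)) N with hW
  set I := Ico (0 : ℤ) N with hI
  set δ : ℤ → ℝ := fun x => (∑ t : Fin n, fA A (x + (M * t : ℕ))) / n with hδ
  have hδ0 : ∀ x, 0 ≤ δ x := fun x => div_nonneg (sum_nonneg fun t _ => (fA_bd A _).1) hnr.le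
  have hδ1 : ∀ x, δ x ≤ 1 := fun x => by
    rw [hδ]; simp only; rw [div_le_one hnr]
    calc ∑ t : Fin n, fA A (x + (M * t : ℕ)) ≤ ∑ t : Fin n, (1 : ℝ) := sum_le_sum fun t _ => (fA_bd A _).2
      _ = n := by simp
  have hδ2 : ∀ x, δ x ≤ (1 + 1 / 1000) * α := fun x => by
    rw [hδ]; simp only; rw [div_le_iff₀ hnr]; exact hNI x
  set ic : ℤ → ℝ := fun x => (∑ t : Fin n, fA I (x + (M * t : ℕ))) / n with hic
  have hic0 : ∀ x, 0 ≤ ic x := fun x => div_nonneg (sum_nonneg fun t _ => (fA_bd I _).1) hnr.le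
  have hic1 : ∀ x, ic x ≤ 1 := fun x => by
    rw [hic]; simp only; rw [div_le_one hnr]
    calc ∑ t : Fin n, fA I (x + (M * t : ℕ)) ≤ ∑ t : Fin n, (1 : ℝ) := sum_le_sum fun t _ => (fA_bd I _).2
      _ = n := by simp
  have hc : ∀ x, (∑ t : Fin n, bF A N α (x + (M * t : ℕ))) / n = δ x - α * ic x := by
    intro x
    simp only [hδ, hic, bF, sum_sub_distrib, ← mul_sum]
    field_simp
    rfl
  have hsum : ∑ x ∈ W, δ x = α * N := by
    simp only [hδ]
    rw [← sum_div, sum_comm]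
    have : ∀ t : Fin n, ∑ x ∈ W, fA A (x + (M * t : ℕ)) = α * N := by
      intro t
      rw [hW, shift_sum N m (M * t) (Nat.mul_le_mul_left _ t.2.le) (fA A) (fun x hx => by
        simp only [fA]; rw [if_neg (fun h => hx (hA h))]), fA_sum_sub A _ hA, hcard]
    simp only [this]
    simp; field_simp
  set J := Ico (0 : ℤ) (N - m) with hJ
  have hJW : J ⊆ W := by
    intro x hx; rw [hJ, mem_Ico] at hx; rw [hW, mem_Ico]; omega
  have hmN : (m : ℝ) ≤ N := by
    rw [hmr]
    have h3 : α ^ 2 ≤ 1 := by nlinarith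
    have h4 : α ^ 2 * N ≤ 1 * N := mul_le_mul_of_nonneg_right h3 (Nat.cast_nonneg N)
    have h5 : (0 : ℝ) ≤ (M : ℝ) * n := by positivity
    linarith
  have hmN' : m ≤ N := by exact_mod_cast hmN
  have hcd : ((W \ J).card : ℝ) = 2 * m := by
    rw [card_sdiff_of_subset hJW, hW, hJ, Int.card_Ico, Int.card_Ico]
    have : ((N : ℤ) - -(m : ℤ)).toNat - ((N : ℤ) - m - 0).toNat = 2 * m := by omega
    rw [this]; push_cast; ring
  have hJc : (J.card : ℝ) ≤ N := by
    have : J.card ≤ N := by rw [hJ, Int.card_Ico]; omega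
    exact_mod_cast this
  have hicJ : ∀ x ∈ J, ic x = 1 := by
    intro x hx
    rw [hJ, mem_Ico] at hx
    have : ∀ t : Fin n, fA I (x + (M * t : ℕ)) = 1 := by
      intro t
      have h1 : M * t.1 ≤ m := Nat.mul_le_mul_left _ t.2.le
      simp only [fA]; rw [if_pos]
      rw [hI, mem_Ico]
      have : ((M * t.1 : ℕ) : ℤ) ≤ m := by exact_mod_cast h1
      omega
    simp only [hic, this]; simp [hnr.ne']
  simp only [hc]
  rw [← sum_sdiff hJW]
  have h1 : ∑ x ∈ W \ J, (δ x - α * ic x) ^ 2 ≤ 2 * m := by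
    rw [← hcd]
    calc ∑ x ∈ W \ J, (δ x - α * ic x) ^ 2 ≤ ∑ x ∈ W \ J, (1 : ℝ) := by
          apply sum_le_sum; intro x _
          have a1 := hδ0 x; have a2 := hδ1 x
          have a3 : 0 ≤ α * ic x := mul_nonneg hα.le (hic0 x)
          have a4 : α * ic x ≤ 1 := by nlinarith [hic0 x, hic1 x]
          rw [sq_le_one_iff_abs_le_one, abs_le]; constructor <;> linarith
      _ = _ := by simp
  have hsJ : α * N - 2 * m ≤ ∑ x ∈ J, δ x := by
    rw [← hsum, ← sum_sdiff hJW, ← hcd]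
    have : ∑ x ∈ W \ J, δ x ≤ ((W \ J).card : ℝ) := by
      calc ∑ x ∈ W \ J, δ x ≤ ∑ x ∈ W \ J, (1 : ℝ) := sum_le_sum fun x _ => hδ1 x
        _ = _ := by simp
    linarith
  have h2 : ∑ x ∈ J, (δ x - α * ic x) ^ 2 ≤ ∑ x ∈ J, (-((1 - 1 / 1000) * α) * δ x + α ^ 2) := by
    apply sum_le_sum; intro x hx
    rw [hicJ x hx]
    nlinarith [mul_le_mul_of_nonneg_left (hδ2 x) (hδ0 x)]
  rw [sum_add_distrib, ← mul_sum, sum_const, nsmul_eq_mul] at h2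
  have h3 : (J.card : ℝ) * α ^ 2 ≤ N * α ^ 2 := by gcongr
  have h4 := mul_le_mul_of_nonneg_left hsJ (by positivity : 0 ≤ (1 - 1 / 1000) * α)
  have h5 : α * (m : ℝ) ≤ m := by nlinarith [(Nat.cast_nonneg m : (0 : ℝ) ≤ m)]
  nlinarith

end Low
end BM

namespace BM
open Finset

section Step
variable {ι : Type*} [Fintype ι] [DecidableEq ι] {P : ι → ℕ} [∀ i, NeZero (P i)]

def pin (P : ι → ℕ) (n : ℕ) (t : Fin n) (i : ι) : ZMod (P i) := (t.1 : ZMod (P i))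

noncomputable def phs (a : ∀ i, ZMod (P i)) : ℝ := ∑ i, ((a i).val : ℝ) / P i

lemma ch_pin (n : ℕ) (a : ∀ i, ZMod (P i)) (t : Fin n) : ch a (pin P n t) = ee (t.1 * phs a) := by
  have h1 : ∀ s : Finset ι, ∏ i ∈ s, (ZMod.stdAddChar (a i * pin P n t i) : ℂ) = ee (t.1 * ∑ i ∈ s, ((a i).val : ℝ) / P i) := by
    intro s
    induction s using Finset.induction_on with
    | empty => simp [ee_zero]
    | insert j s hj ih =>
      rw [prod_insert hj, sum_insert hj, mul_add, ee_add, ih]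
      congr 1
      have h2 : a j * pin P n t j = (((a j).val * t.1 : ℤ) : ZMod (P j)) := by
        push_cast; rw [ZMod.natCast_zmod_val]; rfl
      rw [h2, ZMod.stdAddChar_coe, ee]
      congr 1
      push_cast; ring
  exact h1 univ

lemma kap_big (n M : ℕ) (hn : 1 ≤ n) (a : ∀ i, ZMod (P i)) (θ : ℝ) (z : ℤ)
    (hz : |M * θ - phs a - z| * n ≤ 1 / 16) :
    (n : ℝ) / 2 ≤ ‖∑ t : Fin n, (starRingEnd ℂ) (ch a (pin P n t)) * ee (θ * M * t)‖ := by
  set β := M * θ - phs a - z with hβ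
  have h1 : ∀ t : Fin n, (starRingEnd ℂ) (ch a (pin P n t)) * ee (θ * M * t) = ee (t.1 * β) := by
    intro t
    rw [ch_pin, ← ee_neg, ← ee_add]
    have : -(t.1 * phs a) + θ * M * t.1 = t.1 * β + ((t.1 * z : ℤ) : ℝ) := by rw [hβ]; push_cast; ring
    rw [this, ee_add, ee_int, mul_one]
  simp only [h1]
  have h2 : ‖∑ t : Fin n, (1 - ee (t.1 * β))‖ ≤ n / 2 := by
    refine (norm_sum_le _ _).trans ?_
    calc ∑ t : Fin n, ‖1 - ee (t.1 * β)‖ ≤ ∑ t : Fin n, (1 / 2 : ℝ) := by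
          apply sum_le_sum; intro t _
          rw [norm_sub_rev]
          refine (ee_sub_one_le _).trans ?_
          rw [abs_mul, abs_of_nonneg (by positivity : (0 : ℝ) ≤ (t.1 : ℝ))]
          have h3 : (t.1 : ℝ) ≤ n := by exact_mod_cast t.2.le
          have h4 : (t.1 : ℝ) * |β| ≤ 1 / 16 := by
            have := abs_nonneg β
            calc (t.1 : ℝ) * |β| ≤ n * |β| := by gcongr
              _ ≤ 1 / 16 := by linarith
          have := Real.pi_le_four
          have h5 : 0 ≤ (t.1 : ℝ) * |β| := by positivity
          calc 2 * Real.pi * (t.1 * |β|) ≤ 2 * 4 * (1 / 16) := by gcongr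
            _ = 1 / 2 := by norm_num
      _ = n / 2 := by simp; ring
  have h3 : ((n : ℂ)) = ∑ t : Fin n, (1 - ee (t.1 * β)) + ∑ t : Fin n, ee (t.1 * β) := by
    rw [← sum_add_distrib]; simp
  have h4 : ‖(n : ℂ)‖ = n := by simp
  rw [h3] at h4
  have h5 := norm_add_le (∑ t : Fin n, (1 - ee (t.1 * β))) (∑ t : Fin n, ee (t.1 * β))
  linarith

lemma geo_small (K Q : ℝ) (hK : 0 ≤ K) (hQ : 2 ^ 15 * K ≤ Q) (hQ0 : 0 < Q) (D : ℕ) :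
    ∑ d ∈ range D, K ^ (d + 1) / Q ^ (d + 1) ≤ 1 / 2 ^ 14 := by
  have h1 : ∀ d : ℕ, K ^ (d + 1) / Q ^ (d + 1) ≤ (1 / 2 ^ 15) * (1 / 2) ^ d := by
    intro d
    rw [← div_pow, pow_succ]
    have h2 : K / Q ≤ 1 / 2 ^ 15 := by rw [div_le_div_iff₀ hQ0 (by norm_num)]; linarith
    have h3 : 0 ≤ K / Q := by positivity
    calc (K / Q) ^ d * (K / Q) ≤ (1 / 2) ^ d * (1 / 2 ^ 15) := by
          exact mul_le_mul (pow_le_pow_left₀ h3 (h2.trans (by norm_num)) d) h2 h3 (by positivity)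
      _ = _ := by ring
  refine (sum_le_sum fun d _ => h1 d).trans ?_
  rw [← mul_sum]
  have := sum_geometric_two_le D
  calc (1 / 2 ^ 15 : ℝ) * ∑ i ∈ range D, (1 / 2 : ℝ) ^ i ≤ 1 / 2 ^ 15 * 2 := by gcongr
    _ = _ := by norm_num

theorem no_step (N n M Y k1 D : ℕ) (A : Finset ℤ) (hA : A ⊆ Ico 0 (N : ℤ)) (α K Q : ℝ) (hα : 0 < α) (hα1 : α ≤ 1)
    (hcard : (A.card : ℝ) = α * N) (hN : 1 ≤ N) (hn : 1 ≤ n) (hY : 1 ≤ Y)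
    (hMn : 1000 * ((M : ℝ) * n) ≤ α ^ 2 * N)
    (hNI : ∀ x : ℤ, ∑ t : Fin n, fA A (x + (M * t : ℕ)) ≤ (1 + 1 / 1000) * α * n)
    (g : ℕ → ℤ) (hg : ∀ m < Y, 64 * |(g m : ℝ)| ≤ α * N)
    (Zs : Finset ℕ) (hZs : Zs.card ≤ k1) (hno : ∀ m < Y, m ∉ Zs → ∀ x ∈ A, x + g m ∉ A)
    (hYk : 32 * (k1 : ℝ) ≤ α * Y)
    (hK : 0 ≤ K) (hQ : 2 ^ 15 * K ≤ Q) (hQ0 : 1 ≤ Q)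
    (hmaj : ∀ θ : ℝ, ‖∑ m ∈ range Y, ee (θ * (g m : ℝ))‖ ≤ α / 16 * Y ∨
      ∃ a : ∀ i, ZMod (P i), (sp a).card ≤ D ∧
        ‖∑ m ∈ range Y, ee (θ * (g m : ℝ))‖ ≤ 2 * Y / Q ^ (sp a).card ∧
        ∃ z : ℤ, |M * θ - phs a - z| * n ≤ 1 / 16)
    (hlev : ∀ (x : ℤ) (d : ℕ), 1 ≤ d → d ≤ D →
      ∑ a ∈ univ.filter (fun a : ∀ i, ZMod (P i) => (sp a).card = d),
        ‖cf (fun t : Fin n => bF A N α (x + (M * t : ℕ))) (pin P n) a‖ ^ 2 ≤ 16 * K ^ d * α ^ 2) : False := by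
  have hnr : (0 : ℝ) < n := by exact_mod_cast hn
  have hNr : (0 : ℝ) < N := by exact_mod_cast hN
  have hYr : (0 : ℝ) < Y := by exact_mod_cast hY
  set I := Ico (0 : ℤ) N with hI
  set F := bF A N α with hF
  have hF0 : ∀ x, x ∉ I → F x = 0 := fun x hx => bF_zero N A hA α x hx
  set S : ℝ → ℂ := fun θ => ∑ m ∈ range Y, ee (θ * (g m : ℝ)) with hS
  set N4 := 4 * N with hN4
  have hN41 : 1 ≤ N4 := by omega
  set E : ℕ → ℝ := fun ξ => ‖ft I (fun x => (F x : ℂ)) ((ξ : ℝ) / N4)‖ ^ 2 with hE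
  have hE0 : ∀ ξ, 0 ≤ E ξ := fun ξ => by simp only [hE]; positivity
  have hcorr : ∑ m ∈ range Y, ∑ y ∈ I, F y * F (y + g m) ≤ -(30 / 32) * (Y * (α ^ 2 * N)) := by
    have h1 : ∀ m ∈ range Y, ∑ y ∈ I, F y * F (y + g m) ≤ (if m ∈ Zs then α * N else 0) - (31 / 32) * (α ^ 2 * N) := by
      intro m hm
      rw [mem_range] at hm
      refine (corr_upper N A hA α hα.le hcard (g m) (hg m hm)).trans ?_
      gcongr
      split_ifs with h
      · calc ∑ y ∈ Ico (0 : ℤ) N, fA A y * fA A (y + g m) ≤ ∑ y ∈ Ico (0 : ℤ) N, fA A y := by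
              apply sum_le_sum; intro y _
              have := fA_bd A y; have := fA_bd A (y + g m); nlinarith
          _ = α * N := by rw [fA_sum_sub A _ hA, hcard]
      · apply le_of_eq
        apply sum_eq_zero
        intro y _
        by_cases hy : y ∈ A
        · have := hno m hm h y hy
          simp [fA, this]
        · simp [fA, hy]
    refine (sum_le_sum h1).trans ?_
    rw [sum_sub_distrib, ← sum_filter, sum_const, sum_const, card_range, nsmul_eq_mul, nsmul_eq_mul]
    have h2 : (((range Y).filter (· ∈ Zs)).card : ℝ) ≤ k1 := by
      have : ((range Y).filter (· ∈ Zs)).card ≤ k1 := (card_le_card (fun x hx => (mem_filter.1 hx).2)).trans hZs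
      exact_mod_cast this
    have h3 : (((range Y).filter (· ∈ Zs)).card : ℝ) * (α * N) ≤ (α * Y / 32) * (α * N) := by
      gcongr; linarith
    nlinarith
  have hfour : ∑ ξ ∈ range N4, (E ξ : ℂ) * S ((ξ : ℝ) / N4) = ((N4 * ∑ m ∈ range Y, ∑ y ∈ I, F y * F (y + g m) : ℝ) : ℂ) := by
    have h1 : ∀ m ∈ range Y, ∑ ξ ∈ range N4, (E ξ : ℂ) * ee ((ξ : ℝ) / N4 * (g m : ℝ)) = ((N4 * ∑ y ∈ I, F y * F (y + g m) : ℝ) : ℂ) := by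
      intro m hm
      have h2 := ft_corr N4 hN41 I (fun x => (F x : ℂ)) (g m) (by
        intro x hx y hy
        rw [hI, mem_Ico] at hx hy
        have h3 : |(g m : ℝ)| ≤ N := by
          have := hg m (mem_range.1 hm)
          have : α * N ≤ 1 * N := by gcongr
          have := abs_nonneg (g m : ℝ)
          linarith
        have h4 : |g m| ≤ N := by exact_mod_cast h3
        rw [abs_le] at h4
        rw [abs_lt, hN4]; push_cast; constructor <;> omega)
      simp only [hE]
      rw [h2]
      push_cast
      congr 1
      rw [sum_comm]
      apply sum_congr rfl; intro y _
      rw [sum_ite_eq']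
      split_ifs with h
      · rw [Complex.conj_ofReal]; ring
      · rw [hF0 _ h]; simp
    simp only [hS, mul_sum]
    rw [sum_comm, sum_congr rfl h1]
    push_cast
    apply sum_congr rfl; intro m _
    rw [mul_sum]
  have hlow : (N4 : ℝ) * ((30 / 32) * (Y * (α ^ 2 * N))) ≤ ∑ ξ ∈ range N4, E ξ * ‖S ((ξ : ℝ) / N4)‖ := by
    have h1 : ‖∑ ξ ∈ range N4, (E ξ : ℂ) * S ((ξ : ℝ) / N4)‖ ≤ ∑ ξ ∈ range N4, E ξ * ‖S ((ξ : ℝ) / N4)‖ := by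
      refine (norm_sum_le _ _).trans (le_of_eq ?_)
      apply sum_congr rfl; intro ξ _
      rw [norm_mul, Complex.norm_real, Real.norm_of_nonneg (hE0 ξ)]
    rw [hfour, Complex.norm_real, Real.norm_eq_abs, abs_mul, Nat.abs_cast] at h1
    refine le_trans ?_ h1
    gcongr
    rw [le_abs]; right; linarith
  set κ : (∀ i, ZMod (P i)) → ℝ → ℝ := fun a θ =>
    ‖∑ t : Fin n, (starRingEnd ℂ) (ch a (pin P n t)) * ee (θ * M * t)‖ with hκ
  set 𝒜 := univ.filter (fun a : ∀ i, ZMod (P i) => (sp a).card ≤ D) with h𝒜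
  have hpt : ∀ θ : ℝ, ‖S θ‖ ≤ α / 16 * Y + ∑ a ∈ 𝒜, 8 * Y / n ^ 2 * (1 / Q ^ (sp a).card * κ a θ ^ 2) := by
    intro θ
    have hnn : ∀ a ∈ 𝒜, 0 ≤ 8 * (Y : ℝ) / n ^ 2 * (1 / Q ^ (sp a).card * κ a θ ^ 2) := by
      intro a _
      have : 0 < Q := by linarith
      positivity
    rcases hmaj θ with h | ⟨a, ha, hb, z, hz⟩
    · have := sum_nonneg hnn
      linarith
    · have h1 := single_le_sum hnn (mem_filter.2 ⟨mem_univ a, ha⟩)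
      have h2 := kap_big n M hn a θ z hz
      have h3 : (n : ℝ) ^ 2 / 4 ≤ κ a θ ^ 2 := by
        calc (n : ℝ) ^ 2 / 4 = (n / 2) ^ 2 := by ring
          _ ≤ κ a θ ^ 2 := by gcongr
      have hQp : 0 < Q := by linarith
      have h4 : 2 * Y / Q ^ (sp a).card ≤ 8 * (Y : ℝ) / n ^ 2 * (1 / Q ^ (sp a).card * κ a θ ^ 2) := by
        calc 2 * Y / Q ^ (sp a).card = 8 * (Y : ℝ) / n ^ 2 * (1 / Q ^ (sp a).card * (n ^ 2 / 4)) := by field_simp; norm_num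
          _ ≤ _ := by gcongr
      have : 0 ≤ α / 16 * Y := by positivity
      simp only [hS]
      linarith
  set W := Ico (-((M * n : ℕ) : ℤ)) N with hW
  have hMN : M * n ≤ N := by
    have h3 : α ^ 2 ≤ 1 := by nlinarith
    have h4 : α ^ 2 * N ≤ 1 * N := mul_le_mul_of_nonneg_right h3 hNr.le
    have h5 : (0 : ℝ) ≤ (M : ℝ) * n := by positivity
    have : ((M * n : ℕ) : ℝ) ≤ N := by push_cast; linarith
    exact_mod_cast this
  set c : ℤ → (∀ i, ZMod (P i)) → ℝ := fun x a => ‖cf (fun t : Fin n => F (x + (M * t : ℕ))) (pin P n) a‖ ^ 2 with hc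
  have hpars : ∀ a, ∑ ξ ∈ range N4, E ξ * κ a ((ξ : ℝ) / N4) ^ 2 = N4 * (n ^ 2 * ∑ x ∈ W, c x a) := by
    intro a
    have h1 := parseval N4 hN41 W (fun x => ∑ t : Fin n, (F (x + (M * t : ℕ)) : ℂ) * (starRingEnd ℂ) (ch a (pin P n t))) (by
      intro x hx y hy
      rw [hW, mem_Ico] at hx hy
      rw [abs_lt, hN4]; push_cast at hx hy ⊢
      have : (M : ℤ) * n ≤ N := by exact_mod_cast hMN
      constructor <;> omega)
    have h2 := fun θ => ft_conv N n M (fun x => (F x : ℂ)) (fun x hx => by simp [hF0 x hx]) (fun t => (starRingEnd ℂ) (ch a (pin P n t))) θ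
    rw [mul_sum (s := W)]
    have h3 : ∀ x, (n : ℝ) ^ 2 * c x a = ‖∑ t : Fin n, (F (x + (M * t : ℕ)) : ℂ) * (starRingEnd ℂ) (ch a (pin P n t))‖ ^ 2 := by
      intro x
      simp only [hc, cf, norm_div, Fintype.card_fin]
      rw [div_pow]
      simp
      field_simp
    simp only [h3]
    rw [← h1]
    apply sum_congr rfl; intro ξ _
    rw [h2, norm_mul, mul_pow]
  have hpars0 : ∑ ξ ∈ range N4, E ξ ≤ N4 * (α * N) := by
    have h1 := parseval N4 hN41 I (fun x => (F x : ℂ)) (by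
      intro x hx y hy
      rw [hI, mem_Ico] at hx hy
      rw [abs_lt, hN4]; push_cast; constructor <;> omega)
    simp only [hE]
    rw [h1]
    gcongr
    have h2 := bF_sq N A hA α hcard
    simpa [Complex.norm_real] using h2
  have hup : ∑ ξ ∈ range N4, E ξ * ‖S ((ξ : ℝ) / N4)‖ ≤ N4 * (Y * (α ^ 2 * N / 16)) +
      N4 * (8 * Y * ∑ x ∈ W, ∑ a ∈ 𝒜, 1 / Q ^ (sp a).card * c x a) := by
    calc ∑ ξ ∈ range N4, E ξ * ‖S ((ξ : ℝ) / N4)‖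
        ≤ ∑ ξ ∈ range N4, (E ξ * (α / 16 * Y) + ∑ a ∈ 𝒜, 8 * Y / n ^ 2 * (1 / Q ^ (sp a).card * (E ξ * κ a ((ξ : ℝ) / N4) ^ 2))) := by
          apply sum_le_sum; intro ξ _
          refine (mul_le_mul_of_nonneg_left (hpt _) (hE0 ξ)).trans (le_of_eq ?_)
          rw [mul_add, mul_sum]
          congr 1
          apply sum_congr rfl; intro a _; ring
      _ = (∑ ξ ∈ range N4, E ξ) * (α / 16 * Y) + ∑ a ∈ 𝒜, 8 * Y / n ^ 2 * (1 / Q ^ (sp a).card * (N4 * (n ^ 2 * ∑ x ∈ W, c x a))) := by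
          rw [sum_add_distrib, ← sum_mul, sum_comm]
          congr 1
          apply sum_congr rfl; intro a _
          rw [← mul_sum, ← mul_sum, hpars]
      _ ≤ N4 * (α * N) * (α / 16 * Y) + N4 * (8 * Y * ∑ x ∈ W, ∑ a ∈ 𝒜, 1 / Q ^ (sp a).card * c x a) := by
          gcongr
          apply le_of_eq
          rw [sum_comm, mul_sum, mul_sum]
          apply sum_congr rfl; intro a _
          rw [← mul_sum]
          field_simp
      _ = _ := by ring
  have hN4r : (0 : ℝ) < N4 := by exact_mod_cast hN41
  have hmain : (30 / 32) * (α ^ 2 * N) ≤ α ^ 2 * N / 16 + 8 * ∑ x ∈ W, ∑ a ∈ 𝒜, 1 / Q ^ (sp a).card * c x a := by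
    have h1 : (N4 * (Y : ℝ)) * ((30 / 32) * (α ^ 2 * N)) ≤ (N4 * (Y : ℝ)) * (α ^ 2 * N / 16 + 8 * ∑ x ∈ W, ∑ a ∈ 𝒜, 1 / Q ^ (sp a).card * c x a) := by
      have := hlow.trans hup
      linarith
    exact le_of_mul_le_mul_left h1 (by positivity)
  have hx : ∀ x ∈ W, ∑ a ∈ 𝒜, 1 / Q ^ (sp a).card * c x a ≤ ((∑ t : Fin n, F (x + (M * t : ℕ))) / n) ^ 2 + α ^ 2 / 2 ^ 10 := by
    intro x _
    have h1 : ∑ a ∈ 𝒜, 1 / Q ^ (sp a).card * c x a = ∑ d ∈ range (D + 1), ∑ a ∈ univ.filter (fun a : ∀ i, ZMod (P i) => (sp a).card = d), 1 / Q ^ d * c x a := by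
      rw [← sum_fiberwise_of_maps_to (s := 𝒜) (t := range (D + 1)) (g := fun a => (sp a).card)
        (fun a ha => by rw [mem_range]; have := (mem_filter.1 ha).2; omega)]
      apply sum_congr rfl; intro d hd
      have : 𝒜.filter (fun a => (sp a).card = d) = univ.filter (fun a : ∀ i, ZMod (P i) => (sp a).card = d) := by
        ext a; simp only [h𝒜, mem_filter, mem_univ, true_and]
        rw [mem_range] at hd; constructor
        · exact fun h => h.2
        · intro h; exact ⟨by omega, h⟩
      rw [this]
      apply sum_congr rfl; intro a ha
      rw [(mem_filter.1 ha).2]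
    rw [h1, sum_range_succ', add_comm]
    apply add_le_add
    · have h2 : univ.filter (fun a : ∀ i, ZMod (P i) => (sp a).card = 0) = {0} := by
        ext a
        simp only [mem_filter, mem_univ, true_and, card_eq_zero, mem_singleton, sp, filter_eq_empty_iff]
        constructor
        · intro h; funext i; simpa using h (x := i)
        · rintro rfl i; simp
      rw [h2, sum_singleton]
      apply le_of_eq
      have h3 : ∀ y, ch (0 : ∀ i, ZMod (P i)) y = 1 := by intro y; simp [ch]
      simp only [hc, cf, h3, map_one, mul_one, Fintype.card_fin, pow_zero, div_one, one_mul]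
      rw [← Complex.ofReal_sum, ← Complex.ofReal_natCast, ← Complex.ofReal_div, Complex.norm_real, Real.norm_eq_abs, sq_abs]
    · calc ∑ d ∈ range D, ∑ a ∈ univ.filter (fun a : ∀ i, ZMod (P i) => (sp a).card = d + 1), 1 / Q ^ (d + 1) * c x a
          ≤ ∑ d ∈ range D, 16 * α ^ 2 * (K ^ (d + 1) / Q ^ (d + 1)) := by
            apply sum_le_sum; intro d hd
            rw [mem_range] at hd
            rw [← mul_sum]
            have h2 := hlev x (d + 1) (by omega) (by omega)
            have : 0 < Q := by linarith
            calc 1 / Q ^ (d + 1) * ∑ a ∈ univ.filter (fun a : ∀ i, ZMod (P i) => (sp a).card = d + 1), c x a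
                ≤ 1 / Q ^ (d + 1) * (16 * K ^ (d + 1) * α ^ 2) := by gcongr
              _ = _ := by ring
        _ ≤ 16 * α ^ 2 * (1 / 2 ^ 14) := by
            rw [← mul_sum]
            gcongr
            exact geo_small K Q hK hQ (by linarith) D
        _ = α ^ 2 / 2 ^ 10 := by norm_num; ring
  have hl0 := level0 N n M A hA α hα hα1 hcard hn hMn hNI
  have hfin := (sum_le_sum hx)
  rw [sum_add_distrib, sum_const, nsmul_eq_mul] at hfin
  have hWc : (W.card : ℝ) ≤ 2 * N := by
    have : W.card ≤ 2 * N := by rw [hW, Int.card_Ico]; omega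
    exact_mod_cast this
  have h9 : (W.card : ℝ) * (α ^ 2 / 2 ^ 10) ≤ 2 * N * (α ^ 2 / 2 ^ 10) := by gcongr
  have h10 : 0 < α ^ 2 * N := by positivity
  have h11 : ∑ x ∈ W, ((∑ t : Fin n, F (x + (M * t : ℕ))) / n) ^ 2 ≤ α ^ 2 * N / 100 := hl0
  have h12 : 2 * (N : ℝ) * (α ^ 2 / 2 ^ 10) = α ^ 2 * N / 2 ^ 9 := by ring
  rw [h12] at h9
  norm_num at h9
  linarith

end Step
end BM

namespace BM
open Finset

lemma ap_sum (n q y : ℕ) (hy : y < q) (F : ℕ → ℝ) :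
    ∃ l : ℕ, n ≤ q * l + q ∧ q * l ≤ n + q ∧
      ∑ t : Fin n, (if t.1 % q = y then F t.1 else 0) = ∑ s ∈ range l, F (y + q * s) := by
  have hq : 0 < q := by omega
  refine ⟨(n + q - 1 - y) / q, ?_, ?_, ?_⟩
  · have := Nat.lt_mul_div_succ (n + q - 1 - y) hq
    rw [mul_add] at this; omega
  · have := Nat.mul_div_le (n + q - 1 - y) q
    omega
  · rw [Fin.sum_univ_eq_sum_range (fun t => if t % q = y then F t else 0) n, ← sum_filter]
    symm
    apply sum_bij (fun s _ => y + q * s)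
    · intro s hs
      simp only [mem_range] at hs
      rw [Nat.lt_div_iff_mul_lt hq, mul_comm] at hs
      simp only [mem_filter, mem_range, Nat.add_mul_mod_self_left, Nat.mod_eq_of_lt hy, and_true]
      omega
    · intro a _ b _ hab
      have : q * a = q * b := by omega
      exact Nat.eq_of_mul_eq_mul_left hq this
    · intro t ht
      simp only [mem_filter, mem_range] at ht
      have h1 := Nat.mod_add_div t q
      refine ⟨t / q, ?_, by rw [← ht.2]; exact h1⟩
      simp only [mem_range]
      rw [Nat.lt_div_iff_mul_lt hq, mul_comm]
      rw [ht.2] at h1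
      omega
    · intros; rfl

section Lev
variable {ι : Type*} [Fintype ι] [DecidableEq ι] {P : ι → ℕ} [∀ i, NeZero (P i)]

lemma crt_ex (hcop : ∀ i j, i ≠ j → Nat.Coprime (P i) (P j)) (V : Finset ι) (y : ∀ i, ZMod (P i)) :
    ∃ y0 < ∏ i ∈ V, P i, ∀ t : ℕ, (∀ i ∈ V, y i = (t : ZMod (P i))) ↔ t % (∏ i ∈ V, P i) = y0 := by
  have hs : ∀ i ∈ V, P i ≠ 0 := fun i _ => NeZero.ne _
  have pp : Set.Pairwise (V : Set ι) (Function.onFun Nat.Coprime P) := fun i _ j _ hij => hcop i j hij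
  obtain ⟨y0, hy0⟩ := Nat.chineseRemainderOfFinset (fun i => (y i).val) P V hs pp
  have hpos : 0 < ∏ i ∈ V, P i := prod_pos fun i hi => Nat.pos_of_ne_zero (hs i hi)
  refine ⟨y0 % (∏ i ∈ V, P i), Nat.mod_lt _ hpos, fun t => ?_⟩
  have h1 : t % (∏ i ∈ V, P i) = y0 % (∏ i ∈ V, P i) ↔ ∀ i ∈ V, t ≡ y0 [MOD P i] := by
    constructor
    · intro h i hi
      exact Nat.ModEq.of_dvd (dvd_prod_of_mem P hi) h
    · intro h
      change t ≡ y0 [MOD _]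
      rw [Nat.modEq_iff_dvd]
      push_cast
      apply Finset.prod_dvd_of_coprime
      · intro i hi j hj hij
        exact Nat.isCoprime_iff_coprime.2 (hcop i j hij)
      · intro i hi
        exact (Nat.modEq_iff_dvd.1 (h i hi))
  rw [h1]
  apply forall₂_congr
  intro i hi
  have h2 : y i = (y0 : ZMod (P i)) := by
    have := (ZMod.natCast_eq_natCast_iff _ _ _).2 (hy0 i hi)
    rw [this, ZMod.natCast_zmod_val]
  rw [h2, eq_comm, ZMod.natCast_eq_natCast_iff]

lemma av_dl (hcop : ∀ i j, i ≠ j → Nat.Coprime (P i) (P j)) (n : ℕ) (V : Finset ι) (y : ∀ i, ZMod (P i))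
    (F : ℕ → ℝ) : ∃ l y0 : ℕ, n ≤ (∏ i ∈ V, P i) * l + (∏ i ∈ V, P i) ∧ (∏ i ∈ V, P i) * l ≤ n + (∏ i ∈ V, P i) ∧
      av (fun t : Fin n => F t.1 * dl V y (pin P n t)) =
        ((∏ i ∈ V, P i : ℕ) : ℝ) * (∑ s ∈ range l, F (y0 + (∏ i ∈ V, P i) * s)) / n := by
  obtain ⟨y0, hy0, h⟩ := crt_ex hcop V y
  obtain ⟨l, h1, h2, h3⟩ := ap_sum n _ y0 hy0 F
  refine ⟨l, y0, h1, h2, ?_⟩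
  rw [av, ← h3, mul_sum, Fintype.card_fin]
  congr 1
  apply sum_congr rfl
  intro t _
  have h4 : dl V y (pin P n t) = if t.1 % (∏ i ∈ V, P i) = y0 then ((∏ i ∈ V, P i : ℕ) : ℝ) else 0 := by
    rw [dl]
    split_ifs with h5
    · have h6 := (h t.1).2 h5
      push_cast
      apply prod_congr rfl
      intro i hi
      rw [e1, if_pos (show y i = pin P n t i from h6 i hi), ZMod.card]
    · rw [← h t.1] at h5
      push Not at h5
      obtain ⟨i, hi, h6⟩ := h5
      apply prod_eq_zero hi
      rw [e1, if_neg (show ¬ y i = pin P n t i from h6)]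
  rw [h4]
  split_ifs <;> ring

theorem hlev_of (hcop : ∀ i j, i ≠ j → Nat.Coprime (P i) (P j)) (N n M D r I l0 Pm : ℕ) (A : Finset ℤ)
    (α K : ℝ) (hα : 0 < α) (hα1 : α ≤ 1) (hn : 1 ≤ n) (hr : 1 ≤ r) (hK : 4 ≤ K)
    (hK2 : 4 * (4 * r : ℝ) ^ (2 * r) ≤ α * K ^ r) (hPm : 1 ≤ Pm) (hP : ∀ i, P i ≤ Pm) (hI : 1 ≤ I)
    (hι : Fintype.card ι ≤ I) (hl0 : 1 ≤ l0) (hln : 2 * Pm ^ D * l0 ≤ n)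
    (hε : ((I : ℝ) ^ D * (2 * Pm ^ D)) ^ (2 * r) * Pm ^ ((2 * r + 1) * D) ≤ α ^ (2 * r) * n)
    (hNI : ∀ V : Finset ι, V.card ≤ D → ∀ x : ℤ, ∀ l ≥ l0,
      ∑ s ∈ range l, fA A (x + (M * (∏ i ∈ V, P i) * s : ℕ)) ≤ (1 + 1 / 1000) * α * l)
    (x : ℤ) (d : ℕ) (hd : d ≤ D) :
      ∑ a ∈ univ.filter (fun a : ∀ i, ZMod (P i) => (sp a).card = d),
        ‖cf (fun t : Fin n => bF A N α (x + (M * t : ℕ))) (pin P n) a‖ ^ 2 ≤ 16 * K ^ d * α ^ 2 := by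
  have : NeZero n := ⟨by omega⟩
  have hn0 : (0 : ℝ) < n := by exact_mod_cast hn
  have hPV : ∀ V : Finset ι, ∀ m, V.card ≤ m → (∏ i ∈ V, P i) ≤ Pm ^ m := fun V m hV =>
    (prod_le_pow_card V P Pm fun i _ => hP i).trans (Nat.pow_le_pow_right hPm hV)
  set ε0 : ℝ := (Pm : ℝ) ^ ((2 * r + 1) * D) / n with hε0
  have hH : ∀ U (y : ∀ i, ZMod (P i)), U.card ≤ (2 * r + 1) * D →
      |av (fun t : Fin n => dl U y (pin P n t)) - 1| ≤ ε0 := by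
    intro U y hU
    obtain ⟨l, y0, h1, h2, h3⟩ := av_dl hcop n U y (fun _ => 1)
    simp only [one_mul] at h3
    rw [h3]
    simp only [sum_const, card_range, nsmul_eq_mul, mul_one]
    have h4 := hPV U _ hU
    have h1' : (n : ℝ) ≤ (∏ i ∈ U, P i : ℕ) * l + (∏ i ∈ U, P i : ℕ) := by exact_mod_cast h1
    have h2' : ((∏ i ∈ U, P i : ℕ) : ℝ) * l ≤ n + (∏ i ∈ U, P i : ℕ) := by exact_mod_cast h2
    have h4' : ((∏ i ∈ U, P i : ℕ) : ℝ) ≤ (Pm : ℝ) ^ ((2 * r + 1) * D) := by exact_mod_cast h4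
    rw [div_sub_one hn0.ne', abs_div, abs_of_pos hn0, hε0]
    gcongr
    rw [abs_le]
    constructor <;> linarith
  have hA : ∀ V (y : ∀ i, ZMod (P i)), V.card ≤ D →
      av (fun t : Fin n => fA A (x + (M * t.1 : ℕ)) * dl V y (pin P n t)) ≤ 2 * α := by
    intro V y hV
    obtain ⟨l, y0, h1, h2, h3⟩ := av_dl hcop n V y (fun t => fA A (x + (M * t : ℕ)))
    rw [h3]
    have h4 := hPV V _ hV
    set q := ∏ i ∈ V, P i with hq
    have hq2 : 2 * q * l0 ≤ n := le_trans (by gcongr) hln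
    have hq0 : 0 < q := prod_pos fun i _ => Nat.pos_of_ne_zero (NeZero.ne _)
    have hq3 : 2 * q ≤ n := le_trans (by nlinarith) hq2
    have hl : l0 ≤ l := by
      have : q * l0 ≤ q * l := by
        have e1 : 2 * q * l0 = 2 * (q * l0) := by ring
        omega
      exact Nat.le_of_mul_le_mul_left this hq0
    have h5 := hNI V hV (x + (M * y0 : ℕ)) l hl
    have h6 : ∑ s ∈ range l, fA A (x + (M * (y0 + q * s) : ℕ)) ≤ (1 + 1 / 1000) * α * l := by
      refine le_trans (le_of_eq ?_) h5
      apply sum_congr rfl; intro s _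
      congr 1
      push_cast; rw [hq]; push_cast; ring
    rw [div_le_iff₀ hn0]
    have h2' : (q : ℝ) * l ≤ n + q := by exact_mod_cast h2
    have h7 : 2 * (q : ℝ) ≤ n := by exact_mod_cast hq3
    calc (q : ℝ) * ∑ s ∈ range l, fA A (x + (M * (y0 + q * s) : ℕ)) ≤ q * ((1 + 1 / 1000) * α * l) := by gcongr
      _ = (1 + 1 / 1000) * α * (q * l) := by ring
      _ ≤ (1 + 1 / 1000) * α * (3 / 2 * n) := mul_le_mul_of_nonneg_left (by linarith) (by positivity)
      _ ≤ 2 * α * n := by nlinarith [mul_pos hα hn0]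
  have hPm' : (1 : ℝ) ≤ Pm := by exact_mod_cast hPm
  have hI' : (1 : ℝ) ≤ I := by exact_mod_cast hI
  have hP' : ∀ i, (Fintype.card (ZMod (P i)) : ℝ) ≤ Pm := fun i => by rw [ZMod.card]; exact_mod_cast hP i
  have hε' : (((I : ℝ) ^ D * (2 * Pm ^ D)) ^ (2 * r)) * ε0 ≤ α ^ (2 * r) := by
    rw [hε0, ← mul_div_assoc, div_le_iff₀ hn0]; exact hε
  have hα2 : α ^ (2 * r) ≤ 1 := pow_le_one₀ hα.le hα1
  have hε1 : ε0 ≤ 1 := by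
    have h0 : 0 ≤ ε0 := by positivity
    have : (1 : ℝ) ≤ ((I : ℝ) ^ D * (2 * Pm ^ D)) ^ (2 * r) := by
      apply one_le_pow₀
      have := one_le_pow₀ hI' (n := D)
      have := one_le_pow₀ hPm' (n := D)
      nlinarith
    nlinarith
  set y : ∀ i, ZMod (P i) := fun _ => 0
  have key1 := level (fun t : Fin n => fA A (x + (M * t.1 : ℕ))) (pin P n) D r I hr α K ε0 Pm hα hα1 hK hK2
    (fun t => fA_bd _ _) hA hH hPm' hP' hI hι hε' d ∅ y (by simpa using hd)
  have key2 := level (fun t : Fin n => fA (Ico 0 (N : ℤ)) (x + (M * t.1 : ℕ))) (pin P n) D r I hr 1 K ε0 Pm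
    one_pos le_rfl hK (hK2.trans (by
      have : 0 ≤ K ^ r := by positivity
      nlinarith))
    (fun t => fA_bd _ _) (by
      intro V y hV
      have h1 := hH V y (hV.trans (by nlinarith))
      have h2 := (abs_le.1 h1).2
      have h3 : av (fun t : Fin n => fA (Ico 0 (N : ℤ)) (x + (M * t.1 : ℕ)) * dl V y (pin P n t))
          ≤ av (fun t : Fin n => dl V y (pin P n t)) := by
        apply av_mono
        intro t
        have h4 : 0 ≤ dl V y (pin P n t) := by
          rw [dl]; apply prod_nonneg; intro i _; rw [e1]; positivity
        nlinarith [fA_bd (Ico 0 (N : ℤ)) (x + (M * t.1 : ℕ))]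
      linarith) hH hPm' hP' hI hι (by rw [one_pow]; exact hε'.trans hα2) d ∅ y (by simpa using hd)
  rw [← WW_cf] at key1 key2
  calc _ ≤ ∑ a ∈ univ.filter (fun a : ∀ i, ZMod (P i) => (sp a).card = d),
        (2 * ‖cf (fun t : Fin n => fA A (x + (M * t.1 : ℕ))) (pin P n) a‖ ^ 2 +
          2 * α ^ 2 * ‖cf (fun t : Fin n => fA (Ico 0 (N : ℤ)) (x + (M * t.1 : ℕ))) (pin P n) a‖ ^ 2) := by
        apply sum_le_sum
        intro a _
        exact cf_sub _ _ α (pin P n) a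
    _ ≤ 2 * (4 * K ^ d * α ^ 2) + 2 * α ^ 2 * (4 * K ^ d * 1 ^ 2) := by
        rw [sum_add_distrib, ← mul_sum, ← mul_sum]
        gcongr
    _ = _ := by ring
end Lev
end BM

namespace BM
open Finset

section Maj

lemma parfrac {ι : Type*} [DecidableEq ι] {P : ι → ℕ} [∀ i, NeZero (P i)]
    (hcop : ∀ i j, i ≠ j → Nat.Coprime (P i) (P j)) (V : Finset ι) :
    ∀ b : ℤ, ∃ w : ι → ℤ, (b : ℝ) / ((∏ i ∈ V, P i : ℕ) : ℝ) - ∑ i ∈ V, (w i : ℝ) / P i ∈ Set.range ((↑) : ℤ → ℝ) := by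
  induction V using Finset.induction_on with
  | empty => intro b; exact ⟨fun _ => 0, b, by simp⟩
  | insert j V hj ih =>
    intro b
    have hc : Nat.Coprime (P j) (∏ i ∈ V, P i) :=
      Nat.Coprime.prod_right fun i hi => hcop j i (by rintro rfl; exact hj hi)
    obtain ⟨u, w, huw⟩ := Nat.isCoprime_iff_coprime.2 hc
    obtain ⟨w', z, hw'⟩ := ih (b * u)
    refine ⟨Function.update w' j (b * w), z, ?_⟩
    rw [sum_insert hj, prod_insert hj, Function.update_self]
    have h1 : ∑ i ∈ V, ((Function.update w' j (b * w) i : ℤ) : ℝ) / P i = ∑ i ∈ V, (w' i : ℝ) / P i := by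
      apply sum_congr rfl; intro i hi
      rw [Function.update_of_ne (by rintro rfl; exact hj hi)]
    rw [h1, hw']
    have h2 : (P j : ℝ) ≠ 0 := by exact_mod_cast NeZero.ne _
    have h3 : ((∏ i ∈ V, P i : ℕ) : ℝ) ≠ 0 := by
      have : (∏ i ∈ V, P i : ℕ) ≠ 0 := prod_ne_zero_iff.2 fun i _ => NeZero.ne _
      exact_mod_cast this
    have h4 : (u : ℝ) * P j + w * ((∏ i ∈ V, P i : ℕ) : ℝ) = 1 := by exact_mod_cast huw
    rw [Nat.cast_mul, Int.cast_mul, Int.cast_mul]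
    generalize ((∏ i ∈ V, P i : ℕ) : ℝ) = q at *
    have h5 : (b : ℝ) / (P j * q) = b * u / q + b * w / P j := by
      field_simp
      linear_combination (-(b : ℝ)) * h4
    rw [h5]; ring

lemma phs_of {ι : Type*} [Fintype ι] [DecidableEq ι] {P : ι → ℕ} [∀ i, NeZero (P i)]
    (hcop : ∀ i j, i ≠ j → Nat.Coprime (P i) (P j)) (V : Finset ι) (b : ℤ) :
    ∃ a : ∀ i, ZMod (P i), sp a ⊆ V ∧ ∃ z : ℤ, (b : ℝ) / ((∏ i ∈ V, P i : ℕ) : ℝ) = phs a + z := by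
  obtain ⟨w, z, hz⟩ := parfrac hcop V b
  refine ⟨fun i => if i ∈ V then (w i : ZMod (P i)) else 0, ?_, z + ∑ i ∈ V, w i / P i, ?_⟩
  · intro i hi
    by_contra h
    simp [sp, h] at hi
  · rw [phs]
    have h1 : ∀ i, (((if i ∈ V then (w i : ZMod (P i)) else 0 : ZMod (P i)).val : ℝ)) / P i
        = if i ∈ V then (w i : ℝ) / P i - ((w i / P i : ℤ) : ℝ) else 0 := by
      intro i
      split_ifs with h
      · have h2 : (P i : ℝ) ≠ 0 := by exact_mod_cast NeZero.ne _
        have h3 := ZMod.val_intCast (n := P i) (w i)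
        have h4 := Int.mul_ediv_add_emod (w i) (P i)
        rw [← h3] at h4
        have h5 : (P i : ℝ) * ((w i / P i : ℤ) : ℝ) + (((w i : ZMod (P i)).val : ℝ)) = w i := by exact_mod_cast h4
        field_simp
        linarith
      · simp
    simp only [h1]
    rw [sum_ite_mem, univ_inter, sum_sub_distrib]
    push_cast
    rw [eq_comm, sub_eq_iff_eq_add] at hz
    push_cast at hz
    rw [hz]; ring

lemma split_q0 (q0 q R Q0 J X : ℕ) (hq : 1 ≤ q) (hq0 : 1 ≤ q0) (hR : 1 ≤ R) (hRQ : R ≤ Q0) (hd : q0 ∣ q * R) (hJ : q * R ≤ 2 ^ J)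
    (hX : q ≤ X) :
    ∃ F : Finset ℕ, ∃ s L : ℕ, q0 = s * L ∧ s ∣ (Q0.factorial) ^ J ∧ (∀ p ∈ F, p.Prime ∧ Q0 < p ∧ p ≤ X) ∧
      L ∣ ∏ p ∈ F, p ^ J ∧ Q0 ^ F.card ≤ q := by
  set v := q0.factorization
  have hv : ∀ p ∈ q0.primeFactors, v p ≤ J := by
    intro p hp
    have hpp := Nat.prime_of_mem_primeFactors hp
    have h1 : p ^ v p ≤ q0 := Nat.ordProj_le p (by omega)
    have h2 : q0 ≤ 2 ^ J := (Nat.le_of_dvd (by positivity) hd).trans hJ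
    have h3 : 2 ^ v p ≤ 2 ^ J := ((Nat.pow_le_pow_left hpp.two_le _).trans h1).trans h2
    exact (Nat.pow_le_pow_iff_right (by norm_num)).1 h3
  have hprod : q0 = ∏ p ∈ q0.primeFactors, p ^ v p := by
    conv_lhs => rw [← Nat.prod_factorization_pow_eq_self (show q0 ≠ 0 by omega)]
    rfl
  set F := q0.primeFactors.filter (fun p => ¬ p ≤ Q0) with hF
  have hpF : ∀ p ∈ F, p.Prime ∧ Q0 < p ∧ p ∣ q0 := by
    intro p hp
    simp only [hF, mem_filter, not_le] at hp
    exact ⟨Nat.prime_of_mem_primeFactors hp.1, hp.2, Nat.dvd_of_mem_primeFactors hp.1⟩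
  have hpq : ∀ p ∈ F, p ∣ q := by
    intro p hp
    obtain ⟨h1, h2, h3⟩ := hpF p hp
    rcases h1.dvd_mul.1 (h3.trans hd) with h | h
    · exact h
    · have := Nat.le_of_dvd (by omega) h; omega
  refine ⟨F, ∏ p ∈ q0.primeFactors.filter (fun p => p ≤ Q0), p ^ v p, ∏ p ∈ F, p ^ v p, ?_, ?_, ?_, ?_, ?_⟩
  · rw [prod_filter_mul_prod_filter_not]; exact hprod
  · have h1 : ∏ p ∈ q0.primeFactors.filter (fun p => p ≤ Q0), p ^ v p ∣
        ∏ p ∈ q0.primeFactors.filter (fun p => p ≤ Q0), p ^ J :=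
      prod_dvd_prod_of_dvd _ _ fun p hp => pow_dvd_pow _ (hv p (mem_filter.1 hp).1)
    refine h1.trans ?_
    rw [prod_pow]
    apply pow_dvd_pow_of_dvd
    apply prod_primes_dvd
    · intro p hp; exact (Nat.prime_of_mem_primeFactors (mem_filter.1 hp).1).prime
    · intro p hp
      exact Nat.dvd_factorial (Nat.prime_of_mem_primeFactors (mem_filter.1 hp).1).pos (mem_filter.1 hp).2
  · intro p hp
    obtain ⟨h1, h2, h3⟩ := hpF p hp
    exact ⟨h1, h2, (Nat.le_of_dvd (by omega) (hpq p hp)).trans hX⟩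
  · exact prod_dvd_prod_of_dvd _ _ fun p hp => pow_dvd_pow _ (hv p (mem_filter.1 hp).1)
  · have h1 : Q0 ^ F.card ≤ ∏ p ∈ F, p := pow_card_le_prod F _ Q0 fun p hp => (hpF p hp).2.1.le
    refine h1.trans (Nat.le_of_dvd (by omega) ?_)
    exact prod_primes_dvd _ (fun p hp => (hpF p hp).1.prime) hpq

abbrev prs (Q0 X : ℕ) : Finset ℕ := (Ioc Q0 X).filter Nat.Prime

theorem hmaj_of (k c : ℕ) (hc1 : 1 ≤ c) (hrat : ∀ (g : Polynomial ℤ) (H0 R T Y : ℕ) (θ : ℝ), g.natDegree = k →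
      (∀ j, |g.coeff j| ≤ H0) → (∀ z : ℤ, (∀ j, 1 ≤ j → z ∣ g.coeff j) → z ∣ R) → 2 ≤ T →
      4 * T ^ (2 * c) * H0 < Y → (Y : ℝ) ≤ T * ‖∑ n ∈ range Y, ee (θ * ((g.eval (n : ℤ) : ℤ) : ℝ))‖ →
      ∃ q q0 : ℕ, ∃ p : ℤ, 1 ≤ q ∧ q ≤ T ^ c ∧ 1 ≤ q0 ∧ q0 ∣ q * R ∧ |θ - p / q0| * (Y : ℝ) ^ k ≤ (T : ℝ) ^ c)
    (g : Polynomial ℤ) (H0 R T0 Y Q1 X J D M n : ℕ) (α : ℝ) (hα : 0 < α) (hα1 : α ≤ 1)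
    (P : prs (Q1 ^ c) X → ℕ) [∀ i, NeZero (P i)] (hcop : ∀ i j, i ≠ j → Nat.Coprime (P i) (P j))
    (hPJ : ∀ i, i.1 ^ J ∣ P i)
    (hdeg : g.natDegree = k) (hcoef : ∀ j, |g.coeff j| ≤ H0)
    (hcont : ∀ z : ℤ, (∀ j, 1 ≤ j → z ∣ g.coeff j) → z ∣ R)
    (hR : 1 ≤ R) (hRQ : R ≤ Q1 ^ c) (hQ1 : 1 ≤ Q1) (hT0 : 32 ≤ α * T0) (hX : T0 ^ c ≤ X) (hJ : T0 ^ c * R ≤ 2 ^ J)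
    (hD : T0 < Q1 ^ (D + 1)) (hM : (Q1 ^ c).factorial ^ J ∣ M) (hY : 4 * T0 ^ (2 * c) * H0 < Y)
    (hMn : 16 * (M * n * T0 ^ c) ≤ Y ^ k) (θ : ℝ) :
    ‖∑ m ∈ range Y, ee (θ * ((g.eval (m : ℤ) : ℤ) : ℝ))‖ ≤ α / 16 * Y ∨
      ∃ a : ∀ i, ZMod (P i), (sp a).card ≤ D ∧
        ‖∑ m ∈ range Y, ee (θ * ((g.eval (m : ℤ) : ℤ) : ℝ))‖ ≤ 2 * Y / (Q1 : ℝ) ^ (sp a).card ∧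
        ∃ z : ℤ, |M * θ - phs a - z| * n ≤ 1 / 16 := by
  by_cases hS : ‖∑ m ∈ range Y, ee (θ * ((g.eval (m : ℤ) : ℤ) : ℝ))‖ ≤ α / 16 * Y
  · exact Or.inl hS
  right
  push Not at hS
  have hSY : ‖∑ m ∈ range Y, ee (θ * ((g.eval (m : ℤ) : ℤ) : ℝ))‖ ≤ Y := by
    refine (norm_sum_le _ _).trans ?_
    simp [ee_norm]
  set S := ‖∑ m ∈ range Y, ee (θ * ((g.eval (m : ℤ) : ℤ) : ℝ))‖ with hSd
  have hY0 : (0 : ℝ) < Y := by exact_mod_cast (show 0 < Y by omega)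
  have hS0 : 0 < S := lt_of_le_of_lt (by positivity) hS
  have hYS : 1 ≤ Y / S := by rw [le_div_iff₀ hS0]; linarith
  obtain ⟨T, hT⟩ : ∃ T, T = max 2 ⌈(Y : ℝ) / S⌉₊ := ⟨_, rfl⟩
  have hT2 : 2 ≤ T := by omega
  have hTS : (T : ℝ) ≤ 2 * (Y / S) := by
    rw [hT]; push_cast
    apply max_le (by linarith)
    have := Nat.ceil_lt_add_one (show 0 ≤ Y / S by positivity)
    linarith
  have hYT : (Y : ℝ) ≤ T * S := by
    rw [← div_le_iff₀ hS0, hT]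
    push_cast
    exact (Nat.le_ceil _).trans (le_max_right _ _)
  have hTT : T ≤ T0 := by
    have : (T : ℝ) ≤ T0 := by
      refine hTS.trans ?_
      rw [← mul_div_assoc, div_le_iff₀ hS0]
      nlinarith
    exact_mod_cast this
  have hTc : T ^ c ≤ T0 ^ c := Nat.pow_le_pow_left hTT c
  obtain ⟨q, q0, p, hq, hqT, hq0, hdvd, herr⟩ := hrat g H0 R T Y θ hdeg hcoef hcont hT2
    (lt_of_le_of_lt (by gcongr) hY) hYT
  obtain ⟨F, s, L, hsL, hs, hF, hL, hQF⟩ := split_q0 q0 q R (Q1 ^ c) J X hq hq0 hR hRQ hdvd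
    ((Nat.mul_le_mul_right R (hqT.trans hTc)).trans hJ) ((hqT.trans hTc).trans hX)
  set V : Finset (prs (Q1 ^ c) X) := univ.filter (fun i => i.1 ∈ F) with hV
  have hFV : F = V.image Subtype.val := by
    ext x
    simp only [hV, mem_image, mem_filter, mem_univ, true_and, Subtype.exists, exists_and_left, exists_prop, exists_eq_right_right]
    constructor
    · intro hx
      obtain ⟨h1, h2, h3⟩ := hF x hx
      exact ⟨hx, by simp [h1, h2, h3]⟩
    · exact fun h => h.1
  have hinj : Set.InjOn (Subtype.val : prs (Q1 ^ c) X → ℕ) V := Subtype.val_injective.injOn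
  have hcard : F.card = V.card := by rw [hFV, card_image_of_injOn hinj]
  have hLP : L ∣ ∏ i ∈ V, P i := by
    refine hL.trans ?_
    rw [hFV, prod_image hinj]
    exact prod_dvd_prod_of_dvd _ _ fun i _ => hPJ i
  obtain ⟨L', hL'⟩ := hLP
  obtain ⟨s', hs'⟩ := hs.trans hM
  obtain ⟨a, haV, z, hz⟩ := phs_of hcop V (s' * p * L')
  have hP0 : (∏ i ∈ V, P i : ℕ) ≠ 0 := prod_ne_zero_iff.2 fun i _ => NeZero.ne _
  have hMq : (M : ℝ) * (p / q0) = phs a + z := by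
    rw [← hz, hL', hs', hsL]
    rw [hL'] at hP0
    have h1 : s ≠ 0 := by rintro rfl; simp at hsL; omega
    have h2 : (s : ℝ) ≠ 0 := by exact_mod_cast h1
    have h3 : (L : ℝ) ≠ 0 := by exact_mod_cast (left_ne_zero_of_mul hP0)
    have h4 : (L' : ℝ) ≠ 0 := by exact_mod_cast (right_ne_zero_of_mul hP0)
    push_cast
    field_simp
  have hQT : Q1 ^ F.card ≤ T := by
    have h1 : (Q1 ^ F.card) ^ c ≤ T ^ c := by rw [← pow_mul, mul_comm, pow_mul]; exact hQF.trans hqT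
    exact (Nat.pow_le_pow_iff_left (by omega)).1 h1
  have hcV : (sp a).card ≤ F.card := hcard ▸ card_le_card haV
  have hQa : Q1 ^ (sp a).card ≤ T := (Nat.pow_le_pow_right hQ1 hcV).trans hQT
  refine ⟨a, ?_, ?_, z, ?_⟩
  · have h1 : Q1 ^ (sp a).card < Q1 ^ (D + 1) := lt_of_le_of_lt (hQa.trans hTT) hD
    by_contra hcon
    push Not at hcon
    exact absurd (Nat.pow_le_pow_right hQ1 (Nat.succ_le_of_lt hcon)) (not_le.2 h1)
  · have h1 : ((Q1 : ℝ) ^ (sp a).card) ≤ 2 * (Y / S) := le_trans (by exact_mod_cast hQa) hTS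
    have h2 : 0 < (Q1 : ℝ) ^ (sp a).card := by positivity
    rw [le_div_iff₀ h2]
    rw [← mul_div_assoc, le_div_iff₀ hS0] at h1
    linarith
  · have h1 : M * θ - phs a - z = M * (θ - p / q0) := by rw [mul_sub, hMq]; ring
    rw [h1, abs_mul, abs_of_nonneg (by positivity : (0 : ℝ) ≤ M)]
    have hYk : (0 : ℝ) < (Y : ℝ) ^ k := by positivity
    have h2 : |θ - p / q0| ≤ (T0 : ℝ) ^ c / (Y : ℝ) ^ k := by
      rw [le_div_iff₀ hYk]; exact herr.trans (by exact_mod_cast hTc)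
    have h3 : 16 * ((M : ℝ) * n * (T0 : ℝ) ^ c) ≤ (Y : ℝ) ^ k := by exact_mod_cast hMn
    calc (M : ℝ) * |θ - p / q0| * n ≤ M * ((T0 : ℝ) ^ c / (Y : ℝ) ^ k) * n := by gcongr
      _ = (M * n * (T0 : ℝ) ^ c) / (Y : ℝ) ^ k := by ring
      _ ≤ 1 / 16 := by rw [div_le_iff₀ hYk]; linarith
end Maj
end BM

namespace BM
open Finset

section Aux
open Polynomial

lemma cop_ex (f w : ℤ[X]) (hf : Irreducible f) (hd : f.natDegree ≠ 0) (hw : ¬ f ∣ w) :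
    ∃ ρ : ℤ, ρ ≠ 0 ∧ ∃ a b : ℤ[X], f * a + w * b = C ρ := by
  obtain ⟨a, b, -, -, hab⟩ := exists_mul_add_mul_eq_C_resultant f w le_rfl le_rfl (Or.inl hd)
  refine ⟨_, ?_, a, b, hab⟩
  intro h0
  have hp := hf.isPrimitive hd
  have hi := (IsPrimitive.Int.irreducible_iff_irreducible_map_cast hp).1 hf
  have hnd : ¬ f.map (Int.castRingHom ℚ) ∣ w.map (Int.castRingHom ℚ) := by
    rwa [← IsPrimitive.Int.dvd_iff_map_cast_dvd_map_cast f w hp]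
  have hc : IsCoprime (f.map (Int.castRingHom ℚ)) (w.map (Int.castRingHom ℚ)) :=
    (hi.coprime_iff_not_dvd).2 hnd
  have h1 : resultant (f.map (Int.castRingHom ℚ)) (w.map (Int.castRingHom ℚ)) = 0 := by
    rw [natDegree_map_eq_of_injective Int.cast_injective, natDegree_map_eq_of_injective Int.cast_injective,
      resultant_map_map, h0, map_zero]
  rw [resultant_eq_zero_iff] at h1
  exact h1.2 hc

lemma irr_fac (h : ℤ[X]) (h0 : h ≠ 0) (f : ℤ[X]) (hf : Irreducible f) (hd : f.natDegree ≠ 0) (hfh : f ∣ h) :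
    ∃ R : ℤ, R ≠ 0 ∧ ∃ e : ℕ, 1 ≤ e ∧ e ≤ h.natDegree ∧ ∀ (p : ℕ) [Fact p.Prime] (z : ℤ_[p]),
      f.eval₂ (Int.castRingHom ℤ_[p]) z = 0 →
      ∃ H : ℤ_[p][X], taylor z (h.map (Int.castRingHom ℤ_[p])) = X ^ e * H ∧ H.coeff 0 ∣ (R : ℤ_[p]) := by
  have hfin : FiniteMultiplicity f h := by
    apply FiniteMultiplicity.of_prime_left hf.prime h0
  obtain ⟨w, hw, hnd⟩ := hfin.exists_eq_pow_mul_and_not_dvd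
  set e := multiplicity f h with he
  have he1 : 1 ≤ e := by
    rcases Nat.eq_zero_or_pos e with h1 | h1
    · rw [h1] at hw; simp at hw; rw [← hw] at hnd; exact absurd hfh hnd
    · exact h1
  have hw0 : w ≠ 0 := by rintro rfl; simp at hnd
  have hf0 : f ≠ 0 := hf.ne_zero
  have hek : e ≤ h.natDegree := by
    have h1 : h.natDegree = e * f.natDegree + w.natDegree := by
      conv_lhs => rw [hw, natDegree_mul (pow_ne_zero _ hf0) hw0, natDegree_pow]
    have : e * 1 ≤ e * f.natDegree := Nat.mul_le_mul_left _ (Nat.pos_of_ne_zero hd)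
    omega
  have hder : ¬ f ∣ derivative f := by
    intro hdv
    have h1 : derivative f ≠ 0 := fun h => hd (derivative_eq_zero.1 h)
    have h2 := natDegree_le_of_dvd hdv h1
    have h3 := natDegree_derivative_lt hd
    omega
  obtain ⟨ρ1, hρ1, a1, b1, hab1⟩ := cop_ex f _ hf hd hder
  obtain ⟨ρ2, hρ2, a2, b2, hab2⟩ := cop_ex f w hf hd hnd
  refine ⟨ρ1 ^ e * ρ2, mul_ne_zero (pow_ne_zero _ hρ1) hρ2, e, he1, hek, ?_⟩
  intro p _ z hz
  set φ := Int.castRingHom ℤ_[p] with hφ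
  have hX : X ∣ taylor z (f.map φ) := by
    rw [X_dvd_iff, taylor_coeff_zero, eval_map]; exact hz
  obtain ⟨G, hG⟩ := hX
  have hG0 : G.coeff 0 = (derivative f).eval₂ φ z := by
    have h1 : (taylor z (f.map φ)).coeff 1 = G.coeff 0 := by rw [hG, coeff_X_mul]
    rw [← h1, taylor_coeff_one, derivative_map, eval_map]
  refine ⟨G ^ e * taylor z (w.map φ), ?_, ?_⟩
  · conv_lhs => rw [hw, Polynomial.map_mul, Polynomial.map_pow, taylor_mul, taylor_pow, hG]
    ring
  · rw [mul_coeff_zero, ← constantCoeff_apply, map_pow, constantCoeff_apply, hG0, taylor_coeff_zero, eval_map]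
    push_cast
    apply mul_dvd_mul
    · apply pow_dvd_pow_of_dvd
      have := congrArg (eval₂ φ z) hab1
      rw [eval₂_add, eval₂_mul, eval₂_mul, hz, eval₂_C, zero_mul, zero_add] at this
      exact ⟨_, this.symm⟩
    · have := congrArg (eval₂ φ z) hab2
      rw [eval₂_add, eval₂_mul, eval₂_mul, hz, eval₂_C, zero_mul, zero_add] at this
      exact ⟨_, this.symm⟩

lemma loc_mult (h : ℤ[X]) (h0 : h ≠ 0) :
    ∃ R : ℕ, 1 ≤ R ∧ ∀ (p : ℕ) [Fact p.Prime] (z : ℤ_[p]),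
      h.eval₂ (Int.castRingHom ℤ_[p]) z = 0 → ∃ e : ℕ, 1 ≤ e ∧ e ≤ h.natDegree ∧
      ∃ H : ℤ_[p][X], taylor z (h.map (Int.castRingHom ℤ_[p])) = X ^ e * H ∧ H.coeff 0 ∣ (R : ℤ_[p]) := by
  classical
  have key : ∀ f : ℤ[X], ∃ R : ℤ, R ≠ 0 ∧ (Irreducible f → f.natDegree ≠ 0 → f ∣ h → ∃ e : ℕ, 1 ≤ e ∧ e ≤ h.natDegree ∧
      ∀ (p : ℕ) [Fact p.Prime] (z : ℤ_[p]), f.eval₂ (Int.castRingHom ℤ_[p]) z = 0 →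
      ∃ H : ℤ_[p][X], taylor z (h.map (Int.castRingHom ℤ_[p])) = X ^ e * H ∧ H.coeff 0 ∣ (R : ℤ_[p])) := by
    intro f
    by_cases hf : Irreducible f ∧ f.natDegree ≠ 0 ∧ f ∣ h
    · obtain ⟨R, hR, hh⟩ := irr_fac h h0 f hf.1 hf.2.1 hf.2.2
      exact ⟨R, hR, fun _ _ _ => hh⟩
    · exact ⟨1, one_ne_zero, fun h1 h2 h3 => absurd ⟨h1, h2, h3⟩ hf⟩
  choose ρ hρ0 hρ using key
  obtain ⟨s, hs, hprod⟩ := UniqueFactorizationMonoid.exists_prime_factors h h0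
  set R : ℤ := (s.map ρ).prod with hR
  have hR0 : R ≠ 0 := by
    apply Multiset.prod_ne_zero
    intro hm
    obtain ⟨f, -, hf⟩ := Multiset.mem_map.1 hm
    exact hρ0 f hf
  refine ⟨R.natAbs, Int.natAbs_pos.2 hR0, ?_⟩
  intro p _ z hz
  have h1 : (s.prod).eval₂ (Int.castRingHom ℤ_[p]) z = 0 := by
    obtain ⟨u, hu⟩ := hprod.symm
    rw [← hu, eval₂_mul, hz, zero_mul]
  rw [← coe_eval₂RingHom, map_multiset_prod, Multiset.prod_eq_zero_iff] at h1
  obtain ⟨f, hfs, hf⟩ := Multiset.mem_map.1 h1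
  rw [coe_eval₂RingHom] at hf
  have hfi := (hs f hfs).irreducible
  have hfd : f.natDegree ≠ 0 := by
    intro hd
    rw [eq_C_of_natDegree_eq_zero hd, eval₂_C] at hf
    have h2 : f.coeff 0 = 0 := by
      have : ((f.coeff 0 : ℤ) : ℤ_[p]) = 0 := by simpa using hf
      exact_mod_cast this
    apply hfi.ne_zero
    rw [eq_C_of_natDegree_eq_zero hd, h2, C_0]
  have hfh : f ∣ h := (Multiset.dvd_prod hfs).trans hprod.dvd
  obtain ⟨e, he1, he2, hH⟩ := hρ f hfi hfd hfh
  obtain ⟨H, hH1, hH2⟩ := hH p z hf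
  refine ⟨e, he1, he2, H, hH1, hH2.trans ?_⟩
  have h3 : ρ f ∣ R := Multiset.dvd_prod (Multiset.mem_map_of_mem _ hfs)
  have h4 : ρ f ∣ (R.natAbs : ℤ) := Int.dvd_natAbs.2 h3
  have := (Int.castRingHom ℤ_[p]).map_dvd h4
  simpa using this

lemma padic_root (h : ℤ[X]) (hi : ∀ q : ℕ, 0 < q → ∃ n : ℤ, (q : ℤ) ∣ h.eval n) (p : ℕ) [Fact p.Prime] :
    ∃ z : ℤ_[p], h.eval₂ (Int.castRingHom ℤ_[p]) z = 0 := by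
  have hcont : Continuous (fun z : ℤ_[p] => (h.map (Int.castRingHom ℤ_[p])).eval z) := Polynomial.continuous _
  have hcl := (isCompact_range hcont).isClosed
  have : (0 : ℤ_[p]) ∈ closure (Set.range (fun z : ℤ_[p] => (h.map (Int.castRingHom ℤ_[p])).eval z)) := by
    rw [Metric.mem_closure_iff]
    intro ε hε
    obtain ⟨j, hj⟩ := PadicInt.exists_pow_neg_lt p hε
    obtain ⟨n, hn⟩ := hi (p ^ j) (pow_pos (Fact.out : p.Prime).pos j)
    refine ⟨_, ⟨(n : ℤ_[p]), rfl⟩, ?_⟩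
    have e1 : (h.map (Int.castRingHom ℤ_[p])).eval (n : ℤ_[p]) = ((h.eval n : ℤ) : ℤ_[p]) := by
      rw [eval_map]; exact (hom_eval₂ h (RingHom.id ℤ) (Int.castRingHom ℤ_[p]) n).symm
    simp only [e1, dist_zero_left]
    refine lt_of_le_of_lt (PadicInt.norm_int_le_pow_iff_dvd.2 ?_) hj
    exact_mod_cast hn
  rw [hcl.closure_eq] at this
  obtain ⟨z, hz⟩ := this
  exact ⟨z, by rw [← eval_map]; exact hz⟩
end Aux
end BM

namespace BM
open Finset

section Aux
open Polynomial

lemma loc_D (h : ℤ[X]) (p : ℕ) [hp : Fact p.Prime] (z : ℤ_[p]) (e : ℕ) (he : 1 ≤ e) (H : ℤ_[p][X])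
    (hH : taylor z (h.map (Int.castRingHom ℤ_[p])) = X ^ e * H) (R : ℤ_[p]) (hR : H.coeff 0 ∣ R)
    (d v d' : ℕ) (hd : d = p ^ v * d') (hd' : ¬ p ∣ d') (r : ℤ) (hr : (p : ℤ_[p]) ^ v ∣ (r : ℤ_[p]) - z) :
    ∃ G : ℤ_[p][X], (h.comp (C r + C (d : ℤ) * X)).map (Int.castRingHom ℤ_[p]) = C ((p : ℤ_[p]) ^ (e * v)) * G ∧
      ∀ s, (∀ j, 1 ≤ j → (p : ℤ_[p]) ^ s ∣ G.coeff j) → (p : ℤ_[p]) ^ s ∣ R := by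
  obtain ⟨u, hu⟩ := hr
  set φ := Int.castRingHom ℤ_[p] with hφ
  set t : ℤ_[p][X] := C u + C (d' : ℤ_[p]) * X with ht
  have h1 : (h.comp (C r + C (d : ℤ) * X)).map φ = (X ^ e * H).comp (C ((p : ℤ_[p]) ^ v) * t) := by
    rw [← hH, taylor_apply, comp_assoc, map_comp]
    congr 1
    simp only [Polynomial.map_add, Polynomial.map_mul, map_C, map_X, add_comp, X_comp, C_comp, ht, hd]
    have : (r : ℤ_[p]) = (p : ℤ_[p]) ^ v * u + z := by rw [← hu]; ring
    simp only [hφ, eq_intCast, this]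
    push_cast
    simp only [C_add, C_mul, C_pow]
    ring
  have h2 : (X ^ e * H).comp (C ((p : ℤ_[p]) ^ v) * t)
      = C ((p : ℤ_[p]) ^ (e * v)) * (X ^ e * H.comp (C ((p : ℤ_[p]) ^ v) * X)).comp t := by
    simp only [mul_comp, X_comp, C_comp, comp_assoc, pow_comp]
    rw [mul_pow, ← C_pow, ← pow_mul, mul_comm v e]
    ring
  refine ⟨_, h1.trans h2, ?_⟩
  intro s hs
  set Q := X ^ e * H.comp (C ((p : ℤ_[p]) ^ v) * X) with hQ
  have hunit : IsUnit (d' : ℤ_[p]) := by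
    rw [PadicInt.isUnit_iff]
    have h3 := PadicInt.norm_le_one (d' : ℤ_[p])
    have h4 := (PadicInt.norm_int_lt_one_iff_dvd (p := p) (d' : ℤ)).not.2 (by exact_mod_cast hd')
    push_cast at h4
    exact le_antisymm h3 (not_lt.1 h4)
  obtain ⟨i, hi⟩ := hunit.exists_left_inv
  have h5 : C ((p : ℤ_[p]) ^ s) ∣ Q.comp t - C ((Q.comp t).coeff 0) := by
    rw [C_dvd_iff_dvd_coeff]
    intro j
    rcases Nat.eq_zero_or_pos j with rfl | hj
    · simp
    · rw [coeff_sub, coeff_C, if_neg (by omega), sub_zero]; exact hs j hj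
  obtain ⟨G', hG'⟩ := h5
  have h6 : t.comp (C i * (X - C u)) = X := by
    rw [ht, add_comp, mul_comp, C_comp, C_comp, X_comp, ← mul_assoc, ← C_mul, mul_comm _ i, hi]
    simp
  have h7 : Q = C ((Q.comp t).coeff 0) + C ((p : ℤ_[p]) ^ s) * G'.comp (C i * (X - C u)) := by
    have := congrArg (fun q => q.comp (C i * (X - C u))) hG'
    simp only [sub_comp, mul_comp, C_comp, comp_assoc] at this
    have h6' : t.comp (C i * (X - C u)) = X := h6
    rw [h6', comp_X] at this
    linear_combination this
  have h8 : Q.coeff e = H.coeff 0 := by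
    have := coeff_X_pow_mul (H.comp (C ((p : ℤ_[p]) ^ v) * X)) e 0
    rw [zero_add] at this
    rw [hQ, this, coeff_zero_eq_eval_zero, eval_comp, coeff_zero_eq_eval_zero]
    simp
  refine dvd_trans ?_ hR
  rw [← h8, h7, coeff_add, coeff_C, if_neg (by omega), zero_add, coeff_C_mul]
  exact dvd_mul_right _ _

lemma loc_int (h : ℤ[X]) (h0 : h ≠ 0) (hi : ∀ q : ℕ, 0 < q → ∃ n : ℤ, (q : ℤ) ∣ h.eval n) :
    ∃ R : ℕ, 1 ≤ R ∧ ∀ p : ℕ, p.Prime → ∃ e : ℕ, 1 ≤ e ∧ e ≤ h.natDegree ∧ ∃ ap : ℕ → ℕ,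
      (∀ v v', v ≤ v' → (p ^ v : ℤ) ∣ ap v' - ap v) ∧
      ∀ (d v d' : ℕ) (r : ℤ), d = p ^ v * d' → ¬ p ∣ d' → (p ^ v : ℤ) ∣ r - ap v →
        (∀ j, (p ^ (e * v) : ℤ) ∣ (h.comp (C r + C (d : ℤ) * X)).coeff j) ∧
        ∀ (g : ℤ[X]) (l : ℤ), C (p ^ (e * v) * l) * g = h.comp (C r + C (d : ℤ) * X) →
          ∀ s, (∀ j, 1 ≤ j → (p ^ s : ℤ) ∣ g.coeff j) → (p ^ s : ℤ) ∣ R := by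
  obtain ⟨R, hR, hloc⟩ := loc_mult h h0
  refine ⟨R, hR, ?_⟩
  intro p hp
  have : Fact p.Prime := ⟨hp⟩
  obtain ⟨z, hz⟩ := padic_root h hi p
  obtain ⟨e, he1, he2, H, hH, hHR⟩ := hloc p z hz
  have hap : ∀ v, (p : ℤ_[p]) ^ v ∣ z - (z.appr v : ℤ_[p]) := fun v =>
    Ideal.mem_span_singleton.1 (PadicInt.appr_spec v z)
  refine ⟨e, he1, he2, fun v => z.appr v, ?_, ?_⟩
  · intro v v' hv
    have h1 : (p : ℤ_[p]) ^ v ∣ (((z.appr v' : ℤ) - (z.appr v : ℤ) : ℤ) : ℤ_[p]) := by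
      have := dvd_sub (hap v) ((pow_dvd_pow _ hv).trans (hap v'))
      push_cast
      convert this using 1
      ring
    exact (PadicInt.pow_p_dvd_int_iff _ _).1 h1
  · intro d v d' r hd hd' hr
    have hr' : (p : ℤ_[p]) ^ v ∣ (r : ℤ_[p]) - z := by
      have h1 := (PadicInt.pow_p_dvd_int_iff (p := p) v (r - (z.appr v : ℤ))).2 (by exact_mod_cast hr)
      have := dvd_sub h1 (hap v)
      push_cast at this
      convert this using 1
      ring
    obtain ⟨G, hG, hs⟩ := loc_D h p z e he1 H hH R hHR d v d' hd hd' r hr'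
    constructor
    · intro j
      rw [← PadicInt.pow_p_dvd_int_iff]
      have := congrArg (fun q => q.coeff j) hG
      beta_reduce at this
      rw [coeff_map, coeff_C_mul] at this
      exact ⟨_, this⟩
    · intro g l hg s hgs
      have h1 : G = C (l : ℤ_[p]) * g.map (Int.castRingHom ℤ_[p]) := by
        rw [← hg, Polynomial.map_mul, map_C, map_mul, C_mul, mul_assoc] at hG
        have hne : (C ((p : ℤ_[p]) ^ (e * v)) : ℤ_[p][X]) ≠ 0 := by
          rw [Ne, C_eq_zero]; exact pow_ne_zero _ (by exact_mod_cast hp.ne_zero)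
        apply mul_left_cancel₀ hne
        rw [← hG]; simp
      have h2 := hs s (by
        intro j hj
        rw [h1, coeff_C_mul, coeff_map]
        apply Dvd.dvd.mul_left
        exact (PadicInt.pow_p_dvd_int_iff _ _).2 (hgs j hj))
      have := (PadicInt.pow_p_dvd_int_iff (p := p) s (R : ℤ)).1 (by simpa using h2)
      exact_mod_cast this

lemma coeff_bd (h : ℤ[X]) : ∃ Ch : ℕ, 1 ≤ Ch ∧ ∀ (d : ℕ) (r : ℤ), 1 ≤ d → |r| ≤ d → ∀ j,
    |(h.comp (C r + C (d : ℤ) * X)).coeff j| ≤ Ch * (d : ℤ) ^ h.natDegree := by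
  set k := h.natDegree with hk
  set B : ℤ := ∑ j ∈ range (k + 1), ∑ i ∈ range (k - j + 1), |(hasseDeriv j h).coeff i| with hB
  have hB0 : 0 ≤ B := sum_nonneg fun j _ => sum_nonneg fun i _ => abs_nonneg _
  refine ⟨B.natAbs + 1, by omega, ?_⟩
  intro d r hd hr j
  have h1 : (h.comp (C r + C (d : ℤ) * X)).coeff j = (hasseDeriv j h).eval r * (d : ℤ) ^ j := by
    have : h.comp (C r + C (d : ℤ) * X) = (taylor r h).comp (C (d : ℤ) * X) := by
      rw [taylor_apply, comp_assoc]; simp [add_comm]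
    rw [this, comp_C_mul_X_coeff, taylor_coeff]
  rw [h1, abs_mul, abs_of_nonneg (by positivity : (0 : ℤ) ≤ (d : ℤ) ^ j)]
  have hd0 : (0 : ℤ) ≤ d := by positivity
  by_cases hj : k < j
  · rw [hasseDeriv_eq_zero_of_lt_natDegree _ _ hj]; simp
  push Not at hj
  have hd1 : (1 : ℤ) ≤ d := by exact_mod_cast hd
  have h2 : |(hasseDeriv j h).eval r| ≤ B * (d : ℤ) ^ (k - j) := by
    have hdeg : (hasseDeriv j h).natDegree < k - j + 1 := by
      have := natDegree_hasseDeriv_le h j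
      omega
    rw [eval_eq_sum_range' hdeg]
    calc |∑ i ∈ range (k - j + 1), (hasseDeriv j h).coeff i * r ^ i|
        ≤ ∑ i ∈ range (k - j + 1), |(hasseDeriv j h).coeff i * r ^ i| := abs_sum_le_sum_abs _ _
      _ ≤ ∑ i ∈ range (k - j + 1), |(hasseDeriv j h).coeff i| * (d : ℤ) ^ (k - j) := by
          apply sum_le_sum
          intro i hi
          rw [abs_mul, abs_pow]
          simp only [mem_range] at hi
          gcongr
          calc |r| ^ i ≤ (d : ℤ) ^ i := by gcongr
            _ ≤ (d : ℤ) ^ (k - j) := pow_le_pow_right₀ hd1 (by omega)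
      _ = (∑ i ∈ range (k - j + 1), |(hasseDeriv j h).coeff i|) * (d : ℤ) ^ (k - j) := by rw [sum_mul]
      _ ≤ B * (d : ℤ) ^ (k - j) := by
          gcongr
          rw [hB]
          exact single_le_sum (f := fun j => ∑ i ∈ range (k - j + 1), |(hasseDeriv j h).coeff i|)
            (fun j _ => sum_nonneg fun i _ => abs_nonneg _) (mem_range.2 (by omega))
  calc |(hasseDeriv j h).eval r| * (d : ℤ) ^ j ≤ B * (d : ℤ) ^ (k - j) * (d : ℤ) ^ j := by gcongr
    _ = B * (d : ℤ) ^ k := by rw [mul_assoc, ← pow_add]; congr 2; omega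
    _ ≤ _ := by gcongr; push_cast; rw [abs_of_nonneg hB0]; linarith
end Aux
end BM

namespace BM
open Finset

section Aux
open Polynomial

noncomputable def lamF (e : ℕ → ℕ) (d : ℕ) : ℕ := d.factorization.prod fun p v => p ^ (e p * v)

lemma lamF_mul (e : ℕ → ℕ) (a b : ℕ) (ha : 1 ≤ a) (hb : 1 ≤ b) : lamF e (a * b) = lamF e a * lamF e b := by
  rw [lamF, Nat.factorization_mul (by omega) (by omega), Finsupp.prod_add_index']
  · rfl
  · intro p; simp
  · intro p u v; rw [mul_add, pow_add]

lemma lamF_dvd (e : ℕ → ℕ) (k : ℕ) (he : ∀ p, 1 ≤ e p ∧ e p ≤ k) (d : ℕ) (hd : 1 ≤ d) : d ∣ lamF e d ∧ lamF e d ∣ d ^ k := by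
  have h1 : d = ∏ p ∈ d.factorization.support, p ^ d.factorization p := by
    conv_lhs => rw [← Nat.prod_factorization_pow_eq_self (show d ≠ 0 by omega)]
    rfl
  constructor
  · conv_lhs => rw [h1]
    apply prod_dvd_prod_of_dvd
    intro p _
    apply pow_dvd_pow
    nlinarith [(he p).1]
  · conv_rhs => rw [h1, ← prod_pow]
    apply prod_dvd_prod_of_dvd
    intro p _
    rw [← pow_mul]
    apply pow_dvd_pow
    nlinarith [(he p).2]

lemma r_ex (ap : ℕ → ℕ → ℕ) (d : ℕ) (hd : 1 ≤ d) :
    ∃ r : ℤ, -(d : ℤ) < r ∧ r ≤ 0 ∧ ∀ p : ℕ, p.Prime → (p ^ d.factorization p : ℤ) ∣ r - ap p (d.factorization p) := by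
  have hs : ∀ p ∈ d.primeFactors, p ^ d.factorization p ≠ 0 := fun p hp =>
    pow_ne_zero _ (Nat.prime_of_mem_primeFactors hp).ne_zero
  have pp : Set.Pairwise (d.primeFactors : Set ℕ) (Function.onFun Nat.Coprime (fun p => p ^ d.factorization p)) := by
    intro p hp q hq hpq
    exact Nat.Coprime.pow _ _ ((Nat.coprime_primes (Nat.prime_of_mem_primeFactors hp) (Nat.prime_of_mem_primeFactors hq)).2 hpq)
  obtain ⟨y, hy⟩ := Nat.chineseRemainderOfFinset (fun p => ap p (d.factorization p)) (fun p => p ^ d.factorization p)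
    d.primeFactors hs pp
  have hd0 : (0 : ℤ) < d := by exact_mod_cast hd
  refine ⟨-((-(y : ℤ)) % d), ?_, ?_, ?_⟩
  · have := Int.emod_lt_of_pos (-(y : ℤ)) hd0; linarith
  · have := Int.emod_nonneg (-(y : ℤ)) hd0.ne'; linarith
  · intro p hp
    by_cases hpd : p ∣ d
    · have h1 := hy p (Nat.mem_primeFactors.2 ⟨hp, hpd, by omega⟩)
      have h2 : (p ^ d.factorization p : ℤ) ∣ y - ap p (d.factorization p) := by
        have := (Nat.modEq_iff_dvd.1 h1.symm); push_cast at this; exact this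
      have h3 : (p ^ d.factorization p : ℤ) ∣ d := by exact_mod_cast Nat.ordProj_dvd d p
      have h4 : -((-(y : ℤ)) % d) = y + d * ((-(y : ℤ)) / d) := by
        have := Int.mul_ediv_add_emod (-(y : ℤ)) d
        linarith
      rw [h4, add_sub_right_comm]
      exact dvd_add h2 (h3.mul_right _)
    · rw [Nat.factorization_eq_zero_of_not_dvd hpd, pow_zero]; exact one_dvd _

theorem aux_poly (k : ℕ) (hk : 1 ≤ k) (h : ℤ[X]) (hdeg : h.natDegree = k)
    (hi : ∀ q : ℕ, 0 < q → ∃ n : ℤ, (q : ℤ) ∣ h.eval n) :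
    ∃ (R Ch : ℕ) (lam : ℕ → ℕ) (g : ℕ → ℤ[X]), 1 ≤ R ∧ 1 ≤ Ch ∧
      (∀ a b, 1 ≤ a → 1 ≤ b → lam (a * b) = lam a * lam b) ∧ (∀ d, 1 ≤ d → d ∣ lam d ∧ lam d ∣ d ^ k) ∧
      (∀ d, 1 ≤ d → (g d).natDegree = k) ∧ (∀ d, 1 ≤ d → ∀ j, |(g d).coeff j| ≤ Ch * (d : ℤ) ^ k) ∧
      (∀ d, 1 ≤ d → ∀ z : ℤ, (∀ j, 1 ≤ j → z ∣ (g d).coeff j) → z ∣ R) ∧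
      (∀ d b n : ℕ, 1 ≤ d → 1 ≤ b → 1 ≤ n → ∃ m : ℕ, 1 ≤ m ∧ (lam b : ℤ) * (g (d * b)).eval (n : ℤ) = (g d).eval (m : ℤ)) ∧
      g 1 = h := by
  have h0 : h ≠ 0 := by rintro rfl; simp at hdeg; omega
  obtain ⟨R, hR, hloc⟩ := loc_int h h0 hi
  obtain ⟨Ch, hCh, hcb⟩ := coeff_bd h
  have hloc' : ∀ p : ℕ, ∃ e : ℕ, 1 ≤ e ∧ e ≤ k ∧ ∃ ap : ℕ → ℕ, p.Prime →
      (∀ v v', v ≤ v' → (p ^ v : ℤ) ∣ ap v' - ap v) ∧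
      ∀ (d v d' : ℕ) (r : ℤ), d = p ^ v * d' → ¬ p ∣ d' → (p ^ v : ℤ) ∣ r - ap v →
        (∀ j, (p ^ (e * v) : ℤ) ∣ (h.comp (C r + C (d : ℤ) * X)).coeff j) ∧
        ∀ (g : ℤ[X]) (l : ℤ), C (p ^ (e * v) * l) * g = h.comp (C r + C (d : ℤ) * X) →
          ∀ s, (∀ j, 1 ≤ j → (p ^ s : ℤ) ∣ g.coeff j) → (p ^ s : ℤ) ∣ R := by
    intro p
    by_cases hp : p.Prime
    · obtain ⟨e, h1, h2, ap, h3⟩ := hloc p hp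
      exact ⟨e, h1, hdeg ▸ h2, ap, fun _ => h3⟩
    · exact ⟨1, le_rfl, hk, fun _ => 0, fun h => absurd h hp⟩
  choose e he1 he2 ap hap using hloc'
  have hr : ∀ d : ℕ, ∃ r : ℤ, 1 ≤ d → -(d : ℤ) < r ∧ r ≤ 0 ∧ ∀ p : ℕ, p.Prime →
      (p ^ d.factorization p : ℤ) ∣ r - ap p (d.factorization p) := by
    intro d
    by_cases hd : 1 ≤ d
    · obtain ⟨r, h⟩ := r_ex ap d hd
      exact ⟨r, fun _ => h⟩
    · exact ⟨0, fun h => absurd h hd⟩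
  choose r hr using hr
  have hfac : ∀ d : ℕ, 1 ≤ d → ∀ p : ℕ, p.Prime → d = p ^ d.factorization p * (d / p ^ d.factorization p) ∧
      ¬ p ∣ d / p ^ d.factorization p := fun d hd p hp =>
    ⟨(Nat.ordProj_mul_ordCompl_eq_self d p).symm, Nat.not_dvd_ordCompl hp (by omega)⟩
  have hg : ∀ d : ℕ, ∃ g : ℤ[X], 1 ≤ d → C ((lamF e d : ℕ) : ℤ) * g = h.comp (C (r d) + C (d : ℤ) * X) := by
    intro d
    by_cases hd : 1 ≤ d
    · have : C ((lamF e d : ℕ) : ℤ) ∣ h.comp (C (r d) + C (d : ℤ) * X) := by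
        rw [C_dvd_iff_dvd_coeff]
        intro j
        rw [lamF, Finsupp.prod]
        push_cast
        apply Finset.prod_dvd_of_coprime
        · intro p hp q hq hpq
          have := (Nat.coprime_primes (Nat.prime_of_mem_primeFactors hp) (Nat.prime_of_mem_primeFactors hq)).2 hpq
          exact (Nat.isCoprime_iff_coprime.2 this).pow
        · intro p hp
          have hpp := Nat.prime_of_mem_primeFactors hp
          exact ((hap p hpp).2 d _ _ (r d) (hfac d hd p hpp).1 (hfac d hd p hpp).2 ((hr d hd).2.2 p hpp)).1 j
      obtain ⟨g, hg⟩ := this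
      exact ⟨g, fun _ => hg.symm⟩
    · exact ⟨0, fun h => absurd h hd⟩
  choose g hg using hg
  have hlam0 : ∀ d, 1 ≤ d → 1 ≤ lamF e d := by
    intro d hd
    have := (lamF_dvd e k (fun p => ⟨he1 p, he2 p⟩) d hd).2
    exact Nat.pos_of_dvd_of_pos this (by positivity)
  have hdegg : ∀ d, 1 ≤ d → (g d).natDegree = k := by
    intro d hd
    have h1 := congrArg natDegree (hg d hd)
    have hl := hlam0 d hd
    rw [natDegree_C_mul (by exact_mod_cast (show lamF e d ≠ 0 by omega)), natDegree_comp, hdeg] at h1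
    rw [h1, add_comm, natDegree_linear (by exact_mod_cast (show d ≠ 0 by omega)), mul_one]
  refine ⟨R, Ch, lamF e, g, hR, hCh, lamF_mul e, lamF_dvd e k (fun p => ⟨he1 p, he2 p⟩), hdegg, ?_, ?_, ?_, ?_⟩
  · intro d hd j
    have hl := hlam0 d hd
    have h1 : (lamF e d : ℤ) * (g d).coeff j = (h.comp (C (r d) + C (d : ℤ) * X)).coeff j := by
      rw [← hg d hd, coeff_C_mul]
    have h2 := hcb d (r d) hd (abs_le.2 ⟨(hr d hd).1.le, (hr d hd).2.1.trans (by positivity)⟩) j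
    rw [← h1, abs_mul, hdeg] at h2
    have h3 : (1 : ℤ) ≤ |(lamF e d : ℤ)| := by rw [Nat.abs_cast]; exact_mod_cast hl
    nlinarith [abs_nonneg ((g d).coeff j)]
  · intro d hd z hz
    have hz0 : z ≠ 0 := by
      rintro rfl
      have := hz k hk
      rw [zero_dvd_iff, ← hdegg d hd, coeff_natDegree, leadingCoeff_eq_zero] at this
      have h2 := hdegg d hd
      rw [this] at h2; simp at h2; omega
    rw [← Int.natAbs_dvd]
    have : z.natAbs ∣ R := by
      rw [Nat.dvd_iff_prime_pow_dvd_dvd]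
      intro p s hp hps
      have h1 := ((hap p hp).2 d _ _ (r d) (hfac d hd p hp).1 (hfac d hd p hp).2 ((hr d hd).2.2 p hp)).2 (g d)
      have h2 : p ^ (e p * d.factorization p) ∣ lamF e d := by
        by_cases hpd : p ∣ d
        · exact dvd_prod_of_mem (fun p => p ^ (e p * d.factorization p)) (Nat.mem_primeFactors.2 ⟨hp, hpd, by omega⟩)
        · rw [Nat.factorization_eq_zero_of_not_dvd hpd]; simp
      obtain ⟨l, hl⟩ := h2
      have h3 := h1 l (by rw [← hg d hd, hl]; push_cast; rfl) s (by
        intro j hj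
        have h4 : ((p ^ s : ℕ) : ℤ) ∣ z := Int.natCast_dvd.2 hps
        push_cast at h4
        exact h4.trans (hz j hj))
      exact_mod_cast h3
    exact_mod_cast this
  · intro d b n hd hb hn
    have hdb : 1 ≤ d * b := Nat.mul_pos hd hb
    obtain ⟨a1, a2, a3⟩ := hr d hd
    obtain ⟨b1, b2, b3⟩ := hr (d * b) hdb
    have hdvd : (d : ℤ) ∣ r (d * b) - r d := by
      have h1 : (d : ℤ) = ∏ p ∈ d.primeFactors, (p ^ d.factorization p : ℤ) := by
        have : d = ∏ p ∈ d.primeFactors, p ^ d.factorization p := by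
          conv_lhs => rw [← Nat.prod_factorization_pow_eq_self (show d ≠ 0 by omega)]
          rfl
        exact_mod_cast this
      rw [h1]
      apply Finset.prod_dvd_of_coprime
      · intro p hp q hq hpq
        have := (Nat.coprime_primes (Nat.prime_of_mem_primeFactors hp) (Nat.prime_of_mem_primeFactors hq)).2 hpq
        exact (Nat.isCoprime_iff_coprime.2 this).pow
      · intro p hp
        have hpp := Nat.prime_of_mem_primeFactors hp
        have hle : d.factorization p ≤ (d * b).factorization p := by
          rw [Nat.factorization_mul (by omega) (by omega)]; simp
        have c1 := (pow_dvd_pow (p : ℤ) hle).trans (b3 p hpp)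
        have c2 := (hap p hpp).1 _ _ hle
        have c3 := a3 p hpp
        have := dvd_sub (dvd_add c1 c2) c3
        convert this using 1
        ring
    obtain ⟨m', hm'⟩ := hdvd
    have hd0 : (0 : ℤ) < d := by exact_mod_cast hd
    have hb0 : (0 : ℤ) < b := by exact_mod_cast hb
    have hn0 : (1 : ℤ) ≤ n := by exact_mod_cast hn
    have hm : (0 : ℤ) < m' + b * n := by
      have h1 : 0 < (d : ℤ) * (m' + b * n) := by
        push_cast at b1
        have : (d : ℤ) * b * 1 ≤ d * b * n := by gcongr
        nlinarith
      exact pos_of_mul_pos_right h1 hd0.le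
    obtain ⟨m, hmm⟩ := Int.eq_ofNat_of_zero_le hm.le
    refine ⟨m, by omega, ?_⟩
    have e1 : (lamF e d : ℤ) * (g d).eval (m : ℤ) = h.eval (r d + d * m) := by
      have := congrArg (eval (m : ℤ)) (hg d hd)
      simpa [eval_comp] using this
    have e2 : (lamF e (d * b) : ℤ) * (g (d * b)).eval (n : ℤ) = h.eval (r (d * b) + d * b * n) := by
      have := congrArg (eval (n : ℤ)) (hg (d * b) hdb)
      simpa [eval_comp] using this
    have e3 : r (d * b) + d * b * n = r d + d * m := by
      have : ((m : ℕ) : ℤ) = m' + b * n := by rw [hmm]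
      rw [this]; linear_combination hm'
    rw [e3, ← e1, lamF_mul e d b hd hb] at e2
    have hl : (lamF e d : ℤ) ≠ 0 := by exact_mod_cast (show lamF e d ≠ 0 by have := hlam0 d hd; omega)
    apply mul_left_cancel₀ hl
    rw [← e2]; push_cast; ring
  · have h1 := hg 1 le_rfl
    have h2 : lamF e 1 = 1 := by simp [lamF]
    obtain ⟨a1, a2, -⟩ := hr 1 le_rfl
    have h3 : r 1 = 0 := by push_cast at a1; omega
    rw [h2, h3] at h1
    simpa using h1
end Aux
end BM

namespace BM
open Finset

structure LamG (k R Ch : ℕ) (lam : ℕ → ℕ) (g : ℕ → Polynomial ℤ) : Prop where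
  hR : 1 ≤ R
  hCh : 1 ≤ Ch
  mul : ∀ a b, 1 ≤ a → 1 ≤ b → lam (a * b) = lam a * lam b
  dvd : ∀ d, 1 ≤ d → d ∣ lam d ∧ lam d ∣ d ^ k
  deg : ∀ d, 1 ≤ d → (g d).natDegree = k
  coef : ∀ d : ℕ, 1 ≤ d → ∀ j, |(g d).coeff j| ≤ Ch * (d : ℤ) ^ k
  cont : ∀ d, 1 ≤ d → ∀ z : ℤ, (∀ j, 1 ≤ j → z ∣ (g d).coeff j) → z ∣ R
  sol : ∀ d b n : ℕ, 1 ≤ d → 1 ≤ b → 1 ≤ n → ∃ m : ℕ, 1 ≤ m ∧ (lam b : ℤ) * (g (d * b)).eval (n : ℤ) = (g d).eval (m : ℤ)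

def NoSol (A : Finset ℤ) (p : Polynomial ℤ) : Prop :=
  ∀ x ∈ A, ∀ m : ℕ, 1 ≤ m → p.eval (m : ℤ) ≠ 0 → x + p.eval (m : ℤ) ∉ A

lemma root_ex (k B N : ℕ) (hk : 1 ≤ k) (hB : 1 ≤ B) : ∃ Y, B * Y ^ k ≤ N ∧ N < B * (Y + 1) ^ k := by
  have hex : ∃ Y, N < B * (Y + 1) ^ k := ⟨N, by
    have : N + 1 ≤ (N + 1) ^ k := Nat.le_self_pow (by omega) _
    nlinarith⟩
  refine ⟨Nat.find hex, ?_, Nat.find_spec hex⟩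
  rcases Nat.eq_zero_or_pos (Nat.find hex) with h | h
  · rw [h, zero_pow (by omega)]; simp
  · have := Nat.find_min hex (show Nat.find hex - 1 < Nat.find hex by omega)
    rw [Nat.sub_add_cancel h] at this
    omega

lemma eval_bd (p : Polynomial ℤ) (k H Y m : ℕ) (hd : p.natDegree = k) (hc : ∀ j, |p.coeff j| ≤ (H : ℤ)) (hm : m ≤ Y) (hY : 1 ≤ Y) :
    |p.eval (m : ℤ)| ≤ ((k + 1) * H * Y ^ k : ℕ) := by
  rw [Polynomial.eval_eq_sum_range, hd]
  refine (abs_sum_le_sum_abs _ _).trans ?_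
  have : ∀ j ∈ range (k + 1), |p.coeff j * (m : ℤ) ^ j| ≤ (H : ℤ) * (Y : ℤ) ^ k := by
    intro j hj
    rw [mem_range] at hj
    rw [abs_mul, abs_pow, Nat.abs_cast]
    have h1 : (m : ℤ) ^ j ≤ (Y : ℤ) ^ k := by
      exact_mod_cast (Nat.pow_le_pow_left hm j).trans (Nat.pow_le_pow_right hY (by omega))
    have := hc j
    gcongr
  refine (sum_le_card_nsmul _ _ _ this).trans ?_
  simp
  ring_nf
  rfl

lemma lam_one {k R Ch : ℕ} {lam : ℕ → ℕ} {g : ℕ → Polynomial ℤ} (hG : LamG k R Ch lam g) : lam 1 = 1 := by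
  have := (hG.dvd 1 le_rfl).2
  simpa using this

lemma lam_prod {k R Ch : ℕ} {lam : ℕ → ℕ} {g : ℕ → Polynomial ℤ} (hG : LamG k R Ch lam g) {ι : Type*} [DecidableEq ι]
    (V : Finset ι) (f : ι → ℕ) (hf : ∀ i, 1 ≤ f i) : lam (∏ i ∈ V, f i) = ∏ i ∈ V, lam (f i) := by
  induction V using Finset.induction_on with
  | empty => simp [lam_one hG]
  | insert a s ha ih =>
    rw [prod_insert ha, prod_insert ha, hG.mul _ _ (hf a) (Finset.one_le_prod' fun i _ => hf i), ih]

lemma sum_fA_AP (A : Finset ℤ) (x : ℤ) (q l : ℕ) :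
    ∑ s ∈ range l, fA A (x + (q * s : ℕ)) = (((Ico (0 : ℤ) l).filter fun s => x + q * s ∈ A).card : ℝ) := by
  have : ((Ico (0 : ℤ) l).filter fun s => x + q * s ∈ A) = ((range l).filter fun s : ℕ => x + q * (s : ℤ) ∈ A).map ⟨fun s : ℕ => (s : ℤ), Nat.cast_injective⟩ := by
    ext s
    simp only [mem_filter, mem_Ico, mem_map, mem_range, Function.Embedding.coeFn_mk]
    constructor
    · rintro ⟨⟨h1, h2⟩, h3⟩
      lift s to ℕ using h1
      exact ⟨s, ⟨by exact_mod_cast h2, h3⟩, rfl⟩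
    · rintro ⟨t, ⟨h1, h2⟩, rfl⟩
      exact ⟨⟨by positivity, by exact_mod_cast h1⟩, h2⟩
  rw [this, card_map, card_filter]
  push_cast
  refine sum_congr rfl fun s _ => ?_
  simp [fA]

lemma noSol_sub {k R Ch : ℕ} {lam : ℕ → ℕ} {g : ℕ → Polynomial ℤ} (hG : LamG k R Ch lam g) (A : Finset ℤ) (d b l : ℕ) (x : ℤ)
    (hd : 1 ≤ d) (hb : 1 ≤ b) (hA : NoSol A (g d)) :
    NoSol ((Ico (0 : ℤ) l).filter fun s => x + lam b * s ∈ A) (g (d * b)) := by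
  intro s hs m hm h0 hmem
  rw [mem_filter] at hs hmem
  obtain ⟨m', hm', he⟩ := hG.sol d b m hd hb hm
  refine hA _ hs.2 m' hm' ?_ ?_
  · rw [← he]
    refine mul_ne_zero ?_ h0
    have : 0 < lam b := Nat.pos_of_dvd_of_pos (hG.dvd b hb).2 (by positivity)
    exact_mod_cast this.ne'
  · rw [← he]
    convert hmem.2 using 1
    ring

end BM

namespace BM
open Finset

set_option maxHeartbeats 1000000 in
theorem one_step (k c : ℕ) (hk : 1 ≤ k) (hc1 : 1 ≤ c) (hrat : ∀ (g : Polynomial ℤ) (H0 R T Y : ℕ) (θ : ℝ), g.natDegree = k →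
      (∀ j, |g.coeff j| ≤ H0) → (∀ z : ℤ, (∀ j, 1 ≤ j → z ∣ g.coeff j) → z ∣ R) → 2 ≤ T →
      4 * T ^ (2 * c) * H0 < Y → (Y : ℝ) ≤ T * ‖∑ n ∈ range Y, ee (θ * ((g.eval (n : ℤ) : ℤ) : ℝ))‖ →
      ∃ q q0 : ℕ, ∃ p : ℤ, 1 ≤ q ∧ q ≤ T ^ c ∧ 1 ≤ q0 ∧ q0 ∣ q * R ∧ |θ - p / q0| * (Y : ℝ) ^ k ≤ (T : ℝ) ^ c)
    {R Ch : ℕ} {lam : ℕ → ℕ} {g : ℕ → Polynomial ℤ} (hG : LamG k R Ch lam g)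
    (r a Q1 T0 X J D W : ℕ) (K : ℝ) (hr : 1 ≤ r) (hQ1 : 1 ≤ Q1) (hK : 4 ≤ K)
    (hK2 : 4 * (4 * r : ℝ) ^ (2 * r) * 2 ^ a ≤ K ^ r) (hKQ : 2 ^ 15 * K ≤ Q1)
    (hRQ : R ≤ Q1 ^ c) (hT0 : 32 * 2 ^ a ≤ T0) (hkT : k + 1 ≤ T0) (hX : T0 ^ c ≤ X) (hJ : T0 ^ c * R ≤ 2 ^ J)
    (hD : T0 < Q1 ^ (D + 1))
    (hW : 2 ^ (12 + k) * (k + 1) * Ch * ((Q1 ^ c).factorial ^ (J * k)) * (X ^ (J * k)) ^ D * T0 ^ (2 * c) * 2 ^ (2 * a) ≤ W)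
    (hW2 : (Q1 ^ c).factorial ^ J * (X ^ J) ^ D ≤ W)
    (hW3 : (X ^ D * (2 * (X ^ (J * k)) ^ D)) ^ (2 * r) * (X ^ (J * k)) ^ ((2 * r + 1) * D) * 2 ^ (2 * r * a) ≤ W)
    (d N l0 : ℕ) (A : Finset ℤ) (α : ℝ) (hd : 1 ≤ d) (hl0 : (d ^ k * W) ^ k ≤ l0) (hN : d ^ k * W * l0 ≤ N)
    (hA : A ⊆ Ico 0 (N : ℤ)) (hcard : (A.card : ℝ) = α * N) (hαa : 1 ≤ α * 2 ^ a) (hα1 : α ≤ 1) (hno : NoSol A (g d)) :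
    ∃ (d' l : ℕ) (A' : Finset ℤ), 1 ≤ d' ∧ d' ≤ d * W ∧ l0 ≤ l ∧ A' ⊆ Ico 0 (l : ℤ) ∧
      (1 + 1 / 1000) * α * l < A'.card ∧ NoSol A' (g d') := by
  classical
  by_contra hcon
  have hα : 0 < α := by
    by_contra h
    have : α * 2 ^ a ≤ 0 := mul_nonpos_of_nonpos_of_nonneg (by linarith) (by positivity)
    linarith
  have hT01 : 1 ≤ T0 := by omega
  have hX1 : 1 ≤ X := le_trans (Nat.one_le_pow _ _ hT01) hX
  set E := (Q1 ^ c).factorial ^ J with hE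
  have hE1 : 1 ≤ E := Nat.one_le_pow _ _ (Nat.factorial_pos _)
  set M := lam E with hM
  have hlpos : ∀ b, 1 ≤ b → 1 ≤ lam b := fun b hb => Nat.pos_of_dvd_of_pos (hG.dvd b hb).2 (by positivity)
  have hM1 : 1 ≤ M := hlpos _ hE1
  have hME : M ≤ (Q1 ^ c).factorial ^ (J * k) := by
    rw [pow_mul]
    exact Nat.le_of_dvd (by positivity) (hG.dvd E hE1).2
  set P : prs (Q1 ^ c) X → ℕ := fun i => lam (i.1 ^ J) with hP
  have hpr : ∀ i : prs (Q1 ^ c) X, i.1.Prime ∧ i.1 ≤ X := fun i => by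
    have := i.2
    simp only [mem_filter, mem_Ioc] at this
    exact ⟨this.2, this.1.2⟩
  have hiJ : ∀ i : prs (Q1 ^ c) X, 1 ≤ i.1 ^ J := fun i => Nat.one_le_pow _ _ (hpr i).1.pos
  have : ∀ i, NeZero (P i) := fun i => ⟨Nat.one_le_iff_ne_zero.1 (hlpos _ (hiJ i))⟩
  set Pm := X ^ (J * k) with hPm
  have hPm1 : 1 ≤ Pm := Nat.one_le_pow _ _ hX1
  have hPle : ∀ i, P i ≤ Pm := fun i => by
    refine (Nat.le_of_dvd (by have := hiJ i; positivity) (hG.dvd _ (hiJ i)).2).trans ?_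
    rw [← pow_mul]
    exact Nat.pow_le_pow_left (hpr i).2 _
  have hcop : ∀ i j, i ≠ j → Nat.Coprime (P i) (P j) := by
    intro i j hij
    refine Nat.Coprime.of_dvd (hG.dvd _ (hiJ i)).2 (hG.dvd _ (hiJ j)).2 ?_
    apply Nat.Coprime.pow
    apply Nat.Coprime.pow
    exact (Nat.coprime_primes (hpr i).1 (hpr j).1).2 fun h => hij (Subtype.ext h)
  have hPJ : ∀ i, i.1 ^ J ∣ P i := fun i => (hG.dvd _ (hiJ i)).1
  have hcardι : Fintype.card (prs (Q1 ^ c) X) ≤ X := by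
    rw [Fintype.card_coe]
    refine (card_filter_le _ _).trans ?_
    simp
  have hNI : ∀ V : Finset (prs (Q1 ^ c) X), V.card ≤ D → ∀ x : ℤ, ∀ l ≥ l0,
      ∑ s ∈ range l, fA A (x + (M * (∏ i ∈ V, P i) * s : ℕ)) ≤ (1 + 1 / 1000) * α * l := by
    intro V hV x l hl
    by_contra hlt
    push Not at hlt
    set EV := ∏ i ∈ V, i.1 ^ J with hEV
    have hEV1 : 1 ≤ EV := Finset.one_le_prod' fun i _ => hiJ i
    have hMV : M * ∏ i ∈ V, P i = lam (E * EV) := by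
      rw [hG.mul _ _ hE1 hEV1, hEV, lam_prod hG V (fun i => i.1 ^ J) hiJ]
    rw [hMV, sum_fA_AP] at hlt
    refine hcon ⟨d * (E * EV), l, _, ?_, ?_, hl, filter_subset _ _, hlt, noSol_sub hG A d (E * EV) l x hd (Nat.mul_pos hE1 hEV1) hno⟩
    · exact Nat.mul_pos hd (Nat.mul_pos hE1 hEV1)
    · refine Nat.mul_le_mul_left _ (le_trans ?_ hW2)
      refine Nat.mul_le_mul_left _ ?_
      have : EV ≤ (X ^ J) ^ V.card := prod_le_pow_card V _ _ fun i _ => Nat.pow_le_pow_left (hpr i).2 _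
      exact this.trans (Nat.pow_le_pow_right (Nat.one_le_pow _ _ hX1) hV)
  have hW1 : 1 ≤ W := le_trans (Nat.mul_pos hE1 (by positivity)) hW2
  have hdk : 1 ≤ d ^ k := Nat.one_le_pow _ _ hd
  have hWl : d ^ k * W ≤ l0 := le_trans (Nat.le_self_pow (by omega) _) hl0
  have hl01 : 1 ≤ l0 := le_trans (Nat.mul_pos hdk hW1) hWl
  have hWl' : W ≤ l0 := le_trans (Nat.le_mul_of_pos_left _ hdk) hWl
  set n := 2 * Pm ^ D * l0 with hn
  have hPD : 1 ≤ Pm ^ D := Nat.one_le_pow _ _ hPm1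
  have hnl : l0 ≤ n := by rw [hn]; exact Nat.le_mul_of_pos_left _ (by omega)
  have hn1 : 1 ≤ n := hl01.trans hnl
  set H0 := Ch * d ^ k with hH0
  have hCh := hG.hCh
  have hH01 : 1 ≤ H0 := Nat.mul_pos hCh hdk
  set B := 64 * (k + 1) * Ch * d ^ k * 2 ^ a with hB
  have hB1 : 1 ≤ B := by
    rw [hB]
    have : 0 < d ^ k := hdk
    have : 0 < Ch := hCh
    exact Nat.succ_le_of_lt (by positivity)
  obtain ⟨Y, hY1, hY2⟩ := root_ex k B N hk hB1
  have h2a : 1 ≤ 2 ^ a := Nat.one_le_two_pow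
  have hTc : 1 ≤ T0 ^ (2 * c) := Nat.one_le_pow _ _ hT01
  have hbig : B * (2 ^ k * (64 * (M * Pm ^ D * T0 ^ (2 * c) * 2 ^ a))) ≤ d ^ k * W := by
    calc B * (2 ^ k * (64 * (M * Pm ^ D * T0 ^ (2 * c) * 2 ^ a)))
        ≤ B * (2 ^ k * (64 * ((Q1 ^ c).factorial ^ (J * k) * Pm ^ D * T0 ^ (2 * c) * 2 ^ a))) := by gcongr
      _ = d ^ k * (2 ^ (12 + k) * (k + 1) * Ch * ((Q1 ^ c).factorial ^ (J * k)) * Pm ^ D * T0 ^ (2 * c) * 2 ^ (2 * a)) := by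
          rw [hB, pow_add, two_mul a, pow_add]; ring
      _ ≤ d ^ k * W := by gcongr
  have hbig1 : B ≤ d ^ k * W := by
    refine le_trans (Nat.le_mul_of_pos_right _ ?_) hbig
    positivity
  have hYbig : 4 * T0 ^ (2 * c) * H0 < Y := by
    by_contra hle
    push Not at hle
    have h1 : Y + 1 ≤ d ^ k * W := by
      refine le_trans ?_ hbig
      have : Y + 1 ≤ 8 * (T0 ^ (2 * c) * H0) := by
        have h1 : 1 ≤ T0 ^ (2 * c) * H0 := Nat.mul_pos hTc hH01
        rw [mul_assoc] at hle
        linarith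
      refine this.trans ?_
      have e : B * (2 ^ k * (64 * (M * Pm ^ D * T0 ^ (2 * c) * 2 ^ a))) = (8 * (T0 ^ (2 * c) * H0)) * (8 * 64 * (k + 1) * 2 ^ a * 2 ^ k * M * Pm ^ D * 2 ^ a) := by
        rw [hB, hH0]; ring
      rw [e]
      exact Nat.le_mul_of_pos_right _ (by positivity)
    have h2 : N < B * l0 := lt_of_lt_of_le hY2 (Nat.mul_le_mul_left _ ((Nat.pow_le_pow_left h1 k).trans hl0))
    have h3 : B * l0 ≤ d ^ k * W * l0 := Nat.mul_le_mul_right _ hbig1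
    omega
  have hY0 : 1 ≤ Y := by omega
  have hYk : N < B * (2 ^ k * Y ^ k) := by
    refine lt_of_lt_of_le hY2 (Nat.mul_le_mul_left _ ?_)
    rw [← mul_pow]
    exact Nat.pow_le_pow_left (by omega) _
  have hMn : 16 * (M * n * T0 ^ c) ≤ Y ^ k := by
    by_contra hlt
    push Not at hlt
    have h1 : 16 * (M * n * T0 ^ c) ≤ 64 * (M * Pm ^ D * T0 ^ (2 * c) * 2 ^ a) * l0 := by
      have h2 : T0 ^ c ≤ T0 ^ (2 * c) := Nat.pow_le_pow_right hT01 (by omega)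
      have h3 : M * Pm ^ D * T0 ^ c ≤ M * Pm ^ D * T0 ^ (2 * c) * 2 ^ a :=
        (Nat.mul_le_mul_left _ h2).trans (Nat.le_mul_of_pos_right _ h2a)
      calc 16 * (M * n * T0 ^ c) = 32 * (M * Pm ^ D * T0 ^ c) * l0 := by rw [hn]; ring
        _ ≤ 64 * (M * Pm ^ D * T0 ^ (2 * c) * 2 ^ a) * l0 := by gcongr; norm_num
    have h4 : B * (2 ^ k * Y ^ k) ≤ B * (2 ^ k * (64 * (M * Pm ^ D * T0 ^ (2 * c) * 2 ^ a) * l0)) := by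
      gcongr
      exact hlt.le.trans h1
    have h5 : B * (2 ^ k * (64 * (M * Pm ^ D * T0 ^ (2 * c) * 2 ^ a) * l0)) ≤ d ^ k * W * l0 := by
      refine le_trans (le_of_eq ?_) (Nat.mul_le_mul_right l0 hbig)
      ring
    omega
  have hαN : ∀ x : ℝ, x * 2 ^ a ≤ N → x ≤ α * N := by
    intro x hx
    have h2 : (0 : ℝ) < 2 ^ a := by positivity
    refine le_of_mul_le_mul_right (hx.trans ?_) h2
    calc (N : ℝ) ≤ N * (α * 2 ^ a) := le_mul_of_one_le_right (by positivity) hαa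
      _ = α * N * 2 ^ a := by ring
  have hN1 : 1 ≤ N := le_trans (Nat.mul_pos (Nat.mul_pos hdk hW1) hl01) hN
  have hcoef : ∀ j, |(g d).coeff j| ≤ (H0 : ℤ) := by
    intro j
    have := hG.coef d hd j
    rw [hH0]; push_cast; exact this
  have hdeg := hG.deg d hd
  have hg0 : g d ≠ 0 := by
    intro h
    rw [h] at hdeg; simp at hdeg; omega
  have hT0α : 32 ≤ α * T0 := by
    have h : (32 : ℝ) * 2 ^ a ≤ T0 := by exact_mod_cast hT0
    calc (32 : ℝ) ≤ 32 * (α * 2 ^ a) := le_mul_of_one_le_right (by norm_num) hαa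
      _ = α * (32 * 2 ^ a) := by ring
      _ ≤ α * T0 := by gcongr
  set Zs : Finset ℕ := insert 0 ((range Y).filter fun m => (g d).eval (m : ℤ) = 0) with hZs
  have hZc : Zs.card ≤ k + 1 := by
    refine (card_insert_le _ _).trans (Nat.add_le_add_right ?_ 1)
    have h1 : ((range Y).filter fun m : ℕ => (g d).eval (m : ℤ) = 0).card ≤ (g d).roots.toFinset.card := by
      refine card_le_card_of_injOn (fun m : ℕ => (m : ℤ)) ?_ (fun a _ b _ h => Nat.cast_injective h)
      intro m hm
      rw [mem_coe, mem_filter] at hm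
      simp [hg0, hm.2]
    refine h1.trans ((Multiset.toFinset_card_le _).trans ((Polynomial.card_roots' _).trans hdeg.le))
  refine no_step (P := P) N n M Y (k + 1) D A hA α K Q1 hα hα1 hcard hN1 hn1 hY0 ?_ ?_ (fun m => (g d).eval (m : ℤ)) ?_ Zs hZc ?_ ?_
    (by linarith) hKQ (by exact_mod_cast hQ1) ?_ ?_
  · have h1 : (1000 * ((M : ℝ) * n) * 2 ^ a) * 2 ^ a ≤ N := by
      have : 1000 * (M * n) * 2 ^ a * 2 ^ a ≤ N := by
        refine le_trans ?_ hN
        refine le_trans ?_ (Nat.mul_le_mul_right l0 hbig)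
        calc 1000 * (M * n) * 2 ^ a * 2 ^ a = (2000 * (M * Pm ^ D * 2 ^ a * 2 ^ a)) * l0 := by rw [hn]; ring
          _ ≤ (2000 * (M * Pm ^ D * 2 ^ a * 2 ^ a)) * l0 * (Ch * d ^ k * (k + 1) * 2 ^ k * T0 ^ (2 * c)) :=
            Nat.le_mul_of_pos_right _ (by positivity)
          _ ≤ (4096 * (M * Pm ^ D * 2 ^ a * 2 ^ a)) * l0 * (Ch * d ^ k * (k + 1) * 2 ^ k * T0 ^ (2 * c)) := by
            gcongr; norm_num
          _ = _ := by rw [hB]; ring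
      exact_mod_cast this
    have h2 := hαN _ h1
    have h3 : 0 ≤ 1000 * ((M : ℝ) * n) := by positivity
    calc 1000 * ((M : ℝ) * n) ≤ 1000 * ((M : ℝ) * n) * (α * 2 ^ a) := le_mul_of_one_le_right h3 hαa
      _ = α * (1000 * ((M : ℝ) * n) * 2 ^ a) := by ring
      _ ≤ α * (α * N) := by gcongr
      _ = α ^ 2 * N := by ring
  · intro x
    have := hNI ∅ (by simp) x n hnl
    simp only [prod_empty, mul_one] at this
    rw [Fin.sum_univ_eq_sum_range (fun t => fA A (x + (M * t : ℕ))) n]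
    exact this
  · intro m hm
    apply hαN
    have h1 := eval_bd (g d) k H0 Y m hdeg hcoef hm.le hY0
    have h1' : |(((g d).eval (m : ℤ) : ℤ) : ℝ)| ≤ ((k + 1) * H0 * Y ^ k : ℕ) := by exact_mod_cast h1
    calc 64 * |(((g d).eval (m : ℤ) : ℤ) : ℝ)| * 2 ^ a ≤ 64 * ((k + 1) * H0 * Y ^ k : ℕ) * 2 ^ a := by gcongr
      _ = ((B * Y ^ k : ℕ) : ℝ) := by rw [hB, hH0]; push_cast; ring
      _ ≤ N := by exact_mod_cast hY1
  · intro m hm hmZ x hx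
    simp only [hZs, mem_insert, mem_filter, mem_range, not_or, not_and] at hmZ
    exact hno x hx m (by omega) (hmZ.2 hm)
  · have h1 : 32 * (k + 1) * 2 ^ a ≤ Y := by
      have h2 : T0 ^ 2 ≤ T0 ^ (2 * c) := Nat.pow_le_pow_right hT01 (by omega)
      have h3 : (32 * 2 ^ a) * (k + 1) ≤ T0 * T0 := Nat.mul_le_mul hT0 hkT
      have h4 : T0 ^ (2 * c) ≤ T0 ^ (2 * c) * H0 := Nat.le_mul_of_pos_right _ hH01
      rw [mul_assoc] at hYbig
      rw [pow_two] at h2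
      linarith
    have h1' : 32 * ((k : ℝ) + 1) * 2 ^ a ≤ Y := by exact_mod_cast h1
    push_cast
    calc 32 * ((k : ℝ) + 1) ≤ 32 * ((k : ℝ) + 1) * (α * 2 ^ a) := le_mul_of_one_le_right (by positivity) hαa
      _ = α * (32 * ((k : ℝ) + 1) * 2 ^ a) := by ring
      _ ≤ α * Y := by gcongr
  · intro θ
    exact hmaj_of k c hc1 hrat (g d) H0 R T0 Y Q1 X J D M n α hα hα1 P hcop hPJ hdeg hcoef (hG.cont d hd) hG.hR hRQ hQ1
      hT0α hX hJ hD (hG.dvd E hE1).1 hYbig hMn θ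
  · intro x e _ he
    refine hlev_of hcop N n M D r X l0 Pm A α K hα hα1 hn1 hr hK ?_ hPm1 hPle hX1 hcardι hl01 le_rfl ?_ hNI x e he
    · have h0 : (0 : ℝ) ≤ 4 * (4 * r : ℝ) ^ (2 * r) := by positivity
      calc 4 * (4 * r : ℝ) ^ (2 * r) ≤ 4 * (4 * r : ℝ) ^ (2 * r) * (α * 2 ^ a) := le_mul_of_one_le_right h0 hαa
        _ = α * (4 * (4 * r : ℝ) ^ (2 * r) * 2 ^ a) := by ring
        _ ≤ α * K ^ r := by gcongr
    · have h1 : (((X : ℝ) ^ D * (2 * (Pm : ℝ) ^ D)) ^ (2 * r) * (Pm : ℝ) ^ ((2 * r + 1) * D)) * 2 ^ (2 * r * a) ≤ n := by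
        exact_mod_cast hW3.trans (hWl'.trans hnl)
      have h2 : 1 ≤ α ^ (2 * r) * 2 ^ (2 * r * a) := by
        rw [mul_comm (2 * r) a, pow_mul 2 a, ← mul_pow]
        exact one_le_pow₀ hαa
      set Q := ((X : ℝ) ^ D * (2 * (Pm : ℝ) ^ D)) ^ (2 * r) * (Pm : ℝ) ^ ((2 * r + 1) * D) with hQ
      have h0 : 0 ≤ Q := by positivity
      calc Q ≤ Q * (α ^ (2 * r) * 2 ^ (2 * r * a)) := le_mul_of_one_le_right h0 h2
        _ = α ^ (2 * r) * (Q * 2 ^ (2 * r * a)) := by ring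
        _ ≤ α ^ (2 * r) * n := by gcongr

end BM

namespace BM
open Finset

def StepP (k W a : ℕ) (g : ℕ → Polynomial ℤ) : Prop :=
  ∀ (d N l0 : ℕ) (A : Finset ℤ) (α : ℝ), 1 ≤ d → (d ^ k * W) ^ k ≤ l0 → d ^ k * W * l0 ≤ N →
    A ⊆ Ico 0 (N : ℤ) → (A.card : ℝ) = α * N → 1 ≤ α * 2 ^ a → α ≤ 1 → NoSol A (g d) →
    ∃ (d' l : ℕ) (A' : Finset ℤ), 1 ≤ d' ∧ d' ≤ d * W ∧ l0 ≤ l ∧ A' ⊆ Ico 0 (l : ℤ) ∧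
      (1 + 1 / 1000) * α * l < A'.card ∧ NoSol A' (g d')

lemma iter_step (k W a : ℕ) (g : ℕ → Polynomial ℤ) (hk : 1 ≤ k) (hW : 1 ≤ W) (hS : StepP k W a g) (s : ℕ) :
    ∀ (d N : ℕ) (A : Finset ℤ), 1 ≤ d → d ^ (k * (s + k)) * W ^ (k * (s + k) ^ 2) ≤ N → A ⊆ Ico 0 (N : ℤ) →
      (N : ℝ) ≤ A.card * 2 ^ a → (N : ℝ) < A.card * (1 + 1 / 1000) ^ s → NoSol A (g d) → False := by
  induction s with
  | zero =>
    intro d N A hd hN hA _ h2 _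
    have := card_le_card hA
    simp only [Int.card_Ico, sub_zero, Int.toNat_natCast] at this
    have : (A.card : ℝ) ≤ N := by exact_mod_cast this
    simp at h2
    linarith
  | succ s ih =>
    intro d N A hd hN hA h1 h2 hno
    have hN1 : 1 ≤ N := le_trans (Nat.mul_pos (Nat.one_le_pow _ _ hd) (Nat.one_le_pow _ _ hW)) hN
    have hNr : (0 : ℝ) < N := by exact_mod_cast hN1
    have hc : (A.card : ℝ) ≤ N := by
      have := card_le_card hA
      simp only [Int.card_Ico, sub_zero, Int.toNat_natCast] at this
      exact_mod_cast this
    obtain ⟨α, hα⟩ : ∃ α : ℝ, α = A.card / N := ⟨_, rfl⟩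
    have hcα : (A.card : ℝ) = α * N := by rw [hα]; field_simp
    set p := k * (s + k) with hp
    set q := k * (s + k) ^ 2 with hq
    have hkp : k * k ≤ p := Nat.mul_le_mul_left _ (by omega)
    have hkp' : k ≤ p := le_trans (Nat.le_mul_of_pos_left _ hk) hkp
    have hpq : p + q + 1 ≤ k * (s + 1 + k) ^ 2 := by rw [hp, hq]; nlinarith
    have hα2 : 1 ≤ α * 2 ^ a := by
      refine le_of_mul_le_mul_right ?_ hNr
      rw [hcα] at h1
      linarith
    have hα3 : 1 < α * (1 + 1 / 1000) ^ (s + 1) := by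
      refine lt_of_mul_lt_mul_right ?_ hNr.le
      rw [hcα] at h2
      linarith
    have hα1 : α ≤ 1 := by rw [hα, div_le_one hNr]; exact hc
    obtain ⟨d', l, A', hd', hd'W, hl, hA', hcard', hno'⟩ := hS d N (d ^ p * W ^ (p + q)) A α hd (by
        rw [mul_pow, ← pow_mul]
        exact Nat.mul_le_mul (Nat.pow_le_pow_right hd hkp) (Nat.pow_le_pow_right hW (by omega))) (by
        refine le_trans ?_ hN
        calc d ^ k * W * (d ^ p * W ^ (p + q)) = d ^ (p + k) * W ^ (p + q + 1) := by ring
          _ ≤ _ := Nat.mul_le_mul (Nat.pow_le_pow_right hd (by rw [hp]; apply le_of_eq; ring)) (Nat.pow_le_pow_right hW hpq))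
      hA hcα hα2 hα1 hno
    have hl1 : d' ^ p * W ^ q ≤ l := by
      refine le_trans ?_ hl
      rw [pow_add, ← mul_assoc, ← mul_pow]
      exact Nat.mul_le_mul_right _ (Nat.pow_le_pow_left hd'W _)
    have hl0 : (0 : ℝ) < l := by
      have : 1 ≤ l := le_trans (Nat.mul_pos (Nat.one_le_pow _ _ hd') (Nat.one_le_pow _ _ hW)) hl1
      exact_mod_cast this
    have hαpos : 0 < α := by
      by_contra h
      have : α * 2 ^ a ≤ 0 := mul_nonpos_of_nonpos_of_nonneg (by linarith) (by positivity)
      linarith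
    refine ih d' l A' hd' hl1 hA' ?_ ?_ hno'
    · calc (l : ℝ) ≤ l * (α * 2 ^ a) := le_mul_of_one_le_right hl0.le hα2
        _ = 1 * α * l * 2 ^ a := by ring
        _ ≤ (1 + 1 / 1000) * α * l * 2 ^ a := by gcongr; norm_num
        _ ≤ A'.card * 2 ^ a := by gcongr
    · calc (l : ℝ) < l * (α * (1 + 1 / 1000) ^ (s + 1)) := by
            conv_lhs => rw [← mul_one (l : ℝ)]
            exact mul_lt_mul_of_pos_left hα3 hl0
        _ = (1 + 1 / 1000) * α * l * (1 + 1 / 1000) ^ s := by rw [pow_succ]; ring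
        _ ≤ A'.card * (1 + 1 / 1000) ^ s := by gcongr

lemma iter_final (k W a : ℕ) (g : ℕ → Polynomial ℤ) (hk : 1 ≤ k) (hW : 1 ≤ W) (ha : 1 ≤ a) (hS : StepP k W a g)
    (N : ℕ) (A : Finset ℤ) (hN : W ^ (k * (1000 * a + k) ^ 2) ≤ N) (hA : A ⊆ Ico 0 (N : ℤ)) (hno : NoSol A (g 1)) :
    (A.card : ℝ) * 2 ^ a ≤ N := by
  by_contra h
  push Not at h
  refine iter_step k W a g hk hW hS (1000 * a) 1 N A le_rfl (by simpa using hN) hA h.le ?_ hno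
  refine h.trans_le ?_
  gcongr
  rw [pow_mul]
  gcongr
  have := one_add_mul_le_pow (show (-2 : ℝ) ≤ 1 / 1000 by norm_num) 1000
  refine le_trans ?_ this
  norm_num

end BM

namespace BM
open Finset

lemma sq_le_two_pow' (r : ℕ) (hr : 4 ≤ r) : r * r ≤ 2 ^ r := by
  induction r, hr using Nat.le_induction with
  | base => norm_num
  | succ n hn ih => rw [pow_succ]; nlinarith

lemma num_bounds (k c r a v e J S f : ℕ) (hv : 22 ≤ v) (hk : k ≤ v) (hc : c ≤ v) (hr : r ≤ v) (ha : a ≤ v ^ 2)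
    (hS : 1 ≤ S) (he : e = (a + 5) * c) (hJ : J = e + v) (hf : f = 3 * v * c * S) :
    (12 + k) + k + v + f * (J * k) + e * (J * k) * r + (a + 5) * (2 * c) + 2 * a ≤ v ^ 20 * S ∧
    f * J + e * J * r ≤ v ^ 20 * S ∧
    (e * r + (1 + e * (J * k) * r)) * (2 * r) + e * (J * k) * ((2 * r + 1) * r) + 2 * r * a ≤ v ^ 20 * S ∧
    k * (1000 * a + k) ^ 2 ≤ v ^ 13 := by
  have h1v : 1 ≤ v := by omega
  have ha5 : a + 5 ≤ v ^ 3 := by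
    have : v ^ 3 = v * v ^ 2 := by ring
    nlinarith
  have he' : e ≤ v ^ 4 := by
    rw [he]
    calc (a + 5) * c ≤ v ^ 3 * v := Nat.mul_le_mul ha5 hc
      _ = v ^ 4 := by ring
  have hv4 : v ≤ v ^ 4 := Nat.le_self_pow (by norm_num) _
  have hJ' : J ≤ v ^ 5 := by
    rw [hJ]
    calc e + v ≤ 2 * v ^ 4 := by omega
      _ ≤ v * v ^ 4 := Nat.mul_le_mul_right _ (by omega)
      _ = v ^ 5 := by ring
  have hf' : f ≤ v ^ 3 * S := by
    rw [hf]
    calc 3 * v * c * S ≤ v * v * v * S := by gcongr; omega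
      _ = v ^ 3 * S := by ring
  have key : ∀ i ≤ 18, v ^ i ≤ v ^ 18 * S := fun i hi =>
    (Nat.pow_le_pow_right h1v hi).trans (Nat.le_mul_of_pos_right _ hS)
  have keyS : ∀ i ≤ 18, v ^ i * S ≤ v ^ 18 * S := fun i hi =>
    Nat.mul_le_mul_right _ (Nat.pow_le_pow_right h1v hi)
  have hF : 20 * (v ^ 18 * S) ≤ v ^ 20 * S := by
    calc 20 * (v ^ 18 * S) ≤ v * v * (v ^ 18 * S) := Nat.mul_le_mul_right _ (by nlinarith)
      _ = v ^ 20 * S := by ring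
  have t1 : v ≤ v ^ 18 * S := by simpa using key 1 (by norm_num)
  have t2 : f * (J * k) ≤ v ^ 18 * S := by
    calc f * (J * k) ≤ v ^ 3 * S * (v ^ 5 * v) := by gcongr
      _ = v ^ 9 * S := by ring
      _ ≤ _ := keyS 9 (by norm_num)
  have t3 : e * (J * k) * r ≤ v ^ 11 := by
    calc e * (J * k) * r ≤ v ^ 4 * (v ^ 5 * v) * v := by gcongr
      _ = v ^ 11 := by ring
  have t3' := t3.trans (key 11 (by norm_num))
  have t4 : (a + 5) * (2 * c) ≤ 2 * (v ^ 18 * S) := by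
    calc (a + 5) * (2 * c) = 2 * e := by rw [he]; ring
      _ ≤ 2 * v ^ 4 := by omega
      _ ≤ _ := Nat.mul_le_mul_left _ (key 4 (by norm_num))
  have t5 : a ≤ v ^ 18 * S := ha.trans (key 2 (by norm_num))
  have t6 : f * J ≤ v ^ 18 * S := by
    calc f * J ≤ v ^ 3 * S * v ^ 5 := by gcongr
      _ = v ^ 8 * S := by ring
      _ ≤ _ := keyS 8 (by norm_num)
  have t7 : e * J * r ≤ v ^ 18 * S := by
    calc e * J * r ≤ v ^ 4 * v ^ 5 * v := by gcongr
      _ = v ^ 10 := by ring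
      _ ≤ _ := key 10 (by norm_num)
  have t8 : (e * r + (1 + e * (J * k) * r)) * (2 * r) ≤ 6 * (v ^ 18 * S) := by
    have g1 : e * r ≤ v ^ 11 := by
      calc e * r ≤ v ^ 4 * v := by gcongr
        _ = v ^ 5 := by ring
        _ ≤ _ := Nat.pow_le_pow_right h1v (by norm_num)
    have g2 : 1 ≤ v ^ 11 := Nat.one_le_pow _ _ h1v
    calc (e * r + (1 + e * (J * k) * r)) * (2 * r) ≤ (v ^ 11 + (v ^ 11 + v ^ 11)) * (2 * v) := by gcongr
      _ = 6 * v ^ 12 := by ring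
      _ ≤ _ := Nat.mul_le_mul_left _ (key 12 (by norm_num))
  have t9 : e * (J * k) * ((2 * r + 1) * r) ≤ 3 * (v ^ 18 * S) := by
    calc e * (J * k) * ((2 * r + 1) * r) ≤ v ^ 4 * (v ^ 5 * v) * ((2 * v + v) * v) := by gcongr
      _ = 3 * v ^ 12 := by ring
      _ ≤ _ := Nat.mul_le_mul_left _ (key 12 (by norm_num))
  have t10 : 2 * r * a ≤ 2 * (v ^ 18 * S) := by
    calc 2 * r * a ≤ 2 * v * v ^ 2 := by gcongr
      _ = 2 * v ^ 3 := by ring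
      _ ≤ _ := Nat.mul_le_mul_left _ (key 3 (by norm_num))
  refine ⟨?_, ?_, ?_, ?_⟩
  · refine le_trans ?_ hF
    generalize v ^ 18 * S = F at *
    omega
  · refine le_trans ?_ hF
    generalize v ^ 18 * S = F at *
    omega
  · refine le_trans ?_ hF
    generalize v ^ 18 * S = F at *
    omega
  · have g1 : 1000 * a + k ≤ v ^ 6 := by
      have g2 : 1000 ≤ v ^ 3 := le_trans (by norm_num) (Nat.pow_le_pow_left hv 3)
      calc 1000 * a + k ≤ v ^ 3 * v ^ 2 + v ^ 5 := Nat.add_le_add (Nat.mul_le_mul g2 ha) (hk.trans (Nat.le_self_pow (by norm_num) _))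
        _ = 2 * v ^ 5 := by ring
        _ ≤ v * v ^ 5 := Nat.mul_le_mul_right _ (by omega)
        _ = v ^ 6 := by ring
    calc k * (1000 * a + k) ^ 2 ≤ v * (v ^ 6) ^ 2 := by gcongr
      _ = v ^ 13 := by ring

theorem core (k : ℕ) (hk : 1 ≤ k) : ∃ C1 : ℕ, 1 ≤ C1 ∧ ∀ h : Polynomial ℤ, h.natDegree = k →
    (∀ q : ℕ, 0 < q → ∃ n : ℤ, (q : ℤ) ∣ h.eval n) →
    ∃ r0 : ℕ, 1 ≤ r0 ∧ ∀ r ≥ r0, ∀ N : ℕ, 2 ^ 2 ^ (C1 * (2 ^ r / r + 1)) ≤ N → ∀ A : Finset ℤ, A ⊆ Ico 0 (N : ℤ) →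
      NoSol A h → (A.card : ℝ) * 2 ^ 2 ^ r ≤ N := by
  obtain ⟨c, hc1, hrat⟩ := rat_approx k hk
  refine ⟨33 + 3 * c, by omega, fun h hdeg hi => ?_⟩
  obtain ⟨R, Ch, lam, g, q1, q2, q3, q4, q5, q6, q7, q8, q9⟩ := aux_poly k hk h hdeg hi
  have hG : LamG k R Ch lam g := ⟨q1, q2, q3, q4, q5, q6, q7, q8⟩
  refine ⟨22 + R + Ch + k + c, by omega, fun r hr N hN A hA hno => ?_⟩
  rw [← q9] at hno
  obtain ⟨v, hv⟩ : ∃ v, v = 2 ^ r / r + 1 := ⟨_, rfl⟩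
  rw [← hv] at hN
  have hrr := sq_le_two_pow' r (by omega)
  have hrv : r ≤ v := by
    have : r ≤ 2 ^ r / r := (Nat.le_div_iff_mul_le (by omega)).2 hrr
    omega
  obtain ⟨a, ha⟩ : ∃ a, a = 2 ^ r := ⟨_, rfl⟩
  rw [← ha] at hv hrr ⊢
  have harv : a ≤ r * v := by
    rw [hv]
    exact (Nat.lt_mul_div_succ a (by omega)).le
  have hav : a ≤ v ^ 2 := by
    rw [pow_two]
    exact harv.trans (Nat.mul_le_mul_right _ hrv)
  have hra : r ≤ a := le_trans (Nat.le_mul_of_pos_left _ (by omega)) hrr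
  obtain ⟨S, hS⟩ : ∃ S, S = 2 ^ (3 * v * c) := ⟨_, rfl⟩
  have hS1 : 1 ≤ S := by rw [hS]; exact Nat.one_le_two_pow
  obtain ⟨e, he⟩ : ∃ e, e = (a + 5) * c := ⟨_, rfl⟩
  obtain ⟨J, hJ⟩ : ∃ J, J = e + v := ⟨_, rfl⟩
  obtain ⟨f, hf⟩ : ∃ f, f = 3 * v * c * S := ⟨_, rfl⟩
  obtain ⟨b1, b2, b3, b4⟩ := num_bounds k c r a v e J S f (by omega) (by omega) (by omega) hrv hav hS1 he hJ hf
  have hQc : (2 ^ (3 * v)) ^ c = S := by rw [hS, ← pow_mul]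
  have hfac : ((2 ^ (3 * v)) ^ c).factorial ≤ 2 ^ f := by
    rw [hQc, hf, pow_mul, ← hS]
    exact Nat.factorial_le_pow S
  have hvlt : ∀ n, n ≤ v → n ≤ 2 ^ v := fun n hn => hn.trans Nat.lt_two_pow_self.le
  have hT : (2 ^ (a + 5)) ^ c = 2 ^ e := by rw [← pow_mul, he]
  have hTc : (2 ^ (a + 5)) ^ (2 * c) = 2 ^ ((a + 5) * (2 * c)) := by rw [← pow_mul]
  set w := v ^ 20 * S with hw
  have hstep : StepP k (2 ^ w) a g := by
    intro d N l0 A α hd hl0 hN hA hcard hα hα1 hno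
    have hr0 : (0 : ℝ) ≤ r := by positivity
    refine one_step k c hk hc1 hrat hG r a (2 ^ (3 * v)) (2 ^ (a + 5)) (2 ^ e) J r (2 ^ w) (64 * (r : ℝ) ^ 2 * 2 ^ v)
      (by omega) Nat.one_le_two_pow ?_ ?_ ?_ ?_ ?_ ?_ ?_ ?_ ?_ ?_ ?_ ?_ d N l0 A α hd hl0 hN hA hcard hα hα1 hno
    · have h1 : (1 : ℝ) ≤ (r : ℝ) ^ 2 := one_le_pow₀ (by exact_mod_cast (by omega : 1 ≤ r))
      have h2 : (1 : ℝ) ≤ 2 ^ v := one_le_pow₀ (by norm_num)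
      have h3 := mul_le_mul h1 h2 (by norm_num) (by linarith)
      linarith
    · have h1 : (4 : ℝ) ≤ 4 ^ r := le_self_pow₀ (by norm_num) (by omega)
      have h2 : (2 : ℝ) ^ a ≤ (2 ^ v) ^ r := by
        rw [← pow_mul, mul_comm]
        exact pow_le_pow_right₀ (by norm_num) harv
      calc 4 * (4 * r : ℝ) ^ (2 * r) * 2 ^ a ≤ 4 ^ r * (4 * r : ℝ) ^ (2 * r) * (2 ^ v) ^ r := by gcongr
        _ = (64 * (r : ℝ) ^ 2 * 2 ^ v) ^ r := by
            rw [pow_mul, ← mul_pow, ← mul_pow]; congr 1; ring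
    · have h1 : 2 ^ 11 * r ≤ 2 ^ v := by
        obtain ⟨m, rfl⟩ : ∃ m, v = m + 11 := ⟨v - 11, by omega⟩
        rw [pow_add, mul_comm]
        refine Nat.mul_le_mul_right _ ?_
        have : m ≤ 2 ^ (m - 1) := by
          have := @Nat.lt_two_pow_self (m - 1)
          omega
        have e2 : 2 ^ m = 2 * 2 ^ (m - 1) := by rw [← pow_succ']; congr 1; omega
        omega
      have h1' : (2 ^ 11 * r : ℝ) ≤ 2 ^ v := by exact_mod_cast h1
      push_cast
      calc 2 ^ 15 * (64 * (r : ℝ) ^ 2 * 2 ^ v) = 2⁻¹ * (2 ^ 11 * r : ℝ) ^ 2 * 2 ^ v := by ring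
        _ ≤ 1 * (2 ^ v) ^ 2 * 2 ^ v := by gcongr; norm_num
        _ = 2 ^ (3 * v) := by ring
    · rw [hQc, hS]
      refine (hvlt R (by omega)).trans (Nat.pow_le_pow_right (by norm_num) ?_)
      exact le_trans (by omega : v ≤ 3 * v) (Nat.le_mul_of_pos_right _ hc1)
    · rw [pow_add]; omega
    · have : a < 2 ^ a := Nat.lt_two_pow_self
      have e2 : 2 ^ (a + 5) = 2 ^ a * 32 := by rw [pow_add]; norm_num
      omega
    · rw [hT]
    · rw [hT, hJ, pow_add]
      exact Nat.mul_le_mul_left _ (hvlt R (by omega))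
    · rw [← pow_mul]
      refine Nat.pow_lt_pow_right (by norm_num) ?_
      have e2 : 3 * v * (r + 1) = 3 * (r * v) + 3 * v := by ring
      omega
    · have hk2 : k + 1 ≤ 2 ^ k := Nat.lt_two_pow_self
      have hC2 : Ch ≤ 2 ^ v := hvlt Ch (by omega)
      calc 2 ^ (12 + k) * (k + 1) * Ch * (((2 ^ (3 * v)) ^ c).factorial ^ (J * k)) * ((2 ^ e) ^ (J * k)) ^ r * (2 ^ (a + 5)) ^ (2 * c) * 2 ^ (2 * a)
          ≤ 2 ^ (12 + k) * 2 ^ k * 2 ^ v * ((2 ^ f) ^ (J * k)) * ((2 ^ e) ^ (J * k)) ^ r * (2 ^ (a + 5)) ^ (2 * c) * 2 ^ (2 * a) := by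
            gcongr
        _ = 2 ^ ((12 + k) + k + v + f * (J * k) + e * (J * k) * r + (a + 5) * (2 * c) + 2 * a) := by
            simp only [← pow_mul, ← pow_add]
        _ ≤ 2 ^ w := Nat.pow_le_pow_right (by norm_num) b1
    · calc ((2 ^ (3 * v)) ^ c).factorial ^ J * ((2 ^ e) ^ J) ^ r ≤ (2 ^ f) ^ J * ((2 ^ e) ^ J) ^ r := by gcongr
        _ = 2 ^ (f * J + e * J * r) := by simp only [← pow_mul, ← pow_add]
        _ ≤ 2 ^ w := Nat.pow_le_pow_right (by norm_num) b2
    · refine le_trans (le_of_eq ?_) (Nat.pow_le_pow_right (n := 2) (by norm_num) b3)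
      simp only [← pow_mul, pow_add, mul_pow, add_mul, one_mul, mul_add]
  refine iter_final k (2 ^ w) a g hk Nat.one_le_two_pow (by omega) hstep N A ?_ hA hno
  refine le_trans ?_ hN
  rw [← pow_mul]
  refine Nat.pow_le_pow_right (by norm_num) ?_
  calc w * (k * (1000 * a + k) ^ 2) ≤ w * v ^ 13 := Nat.mul_le_mul_left _ b4
    _ = v ^ 33 * S := by rw [hw]; ring
    _ ≤ (2 ^ v) ^ 33 * S := by
        have := @Nat.lt_two_pow_self v
        gcongr
    _ = 2 ^ ((33 + 3 * c) * v) := by rw [hS, ← pow_mul, ← pow_add]; congr 1; ring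

end BM

namespace BM
open Finset

lemma last_ex (P : ℕ → Prop) (r0 : ℕ) (h0 : P r0) (s : ℕ) (hs : r0 ≤ s) (hP : ¬ P s) : ∃ r ≥ r0, P r ∧ ¬ P (r + 1) := by
  by_contra hcon
  push Not at hcon
  refine hP ?_
  induction s, hs using Nat.le_induction with
  | base => exact h0
  | succ n hn ih =>
    by_cases hPn : P n
    · exact hcon n hn hPn
    · exact absurd (ih hPn) hPn

lemma final_num (C1 r N : ℕ) (hC1 : 1 ≤ C1) (hN : 100 ≤ N) (h : N < 2 ^ 2 ^ (C1 * (2 ^ (r + 1) / (r + 1) + 1))) :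
    ((2 : ℝ) ^ 2 ^ r)⁻¹ ≤ Real.log N ^ (-(Real.log 2 / (9 * C1 ^ 2) * Real.log (Real.log (Real.log N)))) := by
  have hN0 : (100 : ℝ) ≤ N := by exact_mod_cast hN
  have hl : 1 < Real.log N := by
    rw [Real.lt_log_iff_exp_lt (by linarith)]
    have := Real.exp_one_lt_d9
    linarith
  have hll : 0 < Real.log (Real.log N) := Real.log_pos hl
  have hlog2 : 0 < Real.log 2 := Real.log_pos (by norm_num)
  have hlog21 : Real.log 2 ≤ 1 := by have := Real.log_two_lt_d9; linarith
  have hC : (1 : ℝ) ≤ C1 := by exact_mod_cast hC1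
  set m := C1 * (2 ^ (r + 1) / (r + 1) + 1) with hm
  have h1 : Real.log N ≤ 2 ^ m := by
    have h2 : (N : ℝ) ≤ 2 ^ 2 ^ m := by exact_mod_cast h.le
    have h3 := Real.log_le_log (by linarith) h2
    rw [Real.log_pow] at h3
    push_cast at h3
    refine h3.trans ?_
    exact mul_le_of_le_one_right (by positivity) hlog21
  have h2 : Real.log (Real.log N) ≤ m := by
    have h3 := Real.log_le_log (by linarith) h1
    rw [Real.log_pow] at h3
    refine h3.trans ?_
    exact mul_le_of_le_one_right (by positivity) hlog21
  have hr1 : (r : ℝ) + 1 ≤ 2 ^ r := by exact_mod_cast (Nat.lt_two_pow_self : r < 2 ^ r)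
  have hr0 : (0 : ℝ) < (r : ℝ) + 1 := by positivity
  have h3 : Real.log (Real.log N) * ((r : ℝ) + 1) ≤ 3 * C1 * 2 ^ r := by
    have h4 : m * (r + 1) ≤ C1 * (2 ^ (r + 1) + (r + 1)) := by
      rw [hm, mul_assoc, add_mul, one_mul]
      exact Nat.mul_le_mul_left _ (Nat.add_le_add_right (Nat.div_mul_le_self _ _) _)
    have h4' : (m : ℝ) * ((r : ℝ) + 1) ≤ C1 * (2 ^ (r + 1) + ((r : ℝ) + 1)) := by exact_mod_cast h4
    calc Real.log (Real.log N) * ((r : ℝ) + 1) ≤ m * ((r : ℝ) + 1) := by gcongr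
      _ ≤ C1 * (2 ^ (r + 1) + ((r : ℝ) + 1)) := h4'
      _ ≤ C1 * (2 ^ (r + 1) + 2 ^ r) := by gcongr
      _ = 3 * C1 * 2 ^ r := by ring
  have h5 : Real.log (Real.log N) ≤ 3 * C1 * 2 ^ r := by
    refine le_trans ?_ h3
    exact le_mul_of_one_le_right hll.le (by linarith [(Nat.cast_nonneg r : (0 : ℝ) ≤ r)])
  have h6 : Real.log (Real.log (Real.log N)) ≤ 3 * C1 * ((r : ℝ) + 1) := by
    have h7 := Real.log_le_log hll h5
    rw [Real.log_mul (by positivity) (by positivity), Real.log_pow] at h7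
    have h8 : Real.log (3 * C1) ≤ 3 * C1 := (Real.log_le_sub_one_of_pos (by positivity)).trans (by linarith)
    have h9 : (r : ℝ) * Real.log 2 ≤ r := mul_le_of_le_one_right (by positivity) hlog21
    have h10 : (r : ℝ) ≤ 3 * C1 * r := le_mul_of_one_le_left (by positivity) (by linarith)
    linarith
  have h7 : Real.log (Real.log N) * Real.log (Real.log (Real.log N)) ≤ 9 * C1 ^ 2 * 2 ^ r := by
    calc Real.log (Real.log N) * Real.log (Real.log (Real.log N)) ≤ Real.log (Real.log N) * (3 * C1 * ((r : ℝ) + 1)) := by gcongr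
      _ = 3 * C1 * (Real.log (Real.log N) * ((r : ℝ) + 1)) := by ring
      _ ≤ 3 * C1 * (3 * C1 * 2 ^ r) := by gcongr
      _ = 9 * C1 ^ 2 * 2 ^ r := by ring
  rw [Real.rpow_def_of_pos (by linarith), ← Real.exp_log (show (0 : ℝ) < 2 ^ 2 ^ r by positivity), ← Real.exp_neg]
  apply Real.exp_le_exp.2
  rw [Real.log_pow, mul_neg, neg_le_neg_iff]
  push_cast
  calc Real.log (Real.log N) * (Real.log 2 / (9 * C1 ^ 2) * Real.log (Real.log (Real.log N)))
      = Real.log 2 / (9 * C1 ^ 2) * (Real.log (Real.log N) * Real.log (Real.log (Real.log N))) := by ring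
    _ ≤ Real.log 2 / (9 * C1 ^ 2) * (9 * C1 ^ 2 * 2 ^ r) := by gcongr
    _ = 2 ^ r * Real.log 2 := by field_simp

end BM

theorem stmt0 (k : ℕ) (hk : 0 < k) :
    ∃ c : ℝ, 0 < c ∧
      ∀ h : Polynomial ℤ, h.natDegree = k →
        (∀ q : ℕ, 0 < q → ∃ n : ℤ, (q : ℤ) ∣ h.eval n) →
        ∃ C : ℝ, 0 < C ∧
          ∀ N : ℕ, 100 ≤ N →
            ∀ A : Finset ℕ, A ⊆ Finset.Icc 1 N →
              (∀ a ∈ A, ∀ b ∈ A, a ≠ b →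
                ∀ n : ℕ, 0 < n → (a : ℤ) - (b : ℤ) ≠ h.eval (n : ℤ)) →
              (A.card : ℝ) ≤
                C * N * Real.log N ^ (-(c * Real.log (Real.log (Real.log N)))) := by
  obtain ⟨C1, hC1, hcore⟩ := BM.core k hk
  have hC1r : (0 : ℝ) < C1 := by exact_mod_cast hC1
  have hlog2 : 0 < Real.log 2 := Real.log_pos (by norm_num)
  refine ⟨Real.log 2 / (9 * C1 ^ 2), by positivity, fun h hdeg hi => ?_⟩
  obtain ⟨r0, hr0, hr⟩ := hcore h hdeg hi
  set c := Real.log 2 / (9 * (C1 : ℝ) ^ 2) with hc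
  set F : ℕ → ℝ := fun N => Real.log N ^ (c * Real.log (Real.log (Real.log N))) with hF
  have hF0 : ∀ N, 0 ≤ F N := fun N => Real.rpow_nonneg (Real.log_natCast_nonneg N) _
  set N0 := 2 ^ 2 ^ (C1 * (2 ^ r0 / r0 + 1)) with hN0
  have hsum : 0 ≤ ∑ n ∈ Finset.range N0, F n := Finset.sum_nonneg fun n _ => hF0 n
  refine ⟨1 + ∑ n ∈ Finset.range N0, F n, by linarith, fun N hN A hA hno => ?_⟩
  have hNr : (100 : ℝ) ≤ N := by exact_mod_cast hN
  have hl : 0 < Real.log N := Real.log_pos (by linarith)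
  set G := Real.log N ^ (-(c * Real.log (Real.log (Real.log N)))) with hG
  have hG0 : 0 < G := Real.rpow_pos_of_pos hl _
  have hcard : (A.card : ℝ) ≤ N := by
    have := Finset.card_le_card hA
    simp only [Nat.card_Icc, Nat.add_sub_cancel] at this
    exact_mod_cast this
  by_cases hlt : N < N0
  · have h1 : F N ≤ ∑ n ∈ Finset.range N0, F n :=
      Finset.single_le_sum (f := F) (fun n _ => hF0 n) (Finset.mem_range.2 hlt)
    have h2 : F N * G = 1 := by
      rw [hF, hG, ← Real.rpow_add hl, add_neg_cancel, Real.rpow_zero]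
    calc (A.card : ℝ) ≤ N := hcard
      _ = F N * G * N := by rw [h2, one_mul]
      _ ≤ (1 + ∑ n ∈ Finset.range N0, F n) * G * N := by gcongr; linarith
      _ = _ := by ring
  · push Not at hlt
    obtain ⟨r, hrr, hP, hnP⟩ := BM.last_ex (fun r => 2 ^ 2 ^ (C1 * (2 ^ r / r + 1)) ≤ N) r0 hlt (r0 + N + 4) (by omega) (by
      push Not
      set s := r0 + N + 4 with hs
      have h1 : s * s ≤ 2 ^ s := BM.sq_le_two_pow' s (by omega)
      have h2 : s ≤ 2 ^ s / s := (Nat.le_div_iff_mul_le (by omega)).2 h1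
      have h3 : N ≤ C1 * (2 ^ s / s + 1) := le_trans (by omega) (Nat.le_mul_of_pos_left _ hC1)
      have h4 : N < 2 ^ N := Nat.lt_two_pow_self
      have h5 : 2 ^ N < 2 ^ 2 ^ N := Nat.lt_two_pow_self
      have h6 : 2 ^ 2 ^ N ≤ 2 ^ 2 ^ (C1 * (2 ^ s / s + 1)) :=
        Nat.pow_le_pow_right (by norm_num) (Nat.pow_le_pow_right (by norm_num) h3)
      omega)
    push Not at hnP
    have hnum := BM.final_num C1 r N hC1 hN hnP
    set A' : Finset ℤ := A.map ⟨fun n : ℕ => (n : ℤ) - 1, fun a b hab => by simpa using hab⟩ with hA'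
    have hA's : A' ⊆ Finset.Ico 0 (N : ℤ) := by
      intro x hx
      rw [hA', Finset.mem_map] at hx
      obtain ⟨n, hn, rfl⟩ := hx
      have := Finset.mem_Icc.1 (hA hn)
      change (n : ℤ) - 1 ∈ Finset.Ico 0 (N : ℤ)
      rw [Finset.mem_Ico]
      omega
    have hno' : BM.NoSol A' h := by
      intro x hx m hm h0 hxm
      rw [hA', Finset.mem_map] at hx hxm
      obtain ⟨b, hb, hb'⟩ := hx
      obtain ⟨a, ha, ha'⟩ := hxm
      change (b : ℤ) - 1 = x at hb'
      change (a : ℤ) - 1 = x + _ at ha'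
      refine hno a ha b hb ?_ m hm (by linarith)
      rintro rfl
      exact h0 (by linarith)
    have hfin := hr r hrr N hP A' hA's hno'
    rw [hA', Finset.card_map] at hfin
    have h1 : (A.card : ℝ) ≤ N * ((2 : ℝ) ^ 2 ^ r)⁻¹ := by
      rw [← div_eq_mul_inv, le_div_iff₀ (by positivity)]
      exact hfin
    calc (A.card : ℝ) ≤ N * ((2 : ℝ) ^ 2 ^ r)⁻¹ := h1
      _ ≤ N * G := by gcongr
      _ = 1 * N * G := by ring
      _ ≤ _ := by gcongr; linarith
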